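/- arXiv:1704.07306 — 2 statements merged into one kernel-verified Lean document; each statement's English description precedes it below -/
import Mathlib

section
/- Let M and M' be GF(4)-representable matroids such that M' is obtained from M by relaxing a circuit-hyperplane X of M. Then M' has path width 3. -/
open Matroid Set
open scoped Classical

namespace Relax

variable {α β : Type*}

/-- A circuit of a matroid: a minimal dependent set. -/
def Circuit (M : Matroid α) (C : Set α) : Prop :=
  M.Dep C ∧ ∀ D ⊂ C, M.Indep D

/-- A hyperplane of a matroid: a maximal proper flat. -/
def Hyperplane (M : Matroid α) (H : Set α) : Prop :=
  M.IsFlat H ∧ H ≠ M.E ∧ ∀ F, M.IsFlat F → H ⊂ F → F = M.E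

/-- `X` is a circuit-hyperplane of `M`. -/
def CircuitHyperplane (M : Matroid α) (X : Set α) : Prop :=
  Circuit M X ∧ Hyperplane M X

/-- `M'` is obtained from `M` by relaxing the circuit-hyperplane `X` : the ground set is
unchanged and the bases of `M'` are exactly the bases of `M` together with `X`. -/
def IsRelaxation (M M' : Matroid α) (X : Set α) : Prop :=
  CircuitHyperplane M X ∧ M'.E = M.E ∧ ∀ B, (M'.IsBase B ↔ M.IsBase B ∨ B = X)

/-- A matroid is representable over a field `F` if there is an assignment of vectors to its
elements under which independence coincides with linear independence. -/
def Representable (M : Matroid α) (F : Type*) [Field F] : Prop :=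
  ∃ (n : ℕ) (φ : α → (Fin n → F)), ∀ I ⊆ M.E,
    (M.Indep I ↔ LinearIndependent F (fun x : I => φ (x : α)))

/-- The field GF(4). -/
abbrev GF4 := GaloisField 2 2

/-- The rank of a set in a matroid: the maximum size of an independent subset. -/
noncomputable def rk (M : Matroid α) (X : Set α) : ℕ :=
  sSup {n | ∃ I, M.Indep I ∧ I ⊆ X ∧ I.ncard = n}

/-- Deletion of a set of elements. -/
def delete (M : Matroid α) (D : Set α) : Matroid α := M ↾ (M.E \ D)

/-- Contraction of a set of elements. -/
def contract (M : Matroid α) (C : Set α) : Matroid α := (delete M✶ C)✶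

/-- `N` is a minor of `M`. -/
def MinorOf (N M : Matroid α) : Prop :=
  ∃ C D, C ⊆ M.E ∧ D ⊆ M.E ∧ Disjoint C D ∧ N = delete (contract M C) D

/-- Isomorphism of matroids. -/
def Iso (M : Matroid α) (N : Matroid β) : Prop :=
  ∃ e : M.E ≃ N.E, ∀ I : Set M.E,
    M.Indep ((↑) '' I) ↔ N.Indep ((↑) '' (e '' I))

/-- `M` has a minor isomorphic to `N`. -/
def HasMinorIso (M : Matroid α) (N : Matroid β) : Prop :=
  ∃ M₀ : Matroid α, MinorOf M₀ M ∧ Iso M₀ N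

/-- `M` has a minor isomorphic to a member of the set `𝒩` of matroids. -/
def HasMinorIn (M : Matroid α) (𝒩 : Set (Matroid β)) : Prop :=
  ∃ N ∈ 𝒩, HasMinorIso M N

/-- `M` is `𝒩`-fragile. -/
def Fragile (M : Matroid α) (𝒩 : Set (Matroid β)) : Prop :=
  HasMinorIn M 𝒩 ∧
    ∀ a ∈ M.E, ¬ (HasMinorIn (delete M {a}) 𝒩 ∧ HasMinorIn (contract M {a}) 𝒩)

/-- `M` is (isomorphic to) the uniform matroid `U_{r,n}`. -/
def IsUniform (M : Matroid α) (r n : ℕ) : Prop :=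
  M.E.Finite ∧ M.E.ncard = n ∧ ∀ I ⊆ M.E, (M.Indep I ↔ I.ncard ≤ r)

/-- `M` has a minor isomorphic to `U_{r,n}`. -/
def HasUnifMinor (M : Matroid α) (r n : ℕ) : Prop :=
  ∃ M₀, MinorOf M₀ M ∧ IsUniform M₀ r n

/-- `M` has a `{U_{2,5}, U_{3,5}}`-minor. -/
def HasU25U35Minor (M : Matroid α) : Prop :=
  HasUnifMinor M 2 5 ∨ HasUnifMinor M 3 5

/-- `M` is `U_{2,4}`-fragile. -/
def FragileU24 (M : Matroid α) : Prop :=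
  HasUnifMinor M 2 4 ∧
    ∀ a ∈ M.E, ¬ (HasUnifMinor (delete M {a}) 2 4 ∧ HasUnifMinor (contract M {a}) 2 4)

/-- `M` is `{U_{2,5}, U_{3,5}}`-fragile. -/
def FragileU25U35 (M : Matroid α) : Prop :=
  HasU25U35Minor M ∧
    ∀ a ∈ M.E, ¬ (HasU25U35Minor (delete M {a}) ∧ HasU25U35Minor (contract M {a}))

/-- A loop. -/
def Loop (M : Matroid α) (x : α) : Prop := x ∈ M.E ∧ ¬ M.Indep {x}

/-- Two distinct non-loop elements are parallel if they form a two-element circuit. -/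
def Parallel (M : Matroid α) (x y : α) : Prop := x ≠ y ∧ Circuit M {x, y}

/-- A parallel class: a maximal set of pairwise-parallel non-loop elements. -/
def ParallelClass (M : Matroid α) (A : Set α) : Prop :=
  A ⊆ M.E ∧ (∀ x ∈ A, ¬ Loop M x) ∧
    (∀ x ∈ A, ∀ y ∈ A, x ≠ y → Parallel M x y) ∧
    (∀ B, A ⊆ B → B ⊆ M.E → (∀ x ∈ B, ¬ Loop M x) →
      (∀ x ∈ B, ∀ y ∈ B, x ≠ y → Parallel M x y) → B = A)

/-- A series class: a parallel class of the dual. -/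
def SeriesClass (M : Matroid α) (A : Set α) : Prop := ParallelClass M✶ A

/-- A matroid is connected if every two distinct elements lie in a common circuit. -/
def Connected (M : Matroid α) : Prop :=
  ∀ x ∈ M.E, ∀ y ∈ M.E, x ≠ y → ∃ C, Circuit M C ∧ x ∈ C ∧ y ∈ C

/-- A `k`-separation of `M`. -/
def Separation (M : Matroid α) (k : ℕ) (A B : Set α) : Prop :=
  A ∪ B = M.E ∧ Disjoint A B ∧ k ≤ A.ncard ∧ k ≤ B.ncard ∧
    rk M A + rk M B ≤ rk M M.E + (k - 1)

/-- A matroid is 3-connected if it is connected and has no 2-separation. -/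
def ThreeConnected (M : Matroid α) : Prop :=
  Connected M ∧ ∀ A B, ¬ Separation M 2 A B

/-- `M` is 3-connected up to series and parallel classes. -/
def ThreeConnUpToSP (M : Matroid α) : Prop :=
  Connected M ∧ ∀ A B, Separation M 2 A B →
    (SeriesClass M A ∨ ParallelClass M A ∨ SeriesClass M B ∨ ParallelClass M B)

/-- A 3-separating set of `M`. -/
def ThreeSeparating (M : Matroid α) (Y : Set α) : Prop :=
  Y ⊆ M.E ∧ rk M Y + rk M (M.E \ Y) ≤ rk M M.E + 2

/-- `M` has path width 3: there is an ordering of the ground set all of whose initial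
segments are 3-separating. -/
def PathWidth3 (M : Matroid α) : Prop :=
  ∃ (n : ℕ) (e : Fin n → α), Function.Injective e ∧ Set.range e = M.E ∧
    ∀ t : Fin n, ThreeSeparating M (e '' {i | i ≤ t})

/-- A segment: every 3-element subset is a triangle. -/
def Segment (M : Matroid α) (S : Set α) : Prop :=
  S ⊆ M.E ∧ ∀ T ⊆ S, T.ncard = 3 → Circuit M T

/-- A triangle: a 3-element circuit. -/
def Triangle (M : Matroid α) (S : Set α) : Prop := Circuit M S ∧ S.ncard = 3

/-! ### Reduced representations `[I | C]` with `C = [[A, 1], [1ᵀ, w]]` -/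

/-- The column, indexed by `x`, of the matrix `[I | C]` whose rows are indexed by
`(X \ {e}) ∪ {f}`, where `C` is the block matrix `[[A, 1], [1ᵀ, w]]` with row block `X \ {e}`,
column block `(E \ X) \ {f}`, last column `e`, last row `f`, and corner entry `w`. -/
noncomputable def colVec (X : Set α) (e f : α) (A : α → α → GF4) (w : GF4) :
    α → ((X \ {e} ∪ {f} : Set α) → GF4) := fun x r =>
  if x ∈ X \ {e} ∪ ({f} : Set α) then (if (r : α) = x then 1 else 0)
  else if (r : α) = f then (if x = e then w else 1)
  else if x = e then 1 else A (r : α) x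

/-- `M = M[I | C]` where `C` is the block matrix `[[A, 1], [1ᵀ, w]]` relative to the
basis `(X \ {e}) ∪ {f}`. -/
def RepBy (M : Matroid α) (X : Set α) (e f : α) (A : α → α → GF4) (w : GF4) : Prop :=
  ∀ I ⊆ M.E, (M.Indep I ↔
    LinearIndependent GF4 (fun x : I => colVec X e f A w (x : α)))

/-- The matrix `B`, with rows restricted to `R` and columns restricted to `K`, has an
`m × n` submatrix (up to permuting rows and columns) equal to the pattern `P`. -/
def HasPattern {m n : ℕ} (B : α → α → GF4) (R K : Set α) (P : Fin m → Fin n → GF4) : Prop :=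
  ∃ (r : Fin m → α) (c : Fin n → α), Function.Injective r ∧ Function.Injective c ∧
    (∀ i, r i ∈ R) ∧ (∀ j, c j ∈ K) ∧ ∀ i j, B (r i) (c j) = P i j

/-- One non-zero element of GF(4). -/
def NZ1 (x : GF4) : Prop := x ≠ 0

/-- Two distinct non-zero elements of GF(4). -/
def NZ2 (x y : GF4) : Prop := x ≠ 0 ∧ y ≠ 0 ∧ x ≠ y

/-- Three distinct non-zero elements of GF(4). -/
def NZ3 (x y z : GF4) : Prop :=
  x ≠ 0 ∧ y ≠ 0 ∧ z ≠ 0 ∧ x ≠ y ∧ x ≠ z ∧ y ≠ z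

/-- `B` (with rows from `R` and columns from `K`) contains one of the fifteen forbidden
submatrices, up to permuting rows and columns, where `x, y, z` denote distinct non-zero
elements of GF(4). -/
def HasForbidden (B : α → α → GF4) (R K : Set α) : Prop :=
  (∃ x y z, NZ3 x y z ∧ HasPattern B R K ![![x, y, z]]) ∨
  (∃ x y, NZ2 x y ∧ HasPattern B R K ![![x, y], ![0, x]]) ∨
  (∃ x y, NZ2 x y ∧ HasPattern B R K ![![x, y], ![y, x]]) ∨
  (∃ x y z, NZ3 x y z ∧ HasPattern B R K ![![x, y], ![z, x]]) ∨
  (∃ x y z, NZ3 x y z ∧ HasPattern B R K ![![x, x], ![y, z]]) ∨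
  (∃ x, NZ1 x ∧ HasPattern B R K ![![x, x, 0], ![x, 0, x]]) ∨
  (∃ x y, NZ2 x y ∧ HasPattern B R K ![![x, x, 0], ![x, 0, y]]) ∨
  (∃ x y, NZ2 x y ∧ HasPattern B R K ![![x, x, 0], ![y, 0, y]]) ∨
  (∃ x y, NZ2 x y ∧ HasPattern B R K ![![x, y, 0], ![x, 0, y]]) ∨
  (∃ x y z, NZ3 x y z ∧ HasPattern B R K ![![x, 0, 0], ![0, y, z]]) ∨
  (∃ x, NZ1 x ∧ HasPattern B R K ![![x, 0, 0], ![0, x, 0], ![0, 0, x]]) ∨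
  (∃ x y, NZ2 x y ∧ HasPattern B R K ![![x, 0, 0], ![0, x, 0], ![0, 0, y]]) ∨
  (∃ x y z, NZ3 x y z ∧ HasPattern B R K ![![x, 0, 0], ![0, y, 0], ![0, 0, z]]) ∨
  (∃ x y, NZ2 x y ∧ HasPattern B R K ![![x, y, x], ![y, y, 0], ![x, 0, 0]]) ∨
  (∃ x y z, NZ3 x y z ∧ HasPattern B R K ![![x, y, x], ![y, y, 0], ![x, 0, z]])

/-! ### The matroids `P₈⁻`, `F₇⁼` and its dual -/

/-- The columns of the GF(3)-matrix `[I₄ | A]` representing `P₈`, where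
`A = [[0,1,1,-1],[1,0,1,1],[1,1,0,1],[-1,1,1,0]]`. -/
def P8cols : Fin 8 → Fin 4 → ZMod 3 :=
  ![![1, 0, 0, 0], ![0, 1, 0, 0], ![0, 0, 1, 0], ![0, 0, 0, 1],
    ![0, 1, 1, -1], ![1, 0, 1, 1], ![1, 1, 0, 1], ![-1, 1, 1, 0]]

/-- `M` is isomorphic to `P₈`. -/
def IsP8 (M : Matroid α) : Prop :=
  ∃ g : α → Fin 8, Set.BijOn g M.E Set.univ ∧
    ∀ I ⊆ M.E, (M.Indep I ↔ LinearIndependent (ZMod 3) (fun x : I => P8cols (g (x : α))))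

/-- `M` is isomorphic to `P₈⁻`: it is obtained from a copy of `P₈` by relaxing one of its
pair of disjoint circuit-hyperplanes. -/
def IsP8Minus (M : Matroid α) : Prop :=
  ∃ (N : Matroid α) (X Y : Set α), IsP8 N ∧ CircuitHyperplane N Y ∧ Disjoint X Y ∧
    IsRelaxation N M X

/-- The columns of the rational matrix representing the non-Fano matroid `F₇⁻`: the seven
non-zero `{0,1}`-vectors of length 3. -/
def F7cols : Fin 7 → Fin 3 → ℚ :=
  ![![1, 0, 0], ![0, 1, 0], ![0, 0, 1], ![1, 1, 0], ![1, 0, 1], ![0, 1, 1], ![1, 1, 1]]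

/-- `M` is isomorphic to the non-Fano matroid `F₇⁻`. -/
def IsF7Minus (M : Matroid α) : Prop :=
  ∃ g : α → Fin 7, Set.BijOn g M.E Set.univ ∧
    ∀ I ⊆ M.E, (M.Indep I ↔ LinearIndependent ℚ (fun x : I => F7cols (g (x : α))))

/-- `M` is isomorphic to `F₇⁼`: it is obtained from a copy of `F₇⁻` by relaxing a
circuit-hyperplane. -/
def IsF7Eq (M : Matroid α) : Prop :=
  ∃ (N : Matroid α) (X : Set α), IsF7Minus N ∧ IsRelaxation N M X

end Relax

namespace RelaxPath

section Systems

variable {ι κ ι' κ' : Type*}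

/-- Two functions into `ZMod 3` such that, among the three differences of `0`, `p`, `q`, two
take given values alternately. -/
def MidSplit (p q : κ → ZMod 3) : Prop :=
  ∃ a b, (∀ y, p y = a ∨ q y = b) ∨ (∀ y, p y = a ∨ q y - p y = b) ∨
    (∀ y, q y = a ∨ q y - p y = b)

/-- The exceptional `4 × 4` pattern. -/
def quad : Fin 4 → Fin 4 → ZMod 3 :=
  ![![0, 0, 0, 0], ![1, 0, 2, 0], ![0, 1, 0, 2], ![1, 1, 2, 2]]

/-- The local conditions satisfied by the exponent matrix of a relaxation. -/
structure NF (L : ι → κ → ZMod 3) : Prop where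
  row : ∀ i j k, MidSplit (fun y => L j y - L i y) (fun y => L k y - L i y)
  col : ∀ y z w, MidSplit (fun i => L i z - L i y) (fun i => L i w - L i y)
  four : ∀ (r : Fin 4 → ι) (c : Fin 4 → κ) (u : Fin 4 → ZMod 3),
    ¬ ∀ i j, L (r i) (c j) - L (r 0) (c j) = u i + quad i j

theorem MidSplit.comp {p q : κ → ZMod 3} (h : MidSplit p q) (f : κ' → κ) :
    MidSplit (fun y => p (f y)) (fun y => q (f y)) := by
  obtain ⟨a, b, h⟩ := h
  refine ⟨a, b, ?_⟩
  rcases h with h | h | h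
  · exact Or.inl fun y => h _
  · exact Or.inr (Or.inl fun y => h _)
  · exact Or.inr (Or.inr fun y => h _)

theorem MidSplit.add {p q : κ → ZMod 3} (h : MidSplit p q) (s t : ZMod 3) :
    MidSplit (fun y => p y + s) (fun y => q y + t) := by
  obtain ⟨a, b, h⟩ := h
  rcases h with h | h | h
  · exact ⟨a + s, b + t, Or.inl fun y => by simpa using h y⟩
  · exact ⟨a + s, b + (t - s), Or.inr (Or.inl fun y => (h y).imp (by rintro rfl; rfl)
      (by rintro rfl; ring))⟩
  · exact ⟨a + t, b + (t - s), Or.inr (Or.inr fun y => (h y).imp (by rintro rfl; rfl)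
      (by rintro rfl; ring))⟩

theorem NF.comp {L : ι → κ → ZMod 3} (h : NF L) (f : ι' → ι) (g : κ' → κ) :
    NF (fun i y => L (f i) (g y)) where
  row i j k := (h.row (f i) (f j) (f k)).comp g
  col y z w := (h.col (g y) (g z) (g w)).comp f
  four r c u := h.four (f ∘ r) (g ∘ c) u

theorem NF.shift {L : ι → κ → ZMod 3} (h : NF L) (u : ι → ZMod 3) (v : κ → ZMod 3) :
    NF (fun i y => L i y + u i + v y) where
  row i j k := by
    convert (h.row i j k).add (u j - u i) (u k - u i) using 2 <;> ring
  col y z w := by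
    convert (h.col y z w).add (v z - v y) (v w - v y) using 2 <;> ring
  four r c s hh := by
    refine h.four r c (fun i => s i - u (r i) + u (r 0)) fun i j => ?_
    linear_combination hh i j

theorem NF.congr_shift {L L' : ι → κ → ZMod 3} (h : NF L) (u : ι → ZMod 3) (v : κ → ZMod 3)
    (e : ∀ i y, L' i y = L i y + u i + v y) : NF L' := by
  have : L' = fun i y => L i y + u i + v y := by
    funext i y; exact e i y
  rw [this]
  exact h.shift u v

end Systems

section Search

/-- The bit positions are the nine pairs of elements of `ZMod 3`; bit `m` is set when the set
of pairs coded by `m` satisfies `MidSplit`. -/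
def midTable : ℕ :=
  65557056547415131289940932539276272986496347153423494607541222481737217110311575724624687536385841944306182340932338301016272590186896428214779903

def regionMask (f : ℕ → ℕ → Bool) : ℕ :=
  ((List.range 9).map fun b => if f (b / 3) (b % 3) then 2 ^ b else 0).sum

def regions : List ℕ :=
  (List.range 9).flatMap fun ab =>
    [regionMask fun p q => p == ab / 3 || q == ab % 3,
      regionMask fun p q => p == ab / 3 || (q + 3 - p) % 3 == ab % 3,
      regionMask fun p q => q == ab / 3 || (q + 3 - p) % 3 == ab % 3]

theorem midTable_of_region (m : ℕ) (hm : m < 512) (r : ℕ) (hr : r ∈ regions)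
    (h : m &&& r = m) : midTable.testBit m = true := by
  have key : ((List.range 512).all fun m =>
      midTable.testBit m || regions.all fun r => !(m &&& r == m)) = true := by
    decide +kernel
  rw [List.all_eq_true] at key
  have := key m (List.mem_range.2 hm)
  rw [Bool.or_eq_true, List.all_eq_true] at this
  refine this.resolve_right fun hh => ?_
  simpa [h] using hh r hr

/-- The digits of the code of a column. -/
def dg (t i : ℕ) : ℕ := t / 4 ^ i % 4

/-- The code of a column whose first entry is zero. -/
def enc (a b c d : ZMod 3) : ℕ := 4 * a.val + 16 * b.val + 64 * c.val + 256 * d.val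

def diffBit (a b c : ℕ) : ℕ := 2 ^ (3 * ((b + 3 - a) % 3) + (c + 3 - a) % 3)

def triples : List (ℕ × ℕ × ℕ) :=
  [(0, 1, 2), (0, 1, 3), (0, 2, 3), (1, 2, 3), (0, 1, 4), (0, 2, 4), (1, 2, 4), (0, 3, 4),
    (1, 3, 4), (2, 3, 4)]

def sig : List (ℕ × ℕ × ℕ) → ℕ → ℕ
  | [], _ => 0
  | (i, j, k) :: l, t => diffBit (dg t i) (dg t j) (dg t k) + 512 * sig l t

def fieldsOk : ℕ → ℕ → Bool
  | 0, _ => true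
  | n + 1, s => midTable.testBit (s % 512) && fieldsOk n (s / 512)

def colMask (m a b c : ℕ) : ℕ :=
  (List.range m).foldr (fun i s => diffBit (dg a i) (dg b i) (dg c i) ||| s) 0

def badPair (m a : ℕ) : List ℕ → Bool
  | [] => false
  | b :: l => l.any (fun c => !midTable.testBit (colMask m a b c)) || badPair m a l

def badCols (m : ℕ) : List ℕ → Bool
  | [] => false
  | a :: l => badPair m a l || badCols m l

/-- A requirement on a set of columns: some column satisfies `p`, or all columns do. -/
inductive Req
  | some (p : ℕ → Bool)
  | all (p : ℕ → Bool)

def Req.Holds (S : ℕ → Prop) : Req → Prop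
  | .some p => ∃ t, S t ∧ p t = true
  | .all p => ∀ t, S t → p t = true

def Req.metBy (P : List ℕ) : Req → Bool
  | .some p => P.any p
  | .all _ => false

/-- Exhaustive search for a set of columns containing `P`, contained in `U`, and meeting one
alternative out of each list of requirements; the answer is `true` when there is none. -/
def refute (m : ℕ) (tr : List (ℕ × ℕ × ℕ)) : List (List Req) → List ℕ → List ℕ → ℕ → Bool
  | [], _, P, _ => badCols m P
  | c :: cs, U, P, s =>
    if c.any (Req.metBy P) then refute m tr cs U P s
    else c.all fun r => match r with
      | .all p => !P.all p || refute m tr cs (U.filter p) P s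
      | .some p => U.all fun t =>
          !p t || !fieldsOk tr.length (s ||| sig tr t) ||
            refute m tr cs U (t :: P) (s ||| sig tr t)

/-- Each field of the signature is contained in the corresponding region. -/
def Within : List ℕ → ℕ → Prop
  | [], _ => True
  | r :: rs, s => (s % 512) &&& r = s % 512 ∧ Within rs (s / 512)

theorem Within.or {rs : List ℕ} : ∀ {s t : ℕ}, Within rs s → Within rs t →
    Within rs (s ||| t) := by
  induction rs with
  | nil => intros; trivial
  | cons r rs ih =>
    rintro s t ⟨h1, h2⟩ ⟨h3, h4⟩
    refine ⟨?_, ?_⟩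
    · have : (s ||| t) % 512 = s % 512 ||| t % 512 := Nat.or_mod_two_pow (n := 9)
      rw [this, Nat.and_or_distrib_right, h1, h3]
    · have : (s ||| t) / 512 = s / 512 ||| t / 512 := Nat.or_div_two_pow (n := 9)
      rw [this]
      exact ih h2 h4

theorem Within.zero (rs : List ℕ) : Within rs 0 := by
  induction rs with
  | nil => trivial
  | cons r rs ih => exact ⟨by simp, by simpa using ih⟩

theorem Within.fieldsOk {rs : List ℕ} (hrs : ∀ r ∈ rs, r ∈ regions) :
    ∀ {s : ℕ}, Within rs s → fieldsOk rs.length s = true := by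
  induction rs with
  | nil => intros; rfl
  | cons r rs ih =>
    rintro s ⟨h1, h2⟩
    simp only [List.length_cons, RelaxPath.fieldsOk, Bool.and_eq_true]
    exact ⟨midTable_of_region _ (Nat.mod_lt _ (by norm_num)) r (hrs r (by simp)) h1,
      ih (fun x hx => hrs x (by simp [hx])) h2⟩

theorem diffBit_lt (a b c : ℕ) : diffBit a b c < 512 := by
  unfold diffBit
  have : 3 * ((b + 3 - a) % 3) + (c + 3 - a) % 3 < 9 := by omega
  exact Nat.pow_lt_pow_right (by norm_num) this

theorem sub_val : ∀ x y : ZMod 3, (y - x).val = (y.val + 3 - x.val) % 3 := by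
  decide

def region (k a b : ℕ) : ℕ :=
  match k with
  | 0 => regionMask fun p q => p == a || q == b
  | 1 => regionMask fun p q => p == a || (q + 3 - p) % 3 == b
  | _ => regionMask fun p q => q == a || (q + 3 - p) % 3 == b

theorem region_mem : ∀ k < 3, ∀ a < 3, ∀ b < 3, (regions.contains (region k a b)) = true := by
  decide +kernel

theorem diffBit_region : ((List.range 3).all fun a => (List.range 3).all fun b =>
    (List.range 3).all fun x => (List.range 3).all fun y => (List.range 3).all fun z =>
      (!((y + 3 - x) % 3 == a || (z + 3 - x) % 3 == b) ||
        diffBit x y z &&& region 0 a b == diffBit x y z) &&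
      (!((y + 3 - x) % 3 == a || (z + 3 - y) % 3 == b) ||
        diffBit x y z &&& region 1 a b == diffBit x y z) &&
      (!((z + 3 - x) % 3 == a || (z + 3 - y) % 3 == b) ||
        diffBit x y z &&& region 2 a b == diffBit x y z)) = true := by
  decide +kernel

theorem MidSplit.exists_region {κ : Type*} {x y z : κ → ZMod 3}
    (h : MidSplit (fun i => y i - x i) (fun i => z i - x i)) :
    ∃ r ∈ regions, ∀ i, diffBit (x i).val (y i).val (z i).val &&& r =
      diffBit (x i).val (y i).val (z i).val := by
  obtain ⟨a, b, h⟩ := h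
  have H := diffBit_region
  simp only [List.all_eq_true, List.mem_range] at H
  have hm : ∀ k < 3, region k a.val b.val ∈ regions := fun k hk => by
    simpa using region_mem k hk a.val (ZMod.val_lt a) b.val (ZMod.val_lt b)
  have H' := fun i => H a.val (ZMod.val_lt a) b.val (ZMod.val_lt b) (x i).val (ZMod.val_lt _)
    (y i).val (ZMod.val_lt _) (z i).val (ZMod.val_lt _)
  simp only [← sub_val, Bool.and_eq_true, Bool.or_eq_true, Bool.not_eq_true', beq_iff_eq,
    Bool.or_eq_false_iff, beq_eq_false_iff_ne, (ZMod.val_injective 3).eq_iff, ne_eq] at H'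
  simp only [sub_sub_sub_cancel_right] at h
  rcases h with h | h | h
  · exact ⟨_, hm 0 (by norm_num), fun i => (H' i).1.1.resolve_left fun hh => by
      have := h i; tauto⟩
  · exact ⟨_, hm 1 (by norm_num), fun i => (H' i).1.2.resolve_left fun hh => by
      have := h i; tauto⟩
  · exact ⟨_, hm 2 (by norm_num), fun i => (H' i).2.resolve_left fun hh => by
      have := h i; tauto⟩

theorem or_and_region {l : List ℕ} {f : ℕ → ℕ} {r : ℕ} (h : ∀ i ∈ l, f i &&& r = f i) :
    (l.foldr (fun i s => f i ||| s) 0) &&& r = l.foldr (fun i s => f i ||| s) 0 := by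
  induction l with
  | nil => simp
  | cons a l ih =>
    simp only [List.foldr_cons, Nat.and_or_distrib_right]
    rw [h a (by simp), ih fun i hi => h i (by simp [hi])]

theorem colMask_lt (m a b c : ℕ) : colMask m a b c < 512 := by
  unfold colMask
  induction List.range m with
  | nil => simp
  | cons i l ih => exact Nat.or_lt_two_pow (n := 9) (diffBit_lt _ _ _) ih

variable {κ : Type*}

theorem badCols_false {m : ℕ} {l : List ℕ}
    (h : ∀ a ∈ l, ∀ b ∈ l, ∀ c ∈ l, midTable.testBit (colMask m a b c) = true) :
    badCols m l = false := by
  have key : ∀ (a : ℕ) (l : List ℕ),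
      (∀ b ∈ l, ∀ c ∈ l, midTable.testBit (colMask m a b c) = true) → badPair m a l = false := by
    intro a l
    induction l with
    | nil => intros; rfl
    | cons b l ih =>
      intro h
      simp only [badPair, Bool.or_eq_false_iff, List.any_eq_false]
      refine ⟨fun c hc => ?_, ih fun x hx y hy => h x (by simp [hx]) y (by simp [hy])⟩
      simp [h b (by simp) c (by simp [hc])]
  induction l with
  | nil => rfl
  | cons a l ih =>
    simp only [badCols, Bool.or_eq_false_iff]
    exact ⟨key a l fun b hb c hc => h a (by simp) b (by simp [hb]) c (by simp [hc]),
      ih fun x hx y hy z hz => h x (by simp [hx]) y (by simp [hy]) z (by simp [hz])⟩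

/-- Soundness of the search, for an abstract set `S` of columns. -/
theorem refute_sound {S : ℕ → Prop} {m : ℕ} {tr : List (ℕ × ℕ × ℕ)} {rs : List ℕ}
    (hlen : rs.length = tr.length) (hrs : ∀ r ∈ rs, r ∈ regions)
    (hsig : ∀ t, S t → Within rs (sig tr t))
    (hcol : ∀ a b c, S a → S b → S c → midTable.testBit (colMask m a b c) = true) :
    ∀ (cs : List (List Req)) (U P : List ℕ) (s : ℕ), (∀ t, S t → t ∈ U) → (∀ t ∈ P, S t) →
      Within rs s → (∀ c ∈ cs, ∃ r ∈ c, r.Holds S) → refute m tr cs U P s = false := by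
  intro cs
  induction cs with
  | nil =>
    intro U P s _ hP _ _
    exact badCols_false fun a ha b hb c hc => hcol a b c (hP a ha) (hP b hb) (hP c hc)
  | cons c cs ih =>
    intro U P s hU hP hs hc
    obtain ⟨r, hr, hh⟩ := hc c (by simp)
    have hc' : ∀ c ∈ cs, ∃ r ∈ c, r.Holds S := fun d hd => hc d (by simp [hd])
    rw [refute]
    split_ifs with hm
    · exact ih U P s hU hP hs hc'
    · rw [List.all_eq_false]
      refine ⟨r, hr, ?_⟩
      cases r with
      | all p =>
        have h1 : P.all p = true := List.all_eq_true.2 fun t ht => hh t (hP t ht)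
        have h2 := ih (U.filter p) P s
          (fun t ht => List.mem_filter.2 ⟨hU t ht, hh t ht⟩) hP hs hc'
        simp only [h1, h2]
        decide
      | some p =>
        obtain ⟨t, ht, hp⟩ := hh
        simp only [Bool.not_eq_true, List.all_eq_false]
        refine ⟨t, hU t ht, ?_⟩
        have h1 := hs.or (hsig t ht)
        have h2 := hlen ▸ h1.fieldsOk hrs
        have h3 := ih U (t :: P) (s ||| sig tr t) hU
          (by simp only [List.mem_cons, forall_eq_or_imp]; exact ⟨ht, hP⟩) h1 hc'
        simp [hp, h2, h3]

theorem dg_enc : ∀ a b c d : ZMod 3, dg (enc a b c d) 0 = 0 ∧ dg (enc a b c d) 1 = a.val ∧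
    dg (enc a b c d) 2 = b.val ∧ dg (enc a b c d) 3 = c.val ∧ dg (enc a b c d) 4 = d.val := by
  decide +kernel

theorem exists_within {R : ℕ → κ → ZMod 3} (hR : ∀ i j k, MidSplit (fun y => R j y - R i y)
      (fun y => R k y - R i y)) {code : κ → ℕ} :
    ∀ tr : List (ℕ × ℕ × ℕ), (∀ x ∈ tr, ∀ y, dg (code y) x.1 = (R x.1 y).val ∧
      dg (code y) x.2.1 = (R x.2.1 y).val ∧ dg (code y) x.2.2 = (R x.2.2 y).val) →
    ∃ rs : List ℕ, rs.length = tr.length ∧ (∀ r ∈ rs, r ∈ regions) ∧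
      ∀ y, Within rs (sig tr (code y)) := by
  intro tr
  induction tr with
  | nil => exact fun _ => ⟨[], rfl, by simp, fun _ => trivial⟩
  | cons x tr ih =>
    obtain ⟨i, j, k⟩ := x
    intro h
    obtain ⟨rs, h1, h2, h3⟩ := ih fun x hx => h x (by simp [hx])
    obtain ⟨r, hr, hr'⟩ := (hR i j k).exists_region
    refine ⟨r :: rs, by simp [h1], by simp [hr]; exact h2, fun y => ?_⟩
    obtain ⟨e1, e2, e3⟩ := h (i, j, k) (by simp) y
    have hl := diffBit_lt (dg (code y) i) (dg (code y) j) (dg (code y) k)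
    have e4 : sig ((i, j, k) :: tr) (code y) % 512 =
        diffBit (dg (code y) i) (dg (code y) j) (dg (code y) k) := by
      rw [sig]; omega
    have e5 : sig ((i, j, k) :: tr) (code y) / 512 = sig tr (code y) := by
      rw [sig]; omega
    refine ⟨?_, by rw [e5]; exact h3 y⟩
    rw [e4]
    simp only at e1 e2 e3
    rw [e1, e2, e3]
    exact hr' y

/-- All codes of columns with `m` entries after the first. -/
def allCodes : ℕ → List ℕ
  | 0 => [0]
  | m + 1 => (allCodes m).flatMap fun t => [t, t + 4 ^ (m + 1), t + 2 * 4 ^ (m + 1)]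

/-- A predicate on codes, read off the digits. -/
def onDigits (q : ℕ → ℕ → ℕ → ℕ → Bool) (t : ℕ) : Bool := q (dg t 1) (dg t 2) (dg t 3) (dg t 4)

def search (m : ℕ) (q : ℕ → ℕ → ℕ → ℕ → Bool) (cs : List (List Req)) (P : List ℕ) : Bool :=
  refute (m + 1) (triples.take ((m + 1) * m * (m - 1) / 6)) cs ((allCodes m).filter (onDigits q)) P
    (P.foldr (fun t s => sig (triples.take ((m + 1) * m * (m - 1) / 6)) t ||| s) 0)

theorem onDigits_enc (q : ℕ → ℕ → ℕ → ℕ → Bool) (a b c d : ZMod 3) :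
    onDigits q (enc a b c d) = q a.val b.val c.val d.val := by
  obtain ⟨-, h1, h2, h3, h4⟩ := dg_enc a b c d
  rw [onDigits, h1, h2, h3, h4]

theorem search_sound {a b c d : κ → ZMod 3} (h : NF ![0, a, b, c, d]) (m : ℕ) (hm : m ≤ 4)
    (hcode : ∀ y, enc (a y) (b y) (c y) (d y) ∈ allCodes m)
    (q : ℕ → ℕ → ℕ → ℕ → Bool) (cs : List (List Req)) (P : List ℕ)
    (hs : search m q cs P = true)
    (hP : ∀ t ∈ P, ∃ y, enc (a y) (b y) (c y) (d y) = t)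
    (hq : ∀ y, q (a y).val (b y).val (c y).val (d y).val = true) :
    ∃ l ∈ cs, ∀ r ∈ l, ¬ r.Holds fun t => ∃ y, enc (a y) (b y) (c y) (d y) = t := by
  by_contra! hcs
  set R5 : Fin 5 → κ → ZMod 3 := ![0, a, b, c, d]
  let R : ℕ → κ → ZMod 3 := fun i => if h : i < 5 then R5 ⟨i, h⟩ else 0
  let code : κ → ℕ := fun y => enc (a y) (b y) (c y) (d y)
  have hdg : ∀ i < 5, ∀ y, dg (code y) i = (R i y).val := by
    intro i hi y
    obtain ⟨h0, h1, h2, h3, h4⟩ := dg_enc (a y) (b y) (c y) (d y)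
    interval_cases i
    · exact h0
    · exact h1
    · exact h2
    · exact h3
    · exact h4
  have hR : ∀ i j k, MidSplit (fun y => R j y - R i y) (fun y => R k y - R i y) := by
    have : ∀ i, ∃ i' : Fin 5, R i = R5 i' := by
      intro i
      by_cases hi : i < 5
      · exact ⟨⟨i, hi⟩, by simp [R, hi]⟩
      · exact ⟨0, by simp [R, hi, R5]⟩
    intro i j k
    obtain ⟨i', hi⟩ := this i
    obtain ⟨j', hj⟩ := this j
    obtain ⟨k', hk⟩ := this k
    rw [hi, hj, hk]
    exact h.row i' j' k'
  have htr : ∀ x ∈ triples, x.1 < 5 ∧ x.2.1 < 5 ∧ x.2.2 < 5 := by decide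
  obtain ⟨rs, h1, h2, h3⟩ := exists_within hR (code := code)
    (triples.take ((m + 1) * m * (m - 1) / 6)) (fun x hx y => by
      obtain ⟨u, v, w⟩ := htr x (List.mem_of_mem_take hx)
      exact ⟨hdg _ u y, hdg _ v y, hdg _ w y⟩)
  have := refute_sound (S := fun t => ∃ y, code y = t) (m := m + 1) h1 h2
    (by rintro t ⟨y, rfl⟩; exact h3 y)
    (by
      rintro _ _ _ ⟨y, rfl⟩ ⟨z, rfl⟩ ⟨w, rfl⟩
      obtain ⟨r, hr, hr'⟩ := (h.col y z w).exists_region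
      refine midTable_of_region _ (colMask_lt _ _ _ _) r hr (or_and_region fun i hi => ?_)
      have hi : i < 5 := by
        have := List.mem_range.1 hi
        omega
      rw [hdg i hi, hdg i hi, hdg i hi]
      simpa [R, hi] using hr' ⟨i, hi⟩)
    cs ((allCodes m).filter (onDigits q)) P
    (P.foldr (fun t s => sig (triples.take ((m + 1) * m * (m - 1) / 6)) t ||| s) 0)
    (by
      rintro t ⟨y, rfl⟩
      refine List.mem_filter.2 ⟨hcode y, ?_⟩
      rw [onDigits_enc]
      exact hq y)
    hP
    (by
      clear hs
      induction P with
      | nil => exact Within.zero _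
      | cons t P ih =>
        obtain ⟨y, rfl⟩ := hP t (by simp)
        exact (h3 y).or (ih fun t ht => hP t (by simp [ht])))
    hcs
  rw [search, this] at hs
  exact Bool.noConfusion hs

end Search

section Searches

/-- Some column satisfies `q`. -/
def ex (q : ℕ → ℕ → ℕ → ℕ → Bool) : Req := .some (onDigits q)

/-- All columns satisfy `q`. -/
def al (q : ℕ → ℕ → ℕ → ℕ → Bool) : Req := .all (onDigits q)

/-- The elements of `ZMod 3`. -/
def zs : List (ZMod 3) := [0, 1, 2]

def exactReqs : List (List Req) :=
  [zs.map fun a => al fun x _ w _ => w == a.val || x == w,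
    zs.map fun a => al fun _ z _ v => v == a.val || z == v,
    zs.map fun a => al fun x _ _ v => v == a.val || x == v] ++
  (zs.map fun a => [ex fun x z _ _ => !(z == a.val) && !(x == z)]) ++
  (zs.map fun a => [ex fun _ z w _ => !(w == a.val) && !(z == w)]) ++
  (zs.map fun a => [ex fun _ _ w v => !(v == a.val) && !(w == v)])

theorem search_exact : (zs.all fun c => zs.all fun d => zs.all fun b =>
    search 4 (fun x z w v => (x == c.val || z == x) && (z == d.val || w == z) &&
      (w == b.val || v == w)) exactReqs [0]) = true := by
  decide +kernel

def cyclicReqs : List (List Req) :=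
  [[ex fun r x _ _ => r == 0 && !(x == r)], [ex fun r _ z _ => r == 1 && !(z == r)],
    [ex fun r _ _ w => r == 2 && !(w == r)],
    (zs.map fun a => al fun _ x z _ => x == z || x == a.val) ++
      (zs.map fun a => al fun _ x z _ => x == z || z == a.val),
    (zs.map fun a => al fun _ x _ w => x == w || x == a.val) ++
      (zs.map fun a => al fun _ x _ w => x == w || w == a.val),
    (zs.map fun a => al fun _ _ z w => z == w || z == a.val) ++
      (zs.map fun a => al fun _ _ z w => z == w || w == a.val)]

theorem search_cyclic : search 4 (fun r x z w => (r == 0 && x == 0 && z == 0 && w == 0) ||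
    ((x == r) == !(r == 0) && (z == r) == !(r == 1) && (w == r) == !(r == 2)))
    cyclicReqs [0] = true := by
  decide +kernel

def splitReqs : List (List Req) :=
  (zs.map fun c => [ex fun x _ _ _ => x == c.val]) ++
  (zs.map fun c => [ex fun _ z _ _ => z == c.val]) ++
  (zs.flatMap fun a => zs.map fun b =>
    [ex fun x z _ _ => !(z == a.val) && !((x + 3 - z) % 3 == b.val)])

theorem search_split : (zs.all fun i =>
    search 2 (fun x z _ _ => (x == 0 || z == x) && !(x == 0 && z == i.val)) splitReqs []) = true := by
  decide +kernel

def arrowReqs (c d : ZMod 3) : List (List Req) :=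
  [zs.flatMap fun a => zs.map fun b => al fun x _ w _ => w == a.val || (x + 3 - w) % 3 == b.val,
    zs.flatMap fun a => zs.map fun b => al fun _ z _ v => v == a.val || (z + 3 - v) % 3 == b.val,
    zs.flatMap fun a => zs.map fun b => al fun x _ _ v => v == a.val || (x + 3 - v) % 3 == b.val] ++
  (zs.map fun i => [ex fun x z _ _ => x == 0 && z == i.val]) ++
  (zs.map fun i => [ex fun _ z w _ => z == c.val && w == i.val]) ++
  (zs.map fun i => [ex fun _ _ w v => w == d.val && v == i.val])++
  (zs.map fun i => [ex fun x _ _ _ => x == i.val])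

theorem search_arrow : (zs.all fun c => zs.all fun d =>
    search 4 (fun x z w v => (x == 0 || z == x) && (z == c.val || w == z) &&
      (w == d.val || v == w)) (arrowReqs c d) []) = true := by
  decide +kernel

/-- Shapes of a row relative to a three-valued row `r`. -/
def shape (k r x : ℕ) : Bool := if k == 0 then r == 0 || x == r else x == 0 || (x == k && r == 0)

def core (k r x : ℕ) : Bool := if k == 0 then r == 0 && x == 0 else x == k && r == 0

theorem search_chain : (zs.all fun k => zs.all fun l =>
    search 3 (fun r x z _ => shape k.val r x && shape l.val r z)
      ((zs.map fun c => [ex fun r _ _ _ => r == c.val]) ++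
        [[ex fun r x z _ => core k.val r x && !core l.val r z],
          [ex fun r x z _ => core l.val r z && !core k.val r x]]) []) = true := by
  decide +kernel

def block (c k r x : ℕ) : Bool :=
  if k == 0 then (x == r) == !(r == c) else x == 0 || (x == k && r == (c + 3 - k) % 3)

def blockReq (k x : ℕ) : Bool := k == 0 || x == k

theorem search_block : (zs.all fun k => zs.all fun l => zs.all fun j =>
    search 4 (fun r x z w => block 0 k.val r x && block 1 l.val r z && block 2 j.val r w)
      ((zs.map fun c => [ex fun r _ _ _ => r == c.val]) ++
        [[ex fun _ x _ _ => blockReq k.val x], [ex fun _ _ z _ => blockReq l.val z],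
          [ex fun _ _ _ w => blockReq j.val w]]) []) = true := by
  decide +kernel

/-- Shapes of a row relative to a three-valued row `r`, both vanishing at a chosen column. -/
def rooted (k r x : ℕ) : Bool :=
  if k < 3 then r == k || x == r
  else if k < 5 then (x == 0 && r == 0) || x == k - 2
  else x == 0 || (x == k - 4 && r == k - 4)

/-- Pairs of values forming a core. -/
def corePairs : List ((ZMod 3 × ZMod 3) × (ZMod 3 × ZMod 3)) :=
  ((zs.product zs).product (zs.product zs)).filter fun t =>
    !(t.1.1 == t.1.2) && !(t.2.1 == t.2.2) && !(t.1.1 == t.2.1) && !(t.1.2 == t.2.2) &&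
      Nat.blt (3 * t.1.1.val + t.1.2.val) (3 * t.2.1.val + t.2.2.val)

theorem search_rooted : ((List.range 7).all fun k => (List.range 7).all fun l =>
    corePairs.all fun t =>
    search 3 (fun r x z _ => rooted k r x && rooted l r z)
      [[ex fun r _ _ _ => r == 1], [ex fun r _ _ _ => r == 2],
        [ex fun _ x z _ => x == t.1.1.val && z == t.1.2.val],
        [ex fun _ x z _ => x == t.2.1.val && z == t.2.2.val]] [0]) = true := by
  decide +kernel

def minimalReqs (v : ZMod 3) (p : ℕ → ℕ → ℕ) : List Req :=
  [ex fun d x z _ => p x z == v.val && !(d == 0), al fun d x z _ => !(d == 0) || p x z == v.val,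
    al fun _ x z _ => !(p x z == v.val)]

theorem search_minimal : ((zs.tail.product (zs.tail.product zs.tail)).all fun k =>
    corePairs.all fun t =>
    search 3 (fun d x z _ => (d == 0 || d == k.1.val) && (x == 0 || x == k.2.1.val) &&
        (z == 0 || z == k.2.2.val))
      [[ex fun _ x z _ => x == t.1.1.val && z == t.1.2.val],
        [ex fun _ x z _ => x == t.2.1.val && z == t.2.2.val],
        [ex fun d _ _ _ => !(d == 0)],
        minimalReqs 0 fun x _ => x, minimalReqs k.2.1 fun x _ => x,
        minimalReqs 0 fun _ z => z, minimalReqs k.2.2 fun _ z => z] [0]) = true := by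
  decide +kernel

/-- Negation of the strict crossing of `p` and `q` (already shifted by the expected values) with a
support `D' = {p ≠ 0}` larger than `D`. -/
def extremalReqs (D : ℕ → ℕ → ℕ → ℕ → Bool) (p q : ℕ → ℕ → ℕ → ℕ → ℕ) : List Req :=
  [ex fun x z u v => !(p x z u v == 0) && !(q x z u v == 0),
    ex fun x z u v => D x z u v && p x z u v == 0,
    al fun x z u v => D x z u v || p x z u v == 0,
    al fun x z u v => !(p x z u v == 1), al fun x z u v => !(p x z u v == 2),
    al fun x z u v => !(q x z u v == 1), al fun x z u v => !(q x z u v == 2)]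

def quadReqs (w : ℕ → ℕ → ℕ) : List Req :=
  [al fun x z u v => !(x == 1 && z == 0 && w u v == 1),
    al fun x z u v => !(x == 0 && z == 1 && w u v == 1),
    al fun x z u v => !(x == 2 && z == 0 && w u v == 2),
    al fun x z u v => !(x == 0 && z == 2 && w u v == 2)]

def extremalCs : List (List Req) :=
  [[ex fun x _ _ _ => x == 1], [ex fun _ z _ _ => z == 1], [ex fun x _ _ _ => x == 2],
    [ex fun _ z _ _ => z == 2],
    [ex fun x _ u _ => (u + 3 - x) % 3 == 1], [ex fun x _ _ v => (v + 3 - x) % 3 == 1],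
    [ex fun x _ u _ => (u + 3 - x) % 3 == 2], [ex fun x _ _ v => (v + 3 - x) % 3 == 2],
    extremalReqs (fun _ z _ _ => !(z == 0)) (fun x _ _ _ => (5 - x) % 3)
      fun x _ u _ => (u + 3 - x) % 3,
    extremalReqs (fun _ z _ _ => !(z == 0)) (fun x _ _ _ => (4 - x) % 3)
      fun x _ u _ => (u + 3 - x) % 3,
    extremalReqs (fun _ z _ _ => !(z == 0)) (fun x _ _ _ => (5 - x) % 3)
      fun x _ _ v => (v + 3 - x) % 3,
    extremalReqs (fun _ z _ _ => !(z == 0)) (fun x _ _ _ => (4 - x) % 3)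
      fun x _ _ v => (v + 3 - x) % 3,
    extremalReqs (fun _ z _ _ => !(z == 0)) (fun x z _ _ => (z + 3 - x) % 3)
      fun x _ u _ => (u + 3 - x) % 3,
    extremalReqs (fun _ z _ _ => !(z == 0)) (fun x z _ _ => (z + 3 - x) % 3)
      fun x _ _ v => (v + 3 - x) % 3,
    quadReqs fun u _ => u, quadReqs fun _ v => v]

theorem search_extremal : search 4 (fun x z u v => (x == 0 || z == 0) && (u == x || v == x))
    extremalCs [] = true := by
  decide +kernel

end Searches

section Wrap

variable {ι κ : Type*} {a b c d : κ → ZMod 3}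

/-- The set of codes of the columns. -/
def codes (a b c d : κ → ZMod 3) (t : ℕ) : Prop := ∃ y, enc (a y) (b y) (c y) (d y) = t

theorem ex_holds (q : ℕ → ℕ → ℕ → ℕ → Bool) : (ex q).Holds (codes a b c d) ↔
    ∃ y, q (a y).val (b y).val (c y).val (d y).val = true := by
  simp only [ex, Req.Holds, codes, ← onDigits_enc]
  exact ⟨fun ⟨_, ⟨y, e⟩, h⟩ => ⟨y, e ▸ h⟩, fun ⟨y, h⟩ => ⟨_, ⟨y, rfl⟩, h⟩⟩

theorem al_holds (q : ℕ → ℕ → ℕ → ℕ → Bool) : (al q).Holds (codes a b c d) ↔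
    ∀ y, q (a y).val (b y).val (c y).val (d y).val = true := by
  simp only [al, Req.Holds, codes, ← onDigits_enc]
  exact ⟨fun h y => h _ ⟨y, rfl⟩, by rintro h _ ⟨y, rfl⟩; exact h y⟩

theorem enc_mem_four : ∀ a b c d : ZMod 3, enc a b c d ∈ allCodes 4 := by decide +kernel

theorem enc_mem_three : ∀ a b c : ZMod 3, enc a b c 0 ∈ allCodes 3 := by decide +kernel

theorem enc_mem_two : ∀ a b : ZMod 3, enc a b 0 0 ∈ allCodes 2 := by decide +kernel

theorem NF.search_four (h : NF ![0, a, b, c, d]) {q : ℕ → ℕ → ℕ → ℕ → Bool}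
    {cs : List (List Req)} {P : List ℕ} (hs : search 4 q cs P = true)
    (hq : ∀ y, q (a y).val (b y).val (c y).val (d y).val = true)
    (hP : ∀ t ∈ P, codes a b c d t) (hcs : ∀ l ∈ cs, ∃ r ∈ l, r.Holds (codes a b c d)) : False := by
  obtain ⟨l, hl, h⟩ := search_sound h 4 (by norm_num) (fun y => enc_mem_four _ _ _ _) q cs P hs hP hq
  obtain ⟨r, hr, h'⟩ := hcs l hl
  exact h r hr h'

theorem NF.search_three (h : NF ![0, a, b, c, 0]) {q : ℕ → ℕ → ℕ → ℕ → Bool}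
    {cs : List (List Req)} {P : List ℕ} (hs : search 3 q cs P = true)
    (hq : ∀ y, q (a y).val (b y).val (c y).val 0 = true)
    (hP : ∀ t ∈ P, codes a b c 0 t) (hcs : ∀ l ∈ cs, ∃ r ∈ l, r.Holds (codes a b c 0)) : False := by
  obtain ⟨l, hl, h⟩ := search_sound h 3 (by norm_num) (fun y => enc_mem_three _ _ _) q cs P hs hP hq
  obtain ⟨r, hr, h'⟩ := hcs l hl
  exact h r hr h'

theorem NF.search_two (h : NF ![0, a, b, 0, 0]) {q : ℕ → ℕ → ℕ → ℕ → Bool}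
    {cs : List (List Req)} {P : List ℕ} (hs : search 2 q cs P = true)
    (hq : ∀ y, q (a y).val (b y).val 0 0 = true)
    (hP : ∀ t ∈ P, codes a b 0 0 t) (hcs : ∀ l ∈ cs, ∃ r ∈ l, r.Holds (codes a b 0 0)) : False := by
  obtain ⟨l, hl, h⟩ := search_sound h 2 (by norm_num) (fun y => enc_mem_two _ _) q cs P hs hP hq
  obtain ⟨r, hr, h'⟩ := hcs l hl
  exact h r hr h'

theorem mem_zs : ∀ a : ZMod 3, a ∈ zs := by decide

theorem forall_mem_zs (p : ZMod 3 → Prop) : (∀ a ∈ zs, p a) ↔ ∀ a, p a :=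
  ⟨fun h a => h a (mem_zs a), fun h a _ => h a⟩

theorem exists_mem_zs (p : ZMod 3 → Prop) : (∃ a ∈ zs, p a) ↔ ∃ a, p a :=
  ⟨fun ⟨a, _, h⟩ => ⟨a, h⟩, fun ⟨a, h⟩ => ⟨a, mem_zs a, h⟩⟩

theorem exists_mem_append {γ : Type*} (l l' : List γ) (p : γ → Prop) :
    (∃ a ∈ l ++ l', p a) ↔ (∃ a ∈ l, p a) ∨ ∃ a ∈ l', p a := by
  simp only [List.mem_append, or_and_right, exists_or]

theorem exists_mem_map {γ δ : Type*} (l : List γ) (f : γ → δ) (p : δ → Prop) :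
    (∃ a ∈ l.map f, p a) ↔ ∃ a ∈ l, p (f a) := by
  simp only [List.mem_map, exists_exists_and_eq_and]

theorem exists_mem_flatMap {γ δ : Type*} (l : List γ) (f : γ → List δ) (p : δ → Prop) :
    (∃ a ∈ l.flatMap f, p a) ↔ ∃ a ∈ l, ∃ b ∈ f a, p b := by
  simp only [List.mem_flatMap]
  exact ⟨fun ⟨b, ⟨a, h1, h2⟩, h3⟩ => ⟨a, h1, b, h2, h3⟩, fun ⟨a, h1, b, h2, h3⟩ => ⟨b, ⟨a, h1, h2⟩, h3⟩⟩

theorem exists_mem_cons {γ : Type*} (a : γ) (l : List γ) (p : γ → Prop) :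
    (∃ b ∈ a :: l, p b) ↔ p a ∨ ∃ b ∈ l, p b := by
  simp only [List.mem_cons, or_and_right, exists_or, exists_eq_left]

theorem exists_mem_nil {γ : Type*} (p : γ → Prop) : (∃ b ∈ ([] : List γ), p b) ↔ False := by
  simp

theorem forall_mem_nil {γ : Type*} (p : γ → Prop) : (∀ b ∈ ([] : List γ), p b) ↔ True := by
  simp

/-- `a` is a row of `L` relative to the row `e`, shifted by a constant. -/
def RowOf (L : ι → κ → ZMod 3) (e : ι) (a : κ → ZMod 3) : Prop :=
  ∃ x s, ∀ y, a y = L x y - L e y + s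

theorem NF.rows {L : ι → κ → ZMod 3} (h : NF L) (e : ι) {a b c d : κ → ZMod 3} (ha : RowOf L e a)
    (hb : RowOf L e b) (hc : RowOf L e c) (hd : RowOf L e d) : NF ![0, a, b, c, d] := by
  obtain ⟨x1, s1, h1⟩ := ha
  obtain ⟨x2, s2, h2⟩ := hb
  obtain ⟨x3, s3, h3⟩ := hc
  obtain ⟨x4, s4, h4⟩ := hd
  refine (h.comp ![e, x1, x2, x3, x4] id).congr_shift ![0, s1, s2, s3, s4] (fun y => - L e y) ?_
  intro i y
  fin_cases i <;> simp [h1, h2, h3, h4] <;> ring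

theorem RowOf.zero (L : ι → κ → ZMod 3) (e : ι) : RowOf L e 0 := ⟨e, 0, fun y => by simp⟩

theorem RowOf.mk (L : ι → κ → ZMod 3) (e x : ι) (s : ZMod 3) :
    RowOf L e fun y => L x y - L e y - s := ⟨x, -s, fun _ => sub_eq_add_neg _ _⟩

end Wrap

section Source

/-- A total relation on a finite type without long chains of reversed comparisons has a source. -/
theorem exists_source {α : Type*} [Finite α] [Nonempty α] (T : α → α → Prop)
    (total : ∀ x y, T x y ∨ T y x)
    (hT : ∀ x z w v, T x z → ¬T z x → T z w → ¬T w z → T w v → ¬T v w →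
      T w x → T v z → T v x → False) : ∃ r, ∀ x, T r x := by
  let s : α → α → Prop := fun x y => T x y ∧ ¬T y x
  have s_of : ∀ {x y}, ¬T x y → s y x := fun {x y} h => ⟨(total x y).resolve_left h, h⟩
  have three : ∀ {x z w v}, s x z → s z w → s w v → s x v ∨ ∃ t, s x t ∧ s t v := by
    intro x z w v h1 h2 h3
    by_cases h4 : T w x
    · by_cases h5 : T v z
      · by_cases h6 : T v x
        · exact (hT x z w v h1.1 h1.2 h2.1 h2.2 h3.1 h3.2 h4 h5 h6).elim
        · exact Or.inl (s_of h6)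
      · exact Or.inr ⟨z, h1, s_of h5⟩
    · exact Or.inr ⟨w, s_of h4, h3⟩
  let lt : α → α → Prop := fun x y => s x y ∨ ∃ t, s x t ∧ s t y
  have two : ∀ {x y z}, s x y → lt y z → lt x z := by
    rintro x y z h (h' | ⟨t, h1, h2⟩)
    · exact Or.inr ⟨y, h, h'⟩
    · exact three h h1 h2
  have : IsTrans α lt := ⟨by
    rintro x y z (h | ⟨t, h1, h2⟩) h'
    · exact two h h'
    · exact two h1 (two h2 h')⟩
  have : Std.Irrefl lt := ⟨by
    rintro x (h | ⟨t, h1, h2⟩)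
    · exact h.2 h.1
    · exact h1.2 h2.1⟩
  obtain ⟨r, -, hr⟩ := (Finite.wellFounded_of_trans_of_irrefl lt).has_min univ univ_nonempty
  refine ⟨r, fun x => ?_⟩
  by_contra h
  exact hr x (mem_univ x) (Or.inl (s_of h))

end Source

section NoCore

variable {ι κ : Type*}

/-- No two rows of `L` and two columns have both rows nonconstant and different in both columns. -/
def NoCore (L : ι → κ → ZMod 3) : Prop :=
  ∀ x z y y', L x y ≠ L z y → L x y' ≠ L z y' → L x y = L x y' ∨ L z y = L z y'

theorem const_or_const {γ : Type*} {p q : κ → γ} {s : Set κ} [Nonempty γ]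
    (h : ∀ y ∈ s, ∀ y' ∈ s, p y = p y' ∨ q y = q y') :
    (∃ c, ∀ y ∈ s, p y = c) ∨ ∃ c, ∀ y ∈ s, q y = c := by
  by_cases hs : ∃ y₁ ∈ s, ∃ y₂ ∈ s, p y₁ ≠ p y₂
  · obtain ⟨y₁, h₁, y₂, h₂, hne⟩ := hs
    refine Or.inr ⟨q y₁, fun y hy => ?_⟩
    have h12 := (h y₁ h₁ y₂ h₂).resolve_left hne
    rcases h y hy y₁ h₁ with h3 | h3
    · rcases h y hy y₂ h₂ with h4 | h4
      · exact (hne (h3.symm.trans h4)).elim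
      · exact h4.trans h12.symm
    · exact h3
  · push Not at hs
    left
    rcases s.eq_empty_or_nonempty with rfl | ⟨y, hy⟩
    · exact ⟨Classical.arbitrary γ, by simp⟩
    · exact ⟨p y, fun y' hy' => hs y' hy' y hy⟩

theorem NoCore.const {L : ι → κ → ZMod 3} (h : NoCore L) (x z : ι) :
    (∃ c, ∀ y, L x y = L z y ∨ L x y = c) ∨ ∃ c, ∀ y, L x y = L z y ∨ L z y = c := by
  rcases const_or_const (p := L x) (q := L z) (s := {y | L x y ≠ L z y})
    (fun y hy y' hy' => h x z y y' hy hy') with ⟨c, hc⟩ | ⟨c, hc⟩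
  · exact Or.inl ⟨c, fun y => or_iff_not_imp_left.2 (hc y)⟩
  · exact Or.inr ⟨c, fun y => or_iff_not_imp_left.2 (hc y)⟩

theorem NoCore.comp {ι' κ' : Type*} {L : ι → κ → ZMod 3} (h : NoCore L) (f : ι' → ι)
    (g : κ' → κ) : NoCore fun i y => L (f i) (g y) :=
  fun x z y y' => h (f x) (f z) (g y) (g y')

theorem NF.rows_of_eq_zero {L : ι → κ → ZMod 3} (h : NF L) {e : ι} (he : ∀ y, L e y = 0)
    (x z w v : ι) : NF ![0, L x, L z, L w, L v] :=
  h.rows e ⟨x, 0, by simp [he]⟩ ⟨z, 0, by simp [he]⟩ ⟨w, 0, by simp [he]⟩ ⟨v, 0, by simp [he]⟩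

theorem exact_chain {L : ι → κ → ZMod 3} (h : NF L) {e : ι} {f : κ} (he : ∀ y, L e y = 0)
    (hf : ∀ x, L x f = 0) (B : Set κ) (x z w v : ι)
    (hxz : ∃ c, ∀ y ∈ B, L x y = c ∨ L z y = L x y) (hzx : ¬∃ c, ∀ y ∈ B, L z y = c ∨ L x y = L z y)
    (hzw : ∃ c, ∀ y ∈ B, L z y = c ∨ L w y = L z y) (hwz : ¬∃ c, ∀ y ∈ B, L w y = c ∨ L z y = L w y)
    (hwv : ∃ c, ∀ y ∈ B, L w y = c ∨ L v y = L w y) (hvw : ¬∃ c, ∀ y ∈ B, L v y = c ∨ L w y = L v y)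
    (hwx : ∃ c, ∀ y ∈ B, L w y = c ∨ L x y = L w y) (hvz : ∃ c, ∀ y ∈ B, L v y = c ∨ L z y = L v y)
    (hvx : ∃ c, ∀ y ∈ B, L v y = c ∨ L x y = L v y) : False := by
  obtain ⟨c, hxz⟩ := hxz
  obtain ⟨d, hzw⟩ := hzw
  obtain ⟨b, hwv⟩ := hwv
  have hK : NF fun (i : ι) (y : ↥(insert f B)) => L i y := h.comp id Subtype.val
  have key := hK.rows_of_eq_zero (e := e) (fun y => he y) x z w v
  have hzs := mem_zs
  have hs := search_exact
  simp only [List.all_eq_true] at hs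
  refine key.search_four (hs c (hzs c) d (hzs d) b (hzs b)) ?_ ?_ ?_
  · rintro ⟨y, hy⟩
    simp only [Bool.and_eq_true, Bool.or_eq_true, beq_iff_eq, (ZMod.val_injective 3).eq_iff]
    rcases hy with rfl | hy
    · simp [hf]
    · exact ⟨⟨hxz y hy, hzw y hy⟩, hwv y hy⟩
  · simp only [List.mem_singleton, forall_eq]
    exact ⟨⟨f, by simp⟩, by simp [hf, enc]⟩
  · have hal : ∀ p q : ι, (∃ c, ∀ y ∈ B, L p y = c ∨ L q y = L p y) →
        ∃ a, ∀ y : ↥(insert f B), L p y = a ∨ L q y = L p y := by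
      rintro p q ⟨c, hc⟩
      refine ⟨c, ?_⟩
      rintro ⟨y, rfl | hy⟩
      · simp [hf]
      · exact hc y hy
    have hex : ∀ p q : ι, (¬∃ c, ∀ y ∈ B, L p y = c ∨ L q y = L p y) → ∀ c,
        ∃ y : ↥(insert f B), ¬ L p y = c ∧ ¬ L q y = L p y := by
      intro p q hh c
      by_contra! h'
      exact hh ⟨c, fun y hy => or_iff_not_imp_left.2 (h' ⟨y, by simp [hy]⟩)⟩
    simp only [exactReqs, List.forall_mem_cons, List.forall_mem_append, List.forall_mem_map,
      exists_mem_map, exists_mem_cons, exists_mem_nil, forall_mem_nil,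
      forall_mem_zs, exists_mem_zs, al_holds, ex_holds, or_false, and_true]
    simp only [Bool.and_eq_true, Bool.or_eq_true, Bool.not_eq_true', beq_iff_eq,
      beq_eq_false_iff_ne, (ZMod.val_injective 3).eq_iff, ne_eq]
    exact ⟨⟨⟨⟨hal w x hwx, hal v z hvz, hal v x hvx⟩, hex z x hzx⟩, hex w z hwz⟩, hex v w hvw⟩

theorem cyclic {L : ι → κ → ZMod 3} (h : NF L) (hL : NoCore L) {e : ι} {f : κ}
    (he : ∀ y, L e y = 0) (hf : ∀ x, L x f = 0) (B : Set κ) (r : ι) (x : ZMod 3 → ι)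
    (hx : ∀ c, ∀ y ∈ B, (L (x c) y = L r y ↔ L r y ≠ c)) (hr : ∀ c, ∃ y ∈ B, L r y = c) :
    False := by
  have hK : NF fun (i : ι) (y : ↥(insert f B)) => L i y := h.comp id Subtype.val
  have hL' : NoCore fun (i : ι) (y : ↥(insert f B)) => L i y := hL.comp id Subtype.val
  have key := hK.rows_of_eq_zero (e := e) (fun y => he y) r (x 0) (x 1) (x 2)
  have hzs := mem_zs
  have d1 : ∀ r x z w : ZMod 3, (x = r ↔ r ≠ 0) → (z = r ↔ r ≠ 1) → (w = r ↔ r ≠ 2) →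
      ((x.val == r.val) == !(r.val == 0) && (z.val == r.val) == !(r.val == 1) &&
        (w.val == r.val) == !(r.val == 2)) = true := by decide
  have d2 : ∀ (c x : ZMod 3), ¬ x = c → (c.val == c.val && !(x.val == c.val)) = true := by decide
  refine key.search_four search_cyclic ?_ ?_ ?_
  · rintro ⟨y, hy⟩
    rcases hy with rfl | hy
    · simp [hf]
    · rw [Bool.or_eq_true]
      exact Or.inr (d1 _ _ _ _ (hx 0 y hy) (hx 1 y hy) (hx 2 y hy))
  · simp only [List.mem_singleton, forall_eq]
    exact ⟨⟨f, by simp⟩, by simp [hf, enc]⟩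
  · have hal : ∀ p q : ι, (∃ a, ∀ y : ↥(insert f B), L p y = L q y ∨ L p y = a) ∨
        ∃ a, ∀ y : ↥(insert f B), L p y = L q y ∨ L q y = a := by
      intro p q
      exact (hL'.const p q).imp (fun ⟨c, hc⟩ => ⟨c, hc⟩) (fun ⟨c, hc⟩ => ⟨c, hc⟩)
    have hex : ∀ c, ∃ y : ↥(insert f B), L r y = c ∧ ¬ L (x c) y = c := by
      intro c
      obtain ⟨y, hy, e⟩ := hr c
      refine ⟨⟨y, by simp [hy]⟩, e, fun h' => (hx c y hy).1 (h'.trans e.symm) e⟩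
    have hex' : ∀ c, ∃ y : ↥(insert f B), ((L r y).val == c.val && !((L (x c) y).val == (L r y).val)) = true := by
      intro c
      obtain ⟨y, h1, h2⟩ := hex c
      refine ⟨y, ?_⟩
      rw [h1]
      exact d2 c _ h2
    simp only [cyclicReqs, List.forall_mem_cons,
      exists_mem_append, exists_mem_map, exists_mem_cons, exists_mem_nil, forall_mem_nil,
      exists_mem_zs, al_holds, ex_holds, or_false, and_true]
    refine ⟨hex' 0, hex' 1, hex' 2, ?_⟩
    simp only [Bool.or_eq_true, beq_iff_eq, (ZMod.val_injective 3).eq_iff]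
    exact ⟨hal _ _, hal _ _, hal _ _⟩

/-- When there is no core, every nonempty submatrix has a constant row or column. -/
theorem exists_const [Finite ι] [Finite κ] {L : ι → κ → ZMod 3} (h : NF L) (hL : NoCore L) {e : ι}
    {f : κ} (he : ∀ y, L e y = 0) (hf : ∀ x, L x f = 0) (A : Set ι) (B : Set κ) (hA : A.Nonempty) :
    (∃ r ∈ A, ∃ c, ∀ y ∈ B, L r y = c) ∨ ∃ y ∈ B, ∃ c, ∀ x ∈ A, L x y = c := by
  by_contra! hcon
  obtain ⟨hrow, hcol⟩ := hcon
  have tot : ∀ x z : A, (∃ c, ∀ y ∈ B, L x y = c ∨ L z y = L x y) ∨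
      ∃ c, ∀ y ∈ B, L z y = c ∨ L x y = L z y := by
    intro x z
    rcases hL.const x z with ⟨c, hc⟩ | ⟨c, hc⟩
    · exact Or.inl ⟨c, fun y _ => (hc y).symm.imp_right Eq.symm⟩
    · exact Or.inr ⟨c, fun y _ => (hc y).symm⟩
  have : Nonempty A := hA.to_subtype
  obtain ⟨⟨r, hrA⟩, hr⟩ := exists_source
    (fun x z : A => ∃ c, ∀ y ∈ B, L x y = c ∨ L z y = L x y) tot
    (fun x z w v h1 h2 h3 h4 h5 h6 h7 h8 h9 =>
      exact_chain h he hf B x z w v h1 h2 h3 h4 h5 h6 h7 h8 h9)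
  simp only [Subtype.forall] at hr
  have hcls : ∀ c, (∃ y ∈ B, L r y = c) → ∃ x ∈ A, ∀ y ∈ B, (L x y = L r y ↔ L r y ≠ c) := by
    rintro c ⟨y, hy, hyc⟩
    have hS : {x | x ∈ A ∧ ∀ y ∈ B, L r y = c ∨ L x y = L r y}.Nonempty :=
      ⟨r, hrA, fun _ _ => Or.inr rfl⟩
    obtain ⟨x, ⟨hxA, hx⟩, hmax⟩ := Set.exists_max_image _ (fun x => {y ∈ B | L x y ≠ L r y}.ncard)
      (Set.toFinite _) hS
    refine ⟨x, hxA, fun y hy => ⟨fun hxy hyc => ?_, fun h' => (hx y hy).resolve_left h'⟩⟩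
    obtain ⟨z, hzA, hz⟩ := hcol y hy (L r y)
    obtain ⟨c', hc'⟩ := hr z hzA
    obtain rfl : c' = c := ((hc' y hy).resolve_right hz).symm.trans hyc
    have hzz := hmax z ⟨hzA, hc'⟩
    have : ∃ y₁ ∈ B, L x y₁ ≠ L r y₁ ∧ L z y₁ = L r y₁ := by
      by_contra! hcon
      refine (Set.ncard_lt_ncard ?_ (Set.toFinite _)).not_ge hzz
      refine ⟨fun y₁ h₁ => ⟨h₁.1, hcon y₁ h₁.1 h₁.2⟩, fun hsub => ?_⟩
      exact (hsub (show y ∈ {y ∈ B | L z y ≠ L r y} from ⟨hy, hz⟩)).2 hxy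
    obtain ⟨y₁, hy₁, h1, h2⟩ := this
    have h3 := (hx y₁ hy₁).resolve_right h1
    rcases hL x z y y₁ (by rw [hxy]; exact hz.symm) (by rw [h2]; exact h1) with h4 | h4
    · exact h1 (by rw [← h4, hxy, h3, hyc])
    · exact hz (by rw [h4, h2, h3, hyc])
  by_cases hall : ∀ c, ∃ y ∈ B, L r y = c
  · choose x hxA hx using fun c => hcls c (hall c)
    exact cyclic h hL he hf B r x hx hall
  · push Not at hall
    obtain ⟨c, hc⟩ := hall
    have d : ∀ c t : ZMod 3, t ≠ c → t = c + 1 ∨ t = c + 2 := by decide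
    have d' : ∀ c : ZMod 3, c + 1 ≠ c + 2 := by decide
    have h1 : ∃ y ∈ B, L r y = c + 1 := by
      obtain ⟨y, hy, h'⟩ := hrow r hrA (c + 2)
      exact ⟨y, hy, (d _ _ (hc y hy)).resolve_right h'⟩
    have h2 : ∃ y ∈ B, L r y = c + 2 := by
      obtain ⟨y, hy, h'⟩ := hrow r hrA (c + 1)
      exact ⟨y, hy, (d _ _ (hc y hy)).resolve_left h'⟩
    obtain ⟨x, hxA, hx⟩ := hcls _ h1
    obtain ⟨z, hzA, hz⟩ := hcls _ h2
    have hne : ∀ y ∈ B, L x y ≠ L z y := by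
      intro y hy h'
      rcases d _ _ (hc y hy) with h3 | h3
      · exact (hx y hy).1 (h'.trans ((hz y hy).2 (h3 ▸ d' c))) h3
      · exact (hz y hy).1 (h'.symm.trans ((hx y hy).2 (h3 ▸ (d' c).symm))) h3
    rcases hL.const x z with ⟨a, ha⟩ | ⟨a, ha⟩
    · obtain ⟨y, hy, h'⟩ := hrow x hxA a
      exact h' ((ha y).resolve_left (hne y hy))
    · obtain ⟨y, hy, h'⟩ := hrow z hzA a
      exact h' ((ha y).resolve_left (hne y hy))

end NoCore

section Ordering

/-- A family of sets from which elements can be removed one at a time gives an ordering. -/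
theorem exists_list {γ : Type*} (G : Set γ → Prop)
    (step : ∀ U : Set γ, U.Nonempty → G U → ∃ z ∈ U, G (U \ {z})) (U : Finset γ) (hU : G U) :
    ∃ l : List γ, l.Nodup ∧ (∀ z, z ∈ l ↔ z ∈ U) ∧ ∀ k, G {z | z ∈ l.drop k} := by
  induction hn : U.card generalizing U with
  | zero =>
    obtain rfl := Finset.card_eq_zero.1 hn
    exact ⟨[], by simp, by simp, fun k => by simpa using hU⟩
  | succ n ih =>
    obtain ⟨z, hz, hG⟩ := step U (by
      rw [Finset.coe_nonempty, ← Finset.card_pos]; omega) hU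
    have hz : z ∈ U := hz
    obtain ⟨l, h1, h2, h3⟩ := ih (U.erase z) (by rwa [Finset.coe_erase])
      (by rw [Finset.card_erase_of_mem hz, hn]; rfl)
    have hmem : ∀ w, w ∈ z :: l ↔ w ∈ U := by
      intro w
      rw [List.mem_cons, h2, Finset.mem_erase]
      by_cases h : w = z
      · simp [h, hz]
      · simp [h]
    refine ⟨z :: l, List.nodup_cons.2 ⟨by simp [h2], h1⟩, hmem, ?_⟩
    rintro (_ | k)
    · have : {w | w ∈ (z :: l).drop 0} = (U : Set γ) := by
        ext w
        simpa using hmem w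
      rw [this]
      exact hU
    · simpa using h3 k

theorem exists_fin_ordering {γ : Type*} (G : Set γ → Prop)
    (step : ∀ U : Set γ, U.Nonempty → G U → ∃ z ∈ U, G (U \ {z})) (U : Set γ) (hfin : U.Finite)
    (hU : G U) : ∃ (n : ℕ) (e : Fin n → γ), Function.Injective e ∧ range e = U ∧
      ∀ t : Fin n, G (U \ e '' {i | i ≤ t}) := by
  obtain ⟨l, h1, h2, h3⟩ := exists_list G step hfin.toFinset (by simpa using hU)
  have hr : range l.get = U := by
    ext z
    rw [Set.range_list_get]
    simp [h2]
  refine ⟨l.length, l.get, List.nodup_iff_injective_get.1 h1, hr, fun t => ?_⟩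
  convert h3 (t + 1) using 1
  ext z
  simp only [Set.mem_sdiff, Set.mem_image, Set.mem_ofPred_eq, not_exists, not_and]
  constructor
  · rintro ⟨hz, h⟩
    rw [← hr] at hz
    obtain ⟨i, rfl⟩ := hz
    have : ¬ i ≤ t := fun hi => h i hi rfl
    rw [List.mem_drop_iff_getElem]
    exact ⟨i - (t + 1), by omega, by simp only [List.get_eq_getElem]; congr 1; omega⟩
  · intro hz
    refine ⟨by simpa [h2] using List.mem_of_mem_drop hz, fun i hi hiz => ?_⟩
    rw [List.mem_drop_iff_getElem] at hz
    obtain ⟨j, hj, rfl⟩ := hz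
    have := List.nodup_iff_injective_get.1 h1 (a₁ := i) (a₂ := ⟨t + 1 + j, by omega⟩)
      (by simpa using hiz)
    rw [this, Fin.le_def] at hi
    simp only at hi
    omega

variable {ι κ : Type*}

/-- Rows outside `A` are constant on `B`, and columns outside `B` are constant on `A`. -/
def Eliminated (L : ι → κ → ZMod 3) (A : Set ι) (B : Set κ) : Prop :=
  (∀ x ∉ A, ∃ c, ∀ y ∈ B, L x y = c) ∧ ∀ y ∉ B, ∃ c, ∀ x ∈ A, L x y = c

theorem Eliminated.step [Finite ι] [Finite κ] {L : ι → κ → ZMod 3} (h : NF L) (hL : NoCore L)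
    {e : ι} {f : κ} (he : ∀ y, L e y = 0) (hf : ∀ x, L x f = 0) {A : Set ι} {B : Set κ}
    (hAB : Eliminated L A B) (hne : A.Nonempty ∨ B.Nonempty) :
    (∃ r ∈ A, Eliminated L (A \ {r}) B) ∨ ∃ y ∈ B, Eliminated L A (B \ {y}) := by
  rcases A.eq_empty_or_nonempty with rfl | hA
  · obtain ⟨y, hy⟩ := hne.resolve_left (by simp)
    refine Or.inr ⟨y, hy, fun x hx => ?_, by simp⟩
    obtain ⟨c, hc⟩ := hAB.1 x hx
    exact ⟨c, fun z hz => hc z hz.1⟩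
  · rcases exists_const h hL he hf A B hA with ⟨r, hr, c, hc⟩ | ⟨y, hy, c, hc⟩
    · refine Or.inl ⟨r, hr, fun x hx => ?_, fun y hy => ?_⟩
      · by_cases hxr : x = r
        · exact ⟨c, hxr ▸ hc⟩
        · exact hAB.1 x fun h' => hx ⟨h', hxr⟩
      · obtain ⟨c, hc⟩ := hAB.2 y hy
        exact ⟨c, fun x hx => hc x hx.1⟩
    · refine Or.inr ⟨y, hy, fun x hx => ?_, fun z hz => ?_⟩
      · obtain ⟨c, hc⟩ := hAB.1 x hx
        exact ⟨c, fun y hy => hc y hy.1⟩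
      · by_cases hzy : z = y
        · exact ⟨c, hzy ▸ hc⟩
        · exact hAB.2 z fun h' => hz ⟨h', hzy⟩

end Ordering

section RowGood

theorem val_eq_zero : ∀ x : ZMod 3, x.val = 0 ↔ x = 0 := by decide

theorem val_eq_one : ∀ x : ZMod 3, x.val = 1 ↔ x = 1 := by decide

theorem val_eq_two : ∀ x : ZMod 3, x.val = 2 ↔ x = 2 := by decide

theorem five_sub_val : ∀ x : ZMod 3, (5 - x.val) % 3 = (-x - 1).val := by decide

theorem four_sub_val : ∀ x : ZMod 3, (4 - x.val) % 3 = (-x - 2).val := by decide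

variable {ι κ : Type*}

/-- The functions `p` and `q` are alternately zero, and both take all nonzero values. -/
structure Crossing (p q : κ → ZMod 3) : Prop where
  cross : ∀ y, p y = 0 ∨ q y = 0
  left : ∀ k, k ≠ 0 → ∃ y, p y = k
  right : ∀ k, k ≠ 0 → ∃ y, q y = k

theorem Crossing.symm {p q : κ → ZMod 3} (h : Crossing p q) : Crossing q p :=
  ⟨fun y => (h.cross y).symm, h.right, h.left⟩

theorem extremalReqs_holds [Finite κ] {a b c d p q : κ → ZMod 3} {D : Set κ}
    (hpq : Crossing p q → {y | p y ≠ 0}.ncard ≤ D.ncard)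
    {D' p' q'} (hD : ∀ y, D' (a y).val (b y).val (c y).val (d y).val = true ↔ y ∈ D)
    (hp : ∀ y, p' (a y).val (b y).val (c y).val (d y).val = (p y).val)
    (hq : ∀ y, q' (a y).val (b y).val (c y).val (d y).val = (q y).val) :
    ∃ r ∈ extremalReqs D' p' q', r.Holds (codes a b c d) := by
  simp only [extremalReqs, exists_mem_cons, exists_mem_nil, al_holds, ex_holds, hp, hq,
    Bool.and_eq_true, Bool.or_eq_true, Bool.not_eq_true', beq_iff_eq, beq_eq_false_iff_ne, hD, ne_eq,
    or_false, val_eq_zero, val_eq_one, val_eq_two]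
  by_contra! hcon
  obtain ⟨h1, h2, ⟨y, hy, hyp⟩, h3, h4, h5, h6⟩ := hcon
  have d3 : ∀ k : ZMod 3, k ≠ 0 → k = 1 ∨ k = 2 := by decide
  have hlt : D.ncard < {y | p y ≠ 0}.ncard :=
    Set.ncard_lt_ncard ⟨fun y hy => h2 y hy, fun hs => hy (hs hyp)⟩ (Set.toFinite _)
  refine hlt.not_ge (hpq ⟨fun y => or_iff_not_imp_left.2 (h1 y), fun k hk => ?_, fun k hk => ?_⟩)
  · rcases d3 k hk with rfl | rfl <;> assumption
  · rcases d3 k hk with rfl | rfl <;> assumption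

theorem quadReqs_holds {L : ι → κ → ZMod 3} (h : NF L) (e x z w : ι) {s t v : ZMod 3}
    {a b c d q : κ → ZMod 3} (ha : ∀ y, a y = L x y - L e y - s) (hb : ∀ y, b y = L z y - L e y - t)
    (hq : ∀ y, q y = L w y - L e y - v) {q' : ℕ → ℕ → ℕ}
    (hq' : ∀ y, q' (c y).val (d y).val = (q y).val) :
    ∃ r ∈ quadReqs q', r.Holds (codes a b c d) := by
  simp only [quadReqs, exists_mem_cons, exists_mem_nil, al_holds, hq', Bool.not_eq_true',
    Bool.and_eq_false_iff, beq_eq_false_iff_ne, ne_eq, or_false, val_eq_zero, val_eq_one,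
    val_eq_two, ← not_and_or]
  by_contra! hcon
  obtain ⟨⟨y₀, ⟨h1, h2⟩, h3⟩, ⟨y₁, ⟨h4, h5⟩, h6⟩, ⟨y₂, ⟨h7, h8⟩, h9⟩, ⟨y₃, ⟨h10, h11⟩, h12⟩⟩ := hcon
  refine h.four ![e, x, z, w] ![y₀, y₁, y₂, y₃] ![0, s, t, v] ?_
  rw [ha] at h1 h4 h7 h10
  rw [hb] at h2 h5 h8 h11
  rw [hq] at h3 h6 h9 h12
  simp only [quad, Fin.forall_fin_succ, Fin.isValue, Matrix.cons_val_zero, Matrix.cons_val_succ,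
    IsEmpty.forall_iff, and_true, sub_self, add_zero, true_and]
  refine ⟨⟨?_, ?_, ?_, ?_⟩, ⟨?_, ?_, ?_, ?_⟩, ?_, ?_, ?_, ?_⟩
  · linear_combination h1
  · linear_combination h4
  · linear_combination h7
  · linear_combination h10
  · linear_combination h2
  · linear_combination h5
  · linear_combination h8
  · linear_combination h11
  · linear_combination h3
  · linear_combination h6
  · linear_combination h9
  · linear_combination h12

/-- Relative to some row, the other rows are comparable. -/
theorem exists_no_crossing [Finite κ] [Nonempty ι] {L : ι → κ → ZMod 3} (h : NF L) :
    ∃ e, ∀ x z s t, ¬ Crossing (fun y => L x y - L e y - s) fun y => L z y - L e y - t := by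
  by_contra! hcon
  have hbd : ∃ N, ∃ e x z s t, Crossing (fun y => L x y - L e y - s) (fun y => L z y - L e y - t) ∧
      {y | L z y - L e y - t ≠ 0}.ncard = N ∧
      ∀ e x z s t, Crossing (fun y => L x y - L e y - s) (fun y => L z y - L e y - t) →
      {y | L z y - L e y - t ≠ 0}.ncard ≤ N := by
    let P : ℕ → Prop := fun N => ∃ e x z s t, Crossing (fun y => L x y - L e y - s)
      (fun y => L z y - L e y - t) ∧ {y | L z y - L e y - t ≠ 0}.ncard = N
    obtain ⟨x, z, s, t, h0⟩ := hcon (Classical.arbitrary ι)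
    have hP : ∀ N, P N → N ≤ Nat.card κ := by
      rintro N ⟨e, x, z, s, t, -, rfl⟩
      exact Set.ncard_le_card _
    have h1 : P _ := ⟨_, x, z, s, t, h0, rfl⟩
    obtain ⟨e, x, z, s, t, h2, h3⟩ := Nat.findGreatest_spec (P := P) (hP _ h1) h1
    exact ⟨_, e, x, z, s, t, h2, h3, fun e x z s t h4 =>
      Nat.le_findGreatest (hP _ ⟨e, x, z, s, t, h4, rfl⟩) ⟨e, x, z, s, t, h4, rfl⟩⟩
  obtain ⟨N, e, x, z, s, t, hS, hN, hmax⟩ := hbd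
  obtain ⟨u, v, c, d, hS'⟩ := hcon x
  have key := h.rows e (RowOf.mk L e x s) (RowOf.mk L e z t) (RowOf.mk L e u (s + c))
    (RowOf.mk L e v (s + d))
  have hD : ∀ y, (!((L z y - L e y - t).val == 0)) = true ↔ y ∈ {y | L z y - L e y - t ≠ 0} := by
    intro y
    simp only [Bool.not_eq_true', beq_eq_false_iff_ne, ne_eq, val_eq_zero, mem_ofPred_eq]
  subst hN
  refine key.search_four search_extremal ?_ (by simp) ?_
  · intro y
    simp only [Bool.and_eq_true, Bool.or_eq_true, beq_iff_eq, (ZMod.val_injective 3).eq_iff,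
      val_eq_zero]
    exact ⟨hS.cross y, (hS'.cross y).imp (fun h' => by linear_combination h')
      (fun h' => by linear_combination h')⟩
  · have d1 : (1 : ZMod 3) ≠ 0 := by decide
    have d2 : (2 : ZMod 3) ≠ 0 := by decide
    have hl : ∀ {p q : κ → ZMod 3} {k : ZMod 3}, (∀ y, q y = p y) → (∃ y, p y = k) → ∃ y, q y = k :=
      fun hpq ⟨y, hy⟩ => ⟨y, (hpq y).trans hy⟩
    simp only [extremalCs, List.forall_mem_cons, forall_mem_nil, and_true]
    simp only [exists_mem_cons, exists_mem_nil, or_false, ex_holds, beq_iff_eq, val_eq_one,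
      val_eq_two, ← sub_val]
    refine ⟨hS.left 1 d1, hS.right 1 d1, hS.left 2 d2, hS.right 2 d2,
      hl (fun y => ?_) (hS'.left 1 d1), hl (fun y => ?_) (hS'.right 1 d1),
      hl (fun y => ?_) (hS'.left 2 d2), hl (fun y => ?_) (hS'.right 2 d2),
      extremalReqs_holds (hmax x u e c (1 - s) ∘ Crossing.symm) hD (fun y => ?_) (fun y => ?_),
      extremalReqs_holds (hmax x u e c (2 - s) ∘ Crossing.symm) hD (fun y => ?_) (fun y => ?_),
      extremalReqs_holds (hmax x v e d (1 - s) ∘ Crossing.symm) hD (fun y => ?_) (fun y => ?_),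
      extremalReqs_holds (hmax x v e d (2 - s) ∘ Crossing.symm) hD (fun y => ?_) (fun y => ?_),
      extremalReqs_holds (hmax x u z c (t - s) ∘ Crossing.symm) hD (fun y => ?_) (fun y => ?_),
      extremalReqs_holds (hmax x v z d (t - s) ∘ Crossing.symm) hD (fun y => ?_) (fun y => ?_),
      quadReqs_holds h e x z u (fun _ => rfl) (fun _ => rfl) (fun _ => rfl) fun _ => rfl,
      quadReqs_holds h e x z v (fun _ => rfl) (fun _ => rfl) (fun _ => rfl) fun _ => rfl⟩
    any_goals first | rw [five_sub_val] | rw [four_sub_val] | rw [← sub_val]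
    all_goals first | ring1 | (congr 1; ring1)

/-- `z` agrees with a shift of `x` wherever `x` differs from some value. -/
def Arrow (x z : κ → ZMod 3) : Prop := ∃ c b, ∀ y, x y = c ∨ z y - x y = b

theorem MidSplit.arrow_or_arrow {p q : κ → ZMod 3} (h : MidSplit p q)
    (hS : ∀ s t, ¬ Crossing (fun y => p y - s) fun y => q y - t) : Arrow p q ∨ Arrow q p := by
  obtain ⟨a, b, h | h | h⟩ := h
  · by_contra! hcon
    have d3 : ∀ a k t : ZMod 3, k ≠ 0 → t - a ≠ k → t = a ∨ t = a - k := by decide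
    refine hS a b ⟨fun y => by simpa [sub_eq_zero] using h y, fun k hk => ?_, fun k hk => ?_⟩
    · by_contra! hne
      refine hcon.1 ⟨a, b - (a - k), fun y => ?_⟩
      rcases d3 a k _ hk (hne y) with h' | h'
      · exact Or.inl h'
      · exact (h y).imp_right fun h'' => by rw [h', h'']
    · by_contra! hne
      refine hcon.2 ⟨b, a - (b - k), fun y => ?_⟩
      rcases d3 b k _ hk (hne y) with h' | h'
      · exact Or.inl h'
      · exact (h y).symm.imp_right fun h'' => by rw [h', h'']
  · exact Or.inl ⟨a, b, h⟩
  · exact Or.inr ⟨a, -b, fun y => (h y).imp_right fun h' => by linear_combination -h'⟩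

/-- Some row can be subtracted so that the rows become pairwise comparable. -/
theorem exists_row [Finite κ] [Nonempty ι] {L : ι → κ → ZMod 3} (h : NF L) :
    ∃ e, ∀ x z, Arrow (fun y => L x y - L e y) (fun y => L z y - L e y) ∨
      Arrow (fun y => L z y - L e y) (fun y => L x y - L e y) := by
  obtain ⟨e, he⟩ := exists_no_crossing h
  exact ⟨e, fun x z => (h.row e x z).arrow_or_arrow (he x z)⟩

end RowGood

section Column

variable {ι κ : Type*}

/-- `p` takes all values. -/
def Full (p : κ → ZMod 3) : Prop := ∀ i, ∃ y, p y = i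

theorem Full.sub {p : κ → ZMod 3} (h : Full p) (s : ZMod 3) : Full fun y => p y - s := by
  intro i
  obtain ⟨y, hy⟩ := h (i + s)
  exact ⟨y, by simp [hy]⟩

theorem Arrow.sub {p q : κ → ZMod 3} (h : Arrow p q) (s t : ZMod 3) :
    Arrow (fun y => p y - s) fun y => q y - t := by
  obtain ⟨c, b, h⟩ := h
  exact ⟨c - s, b - t + s, fun y => (h y).imp (fun h => by simp only [h])
    fun h => by linear_combination h⟩

theorem RowOf.of_zero {L : ι → κ → ZMod 3} {e : ι} (he : ∀ y, L e y = 0) (x : ι) (s : ZMod 3) :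
    RowOf L e fun y => L x y - s :=
  ⟨x, -s, fun y => by rw [he]; ring⟩

theorem split_arrow {R : ι → κ → ZMod 3} (h : NF R) {e : ι} (he : ∀ y, R e y = 0) {x z : ι}
    (hx : Full (R x)) (hz : Full (R z)) (hzx : ¬ Arrow (R z) (R x)) {c b : ZMod 3}
    (hxz : ∀ y, R x y = c ∨ R z y - R x y = b) (i : ZMod 3) : ∃ y, R x y = c ∧ R z y = i := by
  by_contra! hcon
  have hs := search_split
  simp only [List.all_eq_true] at hs
  refine (h.rows e (RowOf.of_zero he x c) (RowOf.of_zero he z (c + b)) (RowOf.zero _ _)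
    (RowOf.zero _ _)).search_two (hs (i - (c + b)) (mem_zs _)) ?_ (by simp) ?_
  · intro y
    simp only [Bool.and_eq_true, Bool.or_eq_true, beq_iff_eq, (ZMod.val_injective 3).eq_iff,
      val_eq_zero, Bool.not_eq_true', Bool.and_eq_false_iff, beq_eq_false_iff_ne, ne_eq]
    refine ⟨(hxz y).imp (fun h' => by rw [h', sub_self]) fun h' => by linear_combination h', ?_⟩
    by_cases h1 : R x y = c
    · exact Or.inr fun h2 => hcon y h1 (sub_left_injective h2)
    · exact Or.inl fun h2 => h1 (sub_eq_zero.1 h2)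
  · simp only [splitReqs, List.forall_mem_append, List.forall_mem_map, List.forall_mem_flatMap,
      exists_mem_cons, exists_mem_nil, forall_mem_zs, ex_holds, or_false, Bool.and_eq_true,
      Bool.not_eq_true', beq_iff_eq, beq_eq_false_iff_ne, (ZMod.val_injective 3).eq_iff, ne_eq,
      ← sub_val]
    refine ⟨⟨hx.sub _, hz.sub _⟩, fun a d => ?_⟩
    by_contra! hcon'
    exact hzx ⟨a + (c + b), d - b, fun y => or_iff_not_imp_left.2 fun h1 => by
      linear_combination hcon' y fun h2 => h1 (by linear_combination h2)⟩

theorem arrow_chain {R : ι → κ → ZMod 3} (h : NF R) {e : ι} (he : ∀ y, R e y = 0) {x z w v : ι}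
    (hx : Full (R x)) (hz : Full (R z)) (hw : Full (R w)) (hv : Full (R v))
    (hxz : Arrow (R x) (R z)) (hzx : ¬ Arrow (R z) (R x))
    (hzw : Arrow (R z) (R w)) (hwz : ¬ Arrow (R w) (R z))
    (hwv : Arrow (R w) (R v)) (hvw : ¬ Arrow (R v) (R w))
    (hwx : Arrow (R w) (R x)) (hvz : Arrow (R v) (R z)) (hvx : Arrow (R v) (R x)) : False := by
  obtain ⟨c, b, hxz⟩ := hxz
  obtain ⟨c', b', hzw⟩ := hzw
  obtain ⟨c'', b'', hwv⟩ := hwv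
  have h1 := split_arrow h he hx hz hzx hxz
  have h2 := split_arrow h he hz hw hwz hzw
  have h3 := split_arrow h he hw hv hvw hwv
  have hs := search_arrow
  simp only [List.all_eq_true] at hs
  refine (h.rows e (RowOf.of_zero he x c) (RowOf.of_zero he z (b + c))
    (RowOf.of_zero he w (b' + b + c)) (RowOf.of_zero he v (b'' + b' + b + c))).search_four
    (hs (c' - (b + c)) (mem_zs _) (c'' - (b' + b + c)) (mem_zs _)) ?_ (by simp) ?_
  · intro y
    simp only [Bool.and_eq_true, Bool.or_eq_true, beq_iff_eq, (ZMod.val_injective 3).eq_iff,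
      val_eq_zero]
    exact ⟨⟨(hxz y).imp (fun h' => by rw [h', sub_self]) fun h' => by linear_combination h',
      (hzw y).imp (fun h' => by rw [h']) fun h' => by linear_combination h'⟩,
      (hwv y).imp (fun h' => by rw [h']) fun h' => by linear_combination h'⟩
  · have hsub : ∀ {p q : κ → ZMod 3} {a : ZMod 3} (s t t' : ZMod 3), t = a - s →
        (∀ i, ∃ y, p y = a ∧ q y = i) → ∀ i, ∃ y, p y - s = t ∧ q y - t' = i := by
      rintro p q a s t t' rfl hpq i
      obtain ⟨y, h1, h2⟩ := hpq (i + t')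
      exact ⟨y, by rw [h1], by rw [h2]; ring⟩
    simp only [arrowReqs, List.forall_mem_append, List.forall_mem_map, List.forall_mem_cons,
      forall_mem_nil, exists_mem_flatMap, exists_mem_map, exists_mem_zs, al_holds, and_true,
      exists_mem_cons, exists_mem_nil, forall_mem_zs, ex_holds, or_false, Bool.and_eq_true,
      Bool.or_eq_true, beq_iff_eq, (ZMod.val_injective 3).eq_iff, ← sub_val, val_eq_zero]
    exact ⟨⟨⟨⟨⟨hwx.sub _ _, hvz.sub _ _, hvx.sub _ _⟩, hsub _ _ _ (by ring) h1⟩,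
      hsub _ _ _ rfl h2⟩, hsub _ _ _ rfl h3⟩, hx.sub _⟩

/-- `x` has the shape `k` relative to `r`, at the value `c` of `r`. -/
def Shaped (r x : κ → ZMod 3) (k c s : ZMod 3) : Prop :=
  ∀ y, shape k.val (r y - c).val (x y - s).val = true

/-- The set of columns where a shaped row is rooted. -/
def coreSet (r x : κ → ZMod 3) (k c s : ZMod 3) : Set κ :=
  {y | core k.val (r y - c).val (x y - s).val = true}

/-- The row `x` prevents the columns with `r = c` from being chosen. -/
def Blocked (r x : κ → ZMod 3) (c : ZMod 3) : Prop :=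
  ∃ k s : ZMod 3, (∀ y, block c.val k.val (r y).val (x y - s).val = true) ∧
    ∃ y, blockReq k.val (x y - s).val = true

theorem coreSet_chain {R : ι → κ → ZMod 3} (h : NF R) {e : ι} (he : ∀ y, R e y = 0) {r x z : ι}
    (hr : Full (R r)) {k l c d s t : ZMod 3} (hx : Shaped (R r) (R x) k c s)
    (hz : Shaped (R r) (R z) l d t) (hcd : c = d) :
    coreSet (R r) (R x) k c s ⊆ coreSet (R r) (R z) l d t ∨
      coreSet (R r) (R z) l d t ⊆ coreSet (R r) (R x) k c s := by
  subst hcd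
  by_contra! hcon
  obtain ⟨h1, h2⟩ := hcon
  obtain ⟨y, h1, h1'⟩ := Set.not_subset.1 h1
  obtain ⟨y', h2, h2'⟩ := Set.not_subset.1 h2
  have hs := search_chain
  simp only [List.all_eq_true] at hs
  refine (h.rows e (RowOf.of_zero he r c) (RowOf.of_zero he x s) (RowOf.of_zero he z t)
    (RowOf.zero _ _)).search_three (hs k (mem_zs _) l (mem_zs _)) ?_ (by simp) ?_
  · intro y
    rw [Bool.and_eq_true]
    exact ⟨hx y, hz y⟩
  · simp only [List.forall_mem_append, List.forall_mem_map, List.forall_mem_cons, forall_mem_nil,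
      and_true, exists_mem_cons, exists_mem_nil, forall_mem_zs, ex_holds, or_false,
      beq_iff_eq, (ZMod.val_injective 3).eq_iff]
    refine ⟨hr.sub _, ⟨y, ?_⟩, ⟨y', ?_⟩⟩
    · rw [Bool.and_eq_true, Bool.not_eq_true']
      exact ⟨h1, by simpa [coreSet] using h1'⟩
    · rw [Bool.and_eq_true, Bool.not_eq_true']
      exact ⟨h2, by simpa [coreSet] using h2'⟩

theorem exists_unblocked {R : ι → κ → ZMod 3} (h : NF R) {e : ι} (he : ∀ y, R e y = 0) {r : ι}
    (hr : Full (R r)) : ∃ c, ∀ x, ¬ Blocked (R r) (R x) c := by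
  by_contra! hcon
  obtain ⟨x, k, s, hx, hx'⟩ := hcon 0
  obtain ⟨z, l, t, hz, hz'⟩ := hcon 1
  obtain ⟨w, j, u, hw, hw'⟩ := hcon 2
  have hs := search_block
  simp only [List.all_eq_true] at hs
  have hr0 : RowOf R e (R r) := ⟨r, 0, fun y => by simp [he]⟩
  refine (h.rows e hr0 (RowOf.of_zero he x s) (RowOf.of_zero he z t)
    (RowOf.of_zero he w u)).search_four (hs k (mem_zs _) l (mem_zs _) j (mem_zs _)) ?_ (by simp) ?_
  · intro y
    rw [Bool.and_eq_true, Bool.and_eq_true]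
    exact ⟨⟨hx y, hz y⟩, hw y⟩
  · simp only [List.forall_mem_append, List.forall_mem_map, List.forall_mem_cons, forall_mem_nil,
      and_true, exists_mem_cons, exists_mem_nil, forall_mem_zs, ex_holds, or_false,
      beq_iff_eq, (ZMod.val_injective 3).eq_iff]
    exact ⟨hr, hx', hz', hw'⟩

theorem mem_corePairs : ∀ a b c d : ZMod 3, a ≠ b → c ≠ d → a ≠ c → b ≠ d →
    ((a, b), (c, d)) ∈ corePairs ∨ ((c, d), (a, b)) ∈ corePairs := by
  have d : ∀ a b c d : ZMod 3, (a == b || c == d || a == c || b == d ||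
      corePairs.contains ((a, b), (c, d)) || corePairs.contains ((c, d), (a, b))) = true := by
    decide +kernel
  intro a b c d' h1 h2 h3 h4
  simpa [h1, h2, h3, h4] using d a b c d'

theorem noCore_of_pairs {L : ι → κ → ZMod 3} (h : ∀ t ∈ corePairs, ∀ x z,
    (∃ y, L x y = t.1.1 ∧ L z y = t.1.2) → (∃ y, L x y = t.2.1 ∧ L z y = t.2.2) → False) :
    NoCore L := by
  intro x z y y' h1 h2
  by_contra! h3
  rcases mem_corePairs _ _ _ _ h1 h2 h3.1 h3.2 with h4 | h4
  · exact h _ h4 x z ⟨y, rfl, rfl⟩ ⟨y', rfl, rfl⟩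
  · exact h _ h4 x z ⟨y', rfl, rfl⟩ ⟨y, rfl, rfl⟩

theorem noCore_of_rooted {R : ι → κ → ZMod 3} (h : NF R) {e : ι} (he : ∀ y, R e y = 0) {r : ι}
    (hr : Full (R r)) (f : κ)
    (hroot : ∀ x, ∃ k < 7, ∀ y, rooted k (R r y - R r f).val (R x y - R x f).val = true) :
    NoCore fun x y => R x y - R x f := by
  refine noCore_of_pairs fun t ht x z h1 h2 => ?_
  obtain ⟨k, hk, hx⟩ := hroot x
  obtain ⟨l, hl, hz⟩ := hroot z
  have hs := search_rooted
  simp only [List.all_eq_true, List.mem_range] at hs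
  refine (h.rows e (RowOf.of_zero he r (R r f)) (RowOf.of_zero he x (R x f))
    (RowOf.of_zero he z (R z f)) (RowOf.zero _ _)).search_three (hs k hk l hl t ht) ?_ ?_ ?_
  · intro y
    rw [Bool.and_eq_true]
    exact ⟨hx y, hz y⟩
  · simp only [List.mem_singleton, forall_eq]
    exact ⟨f, by simp [enc]⟩
  · simp only [List.forall_mem_cons, forall_mem_nil, and_true, exists_mem_cons, exists_mem_nil,
      ex_holds, or_false, beq_iff_eq, (ZMod.val_injective 3).eq_iff, Bool.and_eq_true, val_eq_one,
      val_eq_two]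
    exact ⟨hr.sub _ _, hr.sub _ _, h1, h2⟩

theorem Arrow.exists_shaped {r x : κ → ZMod 3} (h : Arrow r x) : ∃ k c s, Shaped r x k c s := by
  obtain ⟨c, b, h⟩ := h
  have d : ∀ r x c b : ZMod 3, (r = c ∨ x - r = b) →
      shape (0 : ZMod 3).val (r - c).val (x - (b + c)).val = true := by decide +kernel
  exact ⟨0, c, b + c, fun y => d _ _ _ _ (h y)⟩

theorem Arrow.exists_shaped' {r x : κ → ZMod 3} (h : Arrow x r) (hr : Full r) (hx : ¬ Full x) :
    ∃ k c s, Shaped r x k c s := by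
  obtain ⟨m, b, h⟩ := h
  simp only [Full, not_forall, not_exists] at hx
  obtain ⟨t, ht⟩ := hx
  by_cases htm : t = m
  · obtain ⟨y, hy⟩ := hr (t + b)
    refine (ht y ?_).elim
    have h1 := (h y).resolve_left (htm ▸ ht y)
    linear_combination hy - h1
  · have d : ∀ r x m b t : ZMod 3, (x = m ∨ r - x = b) → x ≠ t → t ≠ m →
        shape (m - t).val (r - (m - t + m + b)).val (x - m).val = true := by decide +kernel
    exact ⟨m - t, _, m, fun y => d _ _ _ _ _ (h y) (ht y) htm⟩

theorem rooted_of_shaped {r x : κ → ZMod 3} {f : κ} {k c s : ZMod 3} (h : Shaped r x k c s)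
    (hb : ¬ Blocked r x (r f)) (hf : r f = c → (coreSet r x k c s).Nonempty →
      f ∈ coreSet r x k c s) :
    ∃ k < 7, ∀ y, rooted k (r y - r f).val (x y - x f).val = true := by
  by_cases hk : k = 0
  · subst hk
    by_cases hc : r f = c
    · have hne : (coreSet r x 0 c s).Nonempty := by
        by_contra hne
        rw [Set.not_nonempty_iff_eq_empty] at hne
        refine hb ⟨0, s - c, fun y => ?_, f, rfl⟩
        have h1 : y ∉ coreSet r x 0 c s := by simp [hne]
        have h2 := h y
        rw [hc]
        simp only [coreSet, mem_ofPred_eq] at h1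
        revert h1 h2
        generalize r y = a
        generalize x y = b
        clear * -
        revert a b c s
        decide +kernel
      have h1 := hf hc hne
      refine ⟨0, by norm_num, fun y => ?_⟩
      have h2 := h y
      rw [hc]
      simp only [coreSet, mem_ofPred_eq, hc] at h1
      revert h1 h2
      generalize r y = a
      generalize x y = b
      generalize x f = b'
      clear * -
      revert a b b' c s
      decide +kernel
    · refine ⟨(c - r f).val, by have := ZMod.val_lt (c - r f); omega, fun y => ?_⟩
      have h1 := h f
      have h2 := h y
      revert hc h1 h2
      generalize r y = a
      generalize x y = b
      generalize r f = a'
      generalize x f = b'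
      clear * -
      revert a b a' b' c s
      decide +kernel
  · by_cases hne : (coreSet r x k c s).Nonempty
    · by_cases hc : r f = c
      · have h1 := hf hc hne
        refine ⟨2 + (-k).val, by have := ZMod.val_lt (-k); omega, fun y => ?_⟩
        have h2 := h y
        simp only [coreSet, mem_ofPred_eq] at h1
        revert hk hc h1 h2
        generalize r y = a
        generalize x y = b
        generalize r f = a'
        generalize x f = b'
        clear * -
        rintro h h'
        subst h'
        revert h
        revert a b a' b' s k
        decide +kernel
      · by_cases hck : c = r f - k
        · refine (hb ⟨k, s, fun y => ?_, ?_⟩).elim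
          · have h2 := h y
            revert hk h2 hck
            generalize r y = a
            generalize x y = b
            generalize r f = a'
            clear * -
            intro h h1 h2
            subst h1
            revert h h2
            revert a b a' k s
            decide +kernel
          · obtain ⟨y, hy⟩ := hne
            refine ⟨y, ?_⟩
            simp only [coreSet, mem_ofPred_eq] at hy
            revert hk hy
            generalize r y = a
            generalize x y = b
            clear * -
            revert a b c k s
            decide +kernel
        · refine ⟨4 + k.val, by have := ZMod.val_lt k; omega, fun y => ?_⟩
          have hck' : c = r f + k := by
            have d : ∀ a k c : ZMod 3, k ≠ 0 → a ≠ c → c ≠ a - k → c = a + k := by decide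
            exact d _ _ _ hk hc hck
          have h1 := h f
          have h2 := h y
          clear hc hck
          subst hck'
          revert hk h1 h2
          generalize r y = a
          generalize x y = b
          generalize r f = a'
          generalize x f = b'
          clear * -
          revert a b a' b' k s
          decide +kernel
    · have hs : ∀ y, x y = s := by
        intro y
        have h1 := h y
        have h2 : y ∉ coreSet r x k c s := fun h2 => hne ⟨y, h2⟩
        simp only [coreSet, mem_ofPred_eq] at h2
        revert hk h1 h2
        generalize r y = a
        generalize x y = b
        clear * -
        revert a b c k s
        decide +kernel
      refine ⟨5, by norm_num, fun y => ?_⟩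
      rw [hs, hs, sub_self]
      rfl

end Column

section ChooseColumn

variable {ι κ : Type*}

theorem exists_two_values {p : κ → ZMod 3} (hp : ¬ Full p) (f : κ) :
    ∃ k : ZMod 3, k ≠ 0 ∧ ∀ y, p y - p f = 0 ∨ p y - p f = k := by
  simp only [Full, not_forall, not_exists] at hp
  obtain ⟨t, ht⟩ := hp
  have d : ∀ a t b : ZMod 3, a ≠ t → b ≠ t → b - a = 0 ∨ b - a = -(t - a) := by decide +kernel
  exact ⟨-(t - p f), neg_ne_zero.2 (sub_ne_zero.2 (Ne.symm (ht f))), fun y => d _ _ _ (ht f) (ht y)⟩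

theorem exists_column_of_full [Finite ι] [Finite κ] {R : ι → κ → ZMod 3} (h : NF R) {e : ι}
    (he : ∀ y, R e y = 0) (htot : ∀ x z, Arrow (R x) (R z) ∨ Arrow (R z) (R x))
    (hfull : ∃ x, Full (R x)) : ∃ f, NoCore fun x y => R x y - R x f := by
  obtain ⟨⟨r, hr⟩, hsrc⟩ : ∃ r : {x // Full (R x)}, ∀ x : {x // Full (R x)},
      Arrow (R r.1) (R x.1) := by
    have : Nonempty {x // Full (R x)} := hfull.elim fun x hx => ⟨⟨x, hx⟩⟩
    exact exists_source (fun x z : {x // Full (R x)} => Arrow (R x.1) (R z.1))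
      (fun x z => htot _ _) fun x z w v h1 h2 h3 h4 h5 h6 h7 h8 h9 =>
        arrow_chain h he x.2 z.2 w.2 v.2 h1 h2 h3 h4 h5 h6 h7 h8 h9
  have hsh : ∀ x, ∃ k c s, Shaped (R r) (R x) k c s := by
    intro x
    by_cases hx : Full (R x)
    · exact (hsrc ⟨x, hx⟩).exists_shaped
    · exact (htot r x).elim Arrow.exists_shaped fun h' => h'.exists_shaped' hr hx
  choose k c s hsh using hsh
  obtain ⟨c₀, hc₀⟩ := exists_unblocked h he hr
  let C : ι → Set κ := fun x => coreSet (R r) (R x) (k x) (c x) (s x)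
  have hC : ∀ x, ∀ y ∈ C x, R r y = c x := by
    intro x y hy
    have d : ∀ k r c x : ZMod 3, core k.val (r - c).val x.val = true → r = c := by decide +kernel
    exact d _ _ _ _ hy
  obtain ⟨f, hf, hf'⟩ : ∃ f, R r f = c₀ ∧ ∀ x, c x = c₀ → (C x).Nonempty → f ∈ C x := by
    by_cases hne : ∃ x, c x = c₀ ∧ (C x).Nonempty
    · obtain ⟨x, ⟨hx, y, hy⟩, hmin⟩ := exists_minimalFor_of_wellFoundedLT
        (fun x => c x = c₀ ∧ (C x).Nonempty) (fun x => (C x).ncard) hne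
      refine ⟨y, (hC x y hy).trans hx, fun z hz hz' => ?_⟩
      rcases coreSet_chain h he hr (hsh x) (hsh z) (hx.trans hz.symm) with h1 | h1
      · exact h1 hy
      · have h2 := hmin ⟨hz, hz'⟩ (Set.ncard_le_ncard h1 (Set.toFinite _))
        exact (Set.eq_of_subset_of_ncard_le h1 h2 (Set.toFinite _)).superset hy
    · obtain ⟨f, hf⟩ := hr c₀
      exact ⟨f, hf, fun x hx hx' => (hne ⟨x, hx, hx'⟩).elim⟩
  refine ⟨f, noCore_of_rooted h he hr f fun x => rooted_of_shaped (hsh x) (hf ▸ hc₀ x) ?_⟩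
  exact fun h1 h2 => hf' x (h1.symm.trans hf) h2

theorem minimalReqs_holds [Finite κ] {a b d : κ → ZMod 3} {p : κ → ZMod 3} {v : ZMod 3}
    {q : ℕ → ℕ → ℕ} (hq : ∀ y, q (a y).val (b y).val = (p y).val)
    (hmin : {y | p y = v}.Nonempty → {y | p y = v} ≠ univ →
      {y | d y = 0}.ncard ≤ {y | p y = v}.ncard) :
    ∃ l ∈ minimalReqs v q, l.Holds (codes d a b 0) := by
  simp only [minimalReqs, exists_mem_cons, exists_mem_nil, ex_holds, al_holds, or_false,
    Bool.and_eq_true, Bool.or_eq_true, beq_iff_eq, hq, (ZMod.val_injective 3).eq_iff, val_eq_zero,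
    Bool.not_eq_true', beq_eq_false_iff_ne, ne_eq]
  by_contra! hcon
  obtain ⟨h1, ⟨y, h2, h2'⟩, z, h3⟩ := hcon
  have hlt : {y | p y = v} ⊂ {y | d y = 0} := ⟨h1, fun h => h2' (h h2)⟩
  exact (Set.ncard_lt_ncard hlt (Set.toFinite _)).not_ge
    (hmin ⟨z, h3⟩ fun h => h2' (h.symm ▸ mem_univ y : y ∈ {y | p y = v}))

theorem exists_column_of_not_full [Finite ι] [Finite κ] [Nonempty κ] {R : ι → κ → ZMod 3}
    (h : NF R) {e : ι} (he : ∀ y, R e y = 0) (hfull : ∀ x, ¬ Full (R x)) :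
    ∃ f, NoCore fun x y => R x y - R x f := by
  let P : ι × ZMod 3 → Prop := fun t => {y | R t.1 y = t.2}.Nonempty ∧ {y | R t.1 y = t.2} ≠ univ
  by_cases hne : ∃ t, P t
  · obtain ⟨⟨d, a⟩, ⟨⟨f, hf⟩, hd⟩, hmin⟩ := exists_minimalFor_of_wellFoundedLT P
      (fun t => {y | R t.1 y = t.2}.ncard) hne
    have hmin : ∀ x v, {y | R x y = v}.Nonempty → {y | R x y = v} ≠ univ →
        {y | R d y = a}.ncard ≤ {y | R x y = v}.ncard := fun x v h1 h2 =>
      (le_total _ _).elim id fun h3 => hmin (j := (x, v)) ⟨h1, h2⟩ h3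
    simp only [mem_ofPred_eq] at hf
    subst hf
    refine ⟨f, noCore_of_pairs fun t ht x z h1 h2 => ?_⟩
    have hs := search_minimal
    simp only [List.all_eq_true] at hs
    obtain ⟨k, hk, hdk⟩ := exists_two_values (hfull d) f
    obtain ⟨l, hl, hxl⟩ := exists_two_values (hfull x) f
    obtain ⟨j, hj, hzj⟩ := exists_two_values (hfull z) f
    have hz : ∀ k : ZMod 3, k ≠ 0 → k ∈ zs.tail := by decide
    have hmin' : ∀ x v, {y | R x y - R x f = v}.Nonempty → {y | R x y - R x f = v} ≠ univ →
        {y | R d y - R d f = 0}.ncard ≤ {y | R x y - R x f = v}.ncard := by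
      intro x v
      simpa only [sub_eq_iff_eq_add, zero_add] using hmin x (v + R x f)
    refine (h.rows e (RowOf.of_zero he d (R d f)) (RowOf.of_zero he x (R x f))
      (RowOf.of_zero he z (R z f)) (RowOf.zero _ _)).search_three (hs (k, l, j)
        (List.mem_product.2 ⟨hz _ hk, List.mem_product.2 ⟨hz _ hl, hz _ hj⟩⟩) t ht) ?_ ?_ ?_
    · intro y
      simp only [Bool.and_eq_true, Bool.or_eq_true, beq_iff_eq, (ZMod.val_injective 3).eq_iff,
        val_eq_zero]
      exact ⟨⟨hdk y, hxl y⟩, hzj y⟩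
    · simp only [List.mem_singleton, forall_eq]
      exact ⟨f, by simp [enc]⟩
    · simp only [List.forall_mem_cons, forall_mem_nil, and_true]
      refine ⟨?_, ?_, ?_, minimalReqs_holds (fun y => rfl) (hmin' x _),
        minimalReqs_holds (fun y => rfl) (hmin' x _), minimalReqs_holds (fun y => rfl) (hmin' z _),
        minimalReqs_holds (fun y => rfl) (hmin' z _)⟩
      · simpa only [exists_mem_cons, exists_mem_nil, ex_holds, or_false, beq_iff_eq,
          (ZMod.val_injective 3).eq_iff, Bool.and_eq_true] using h1
      · simpa only [exists_mem_cons, exists_mem_nil, ex_holds, or_false, beq_iff_eq,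
          (ZMod.val_injective 3).eq_iff, Bool.and_eq_true] using h2
      · obtain ⟨y, hy⟩ := (Set.ne_univ_iff_exists_notMem _).1 hd
        simp only [exists_mem_cons, exists_mem_nil, ex_holds, or_false,
          val_eq_zero, Bool.not_eq_true', beq_eq_false_iff_ne, ne_eq]
        exact ⟨y, fun h0 => hy (sub_eq_zero.1 h0)⟩
  · obtain ⟨f⟩ := ‹Nonempty κ›
    have hc : ∀ x y, R x y - R x f = 0 := by
      intro x y
      by_contra h0
      exact hne ⟨(x, R x f), ⟨f, rfl⟩, fun h1 => h0 (sub_eq_zero.2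
        (h1.symm ▸ mem_univ y : y ∈ {y | R x y = R x f}))⟩
    exact ⟨f, fun x z y y' _ _ => Or.inl (by simp only [hc])⟩

/-- The matrix can be normalised so that a row and a column vanish and no core remains. -/
theorem exists_normalised [Finite ι] [Finite κ] [Nonempty ι] [Nonempty κ] {L : ι → κ → ZMod 3}
    (h : NF L) : ∃ (u : ι → ZMod 3) (v : κ → ZMod 3) (e : ι) (f : κ),
      NF (fun x y => L x y + u x + v y) ∧ NoCore (fun x y => L x y + u x + v y) ∧
      (∀ y, L e y + u e + v y = 0) ∧ ∀ x, L x f + u x + v f = 0 := by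
  obtain ⟨e, he⟩ := exists_row h
  let R : ι → κ → ZMod 3 := fun x y => L x y - L e y
  have hR : NF R := h.congr_shift 0 (fun y => - L e y) fun x y => by simp [R, sub_eq_add_neg]
  have hRe : ∀ y, R e y = 0 := fun y => sub_self _
  obtain ⟨f, hf⟩ : ∃ f, NoCore fun x y => R x y - R x f := by
    by_cases hfull : ∃ x, Full (R x)
    · exact exists_column_of_full hR hRe he hfull
    · exact exists_column_of_not_full hR hRe (not_exists.1 hfull)
  have heq : (fun x y => L x y + -(R x f) + -(L e y)) = fun x y => R x y - R x f := by
    funext x y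
    simp only [R]
    ring
  refine ⟨fun x => -R x f, fun y => -L e y, e, f, h.shift _ _, heq ▸ hf, fun y => ?_, fun x => ?_⟩
  · simp [R]
  · simp only [R]; ring

end ChooseColumn

section Field

variable {ι κ F : Type*} [Field F]

/-- An isomorphism from `ZMod 3` to the multiplicative group of `F`. -/
structure IsExp (E : ZMod 3 → F) : Prop where
  zero : E 0 = 1
  add : ∀ i j, E (i + j) = E i * E j
  inj : Function.Injective E
  surj : ∀ a, a ≠ 0 → ∃ i, E i = a

theorem exists_isExp (hF : Nat.card F = 4) : ∃ E : ZMod 3 → F, IsExp E := by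
  have : Finite F := Nat.finite_of_card_ne_zero (by omega)
  have hc : Nat.card Fˣ = 3 := by rw [Nat.card_units, hF]
  have e : Multiplicative (ZMod (Nat.card Fˣ)) ≃* Fˣ := zmodCyclicMulEquiv inferInstance
  rw [hc] at e
  refine ⟨fun i => e (Multiplicative.ofAdd i), by simp, fun i j => by simp [ofAdd_add],
    fun i j h => ?_, fun a ha => ⟨(e.symm (Units.mk0 a ha)).toAdd, by simp⟩⟩
  simpa [Units.val_inj] using h

namespace IsExp

variable {E : ZMod 3 → F} (hE : IsExp E)
include hE

theorem ne_zero (i : ZMod 3) : E i ≠ 0 := by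
  intro h
  have h1 := hE.add i (-i)
  rw [add_neg_cancel, hE.zero, h, zero_mul] at h1
  exact one_ne_zero h1

theorem sum : 1 + E 1 + E 2 = 0 := by
  have h1 : E 2 = E 1 * E 1 := hE.add 1 1
  have h2 : E 1 * E 2 = 1 := (hE.add 1 2).symm.trans hE.zero
  have h3 : E 1 - 1 ≠ 0 := sub_ne_zero.2 fun h => by simpa using hE.inj (h.trans hE.zero.symm)
  refine (mul_eq_zero.1 (?_ : (E 1 - 1) * (1 + E 1 + E 2) = 0)).resolve_left h3
  linear_combination h2 - h1

theorem one_cube : E 1 ^ 3 = 1 := by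
  have h1 : E 2 = E 1 * E 1 := hE.add 1 1
  have h2 : E 1 * E 2 = 1 := (hE.add 1 2).symm.trans hE.zero
  linear_combination h2 - E 1 * h1

theorem cube {a : F} (ha : a ≠ 0) : a ^ 3 = 1 := by
  obtain ⟨i, rfl⟩ := hE.surj a ha
  rw [pow_three, ← hE.add, ← hE.add, ← hE.zero]
  congr 1
  clear ha
  revert i
  decide

theorem eq_add [CharP F 2] {a b c : F} (ha : a ≠ 0) (hb : b ≠ 0) (hab : a ≠ b) (hc : c ≠ 0)
    (hca : c ≠ a) (hcb : c ≠ b) : c = a + b := by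
  have h1 := hE.cube ha
  have h2 := hE.cube hb
  have h3 := hE.cube hc
  have h4 : a ^ 2 + a * b + b ^ 2 = 0 :=
    (mul_eq_zero.1 (by linear_combination h1 - h2 : (a - b) * _ = 0)).resolve_left
      (sub_ne_zero.2 hab)
  have h5 : a ^ 2 + a * c + c ^ 2 = 0 :=
    (mul_eq_zero.1 (by linear_combination h1 - h3 : (a - c) * _ = 0)).resolve_left
      (sub_ne_zero.2 hca.symm)
  have h6 : (b - c) * (a + b + c) = 0 := by linear_combination h4 - h5
  have h7 := (mul_eq_zero.1 h6).resolve_left (sub_ne_zero.2 hcb.symm)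
  rw [← CharTwo.neg_eq c]
  linear_combination -h7

theorem mul_eq_mul [CharP F 2] {a b c d : F} (ha : a ≠ 0) (hb : b ≠ 0) (hab : a ≠ b)
    (hc : c ≠ 0) (hd : d ≠ 0) (hcd : c ≠ d) (hac : a ≠ c) (hbd : b ≠ d) (h : a - b ≠ c - d) :
    a * d = b * c := by
  have h1 := hE.cube ha
  have h2 := hE.cube hb
  have h4 : a ^ 2 + a * b + b ^ 2 = 0 :=
    (mul_eq_zero.1 (by linear_combination h1 - h2 : (a - b) * _ = 0)).resolve_left
      (sub_ne_zero.2 hab)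
  have h0 : (2 : F) = 0 := CharTwo.two_eq_zero
  by_cases hcb : c = b
  · by_cases hda : d = a
    · exact (h (by rw [hcb, hda]; linear_combination (a - b) * h0)).elim
    · rw [hE.eq_add ha hb hab hd hda hbd.symm, hcb]
      linear_combination h4 - b ^ 2 * h0
  · have hc' := hE.eq_add ha hb hab hc hac.symm hcb
    by_cases hda : d = a
    · rw [hc', hda]
      linear_combination h4 - (a * b + b ^ 2) * h0
    · exact (hcd (hc'.trans (hE.eq_add ha hb hab hd hda hbd.symm).symm)).elim

theorem fourier [CharP F 2] {m₀ m₁ m₂ : F} (h0 : m₀ + m₁ + m₂ = 0)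
    (h1 : m₀ + m₁ * E 1 + m₂ * E 2 = 0) (h2 : m₀ + m₁ * E 2 + m₂ * E 1 = 0) :
    m₀ = 0 ∧ m₁ = 0 ∧ m₂ = 0 := by
  have hs := hE.sum
  have hc := hE.one_cube
  have h3 : E 2 = E 1 * E 1 := hE.add 1 1
  have ht : (2 : F) = 0 := CharTwo.two_eq_zero
  have e0 : m₀ = 0 := by
    linear_combination h0 + h1 + h2 - (m₁ + m₂) * hs - m₀ * ht
  rw [h3] at h1 h2 hs
  refine ⟨e0, ?_, ?_⟩
  · linear_combination h0 + (E 1) ^ 2 * h1 + E 1 * h2 - m₁ * ht - (m₂ + m₀) * hs -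
      (2 * m₁ + m₂ * E 1) * hc
  · linear_combination h0 + E 1 * h1 + E 1 ^ 2 * h2 - m₂ * ht - (m₁ + m₀) * hs -
      (2 * m₂ + m₁ * E 1) * hc

end IsExp

/-- The matrices represent a basis of the relaxation and the circuit-hyperplane. -/
def Twin (D A : ι → κ → F) : Prop :=
  ∀ (k : ℕ) (r : Fin k → ι) (c : Fin k → κ), 0 < k → Function.Injective r → Function.Injective c →
    ((∃ l : Fin k → F, l ≠ 0 ∧ ∀ s, ∑ t, l t * D (r s) (c t) = 0) ↔
      ∃ l : Fin k → F, l ≠ 0 ∧ ∑ t, l t = 0 ∧ ∃ a, ∀ s, ∑ t, l t * A (r s) (c t) = a)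

theorem Twin.ne_zero {D A : ι → κ → F} (h : Twin D A) (i : ι) (y : κ) : D i y ≠ 0 := by
  intro h0
  obtain ⟨l, hl, hl', -⟩ := (h 1 (fun _ => i) (fun _ => y) one_pos
    (Function.injective_of_subsingleton _) (Function.injective_of_subsingleton _)).1
    ⟨fun _ => 1, fun h => by simpa using congrFun h 0, fun _ => by simp [h0]⟩
  refine hl (funext fun i => ?_)
  rw [Subsingleton.elim i 0]
  simpa using hl'

section LogTwin

variable [CharP F 2] {E : ZMod 3 → F} {L : ι → κ → ZMod 3} {A : ι → κ → F}

theorem Twin.cross (h : Twin (fun i y => E (L i y)) A) (hE : IsExp E) (i j : ι) (y z : κ) :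
    L i y - L j y = L i z - L j z ↔ A i y - A j y = A i z - A j z := by
  by_cases hij : i = j
  · simp [hij]
  by_cases hyz : y = z
  · simp [hyz]
  have h2 := h 2 ![i, j] ![y, z] two_pos
    (by simpa [Function.Injective, Fin.forall_fin_two, eq_comm] using hij)
    (by simpa [Function.Injective, Fin.forall_fin_two, eq_comm] using hyz)
  simp only [Fin.sum_univ_two, Fin.forall_fin_two, Matrix.cons_val_zero, Matrix.cons_val_one] at h2
  have ht : (2 : F) = 0 := CharTwo.two_eq_zero
  constructor
  · intro h0
    have e1 : E (L i y) * E (L j z) = E (L i z) * E (L j y) := by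
      rw [← hE.add, ← hE.add]
      congr 1
      linear_combination h0
    obtain ⟨l, hl, hs, a, ha, hb⟩ := h2.1 ⟨![E (L i z), -E (L i y)],
      fun h => hE.ne_zero (L i z) (by simpa using congrFun h 0), by simp; ring, by
        simp only [Matrix.cons_val_zero, Matrix.cons_val_one]
        linear_combination -e1⟩
    have hl0 : l 0 ≠ 0 := fun h0 => hl (funext fun t => by
      fin_cases t
      · exact h0
      · simpa [h0] using hs)
    have h3 : l 0 * ((A i y - A j y) - (A i z - A j z)) = 0 := by
      linear_combination ha - hb - (A i z - A j z) * hs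
    exact sub_eq_zero.1 ((mul_eq_zero.1 h3).resolve_left hl0)
  · intro h0
    obtain ⟨l, hl, ha, hb⟩ := h2.2 ⟨fun _ => 1, fun h => by simpa using congrFun h 0,
      by linear_combination ht, A i y + A i z, by ring, by
        linear_combination h0 + (A j y - A i y) * ht⟩
    have h3 : E (L i y) * E (L j z) = E (L i z) * E (L j y) := by
      by_contra h3
      have h4 : l 0 * (E (L i y) * E (L j z) - E (L i z) * E (L j y)) = 0 := by
        linear_combination E (L j z) * ha - E (L i z) * hb
      have h5 : l 1 * (E (L i y) * E (L j z) - E (L i z) * E (L j y)) = 0 := by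
        linear_combination -E (L j y) * ha + E (L i y) * hb
      refine hl (funext fun t => ?_)
      fin_cases t
      · exact (mul_eq_zero.1 h4).resolve_right (sub_ne_zero.2 h3)
      · exact (mul_eq_zero.1 h5).resolve_right (sub_ne_zero.2 h3)
    rw [← hE.add, ← hE.add] at h3
    linear_combination hE.inj h3

end LogTwin

end Field

section Pairs

/-- The negation of `MidSplit` for the set of pairs `w`. -/
def unsplit (w : ZMod 3 → ZMod 3 → Bool) : Bool :=
  !(zs.any fun a => zs.any fun b =>
    (zs.all fun i => zs.all fun j => !(w i j) || i == a || j == b) ||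
    (zs.all fun i => zs.all fun j => !(w i j) || i == a || j - i == b) ||
    (zs.all fun i => zs.all fun j => !(w i j) || j == a || j - i == b))

def hasLine (w : ZMod 3 → ZMod 3 → Bool) : Bool :=
  zs.any fun a => zs.any fun b => w a b && w (a + 1) (b + 2) && w (a + 2) (b + 1)

def hasSquare (w : ZMod 3 → ZMod 3 → Bool) : Bool :=
  zs.any fun a => zs.any fun a' => zs.any fun b => zs.any fun b' =>
    !(a == a') && !(b == b') && (w a b && w a b' && w a' b && w a' b')

def tableOf (a b c d e f g h i : Bool) : ZMod 3 → ZMod 3 → Bool :=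
  ![![a, b, c], ![d, e, f], ![g, h, i]]

theorem unsplit_tableOf : ∀ a b c d e f g h i : Bool, !(unsplit (tableOf a b c d e f g h i)) ||
    hasLine (tableOf a b c d e f g h i) || hasSquare (tableOf a b c d e f g h i) ||
    hasSquare (fun p q => tableOf a b c d e f g h i p (q + p)) ||
    hasSquare (fun q p => tableOf a b c d e f g h i (q - p) q) = true := by
  decide +kernel

variable {κ : Type*}

/-- Columns on which `p` and `q` vary independently. -/
def Square (p q : κ → ZMod 3) : Prop :=
  ∃ y₁ y₂ y₃ y₄, p y₁ = p y₂ ∧ p y₃ = p y₄ ∧ p y₁ ≠ p y₃ ∧ q y₁ = q y₃ ∧ q y₂ = q y₄ ∧ q y₁ ≠ q y₂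

theorem square_of_hasSquare {p q : κ → ZMod 3} {w : ZMod 3 → ZMod 3 → Bool}
    (hw : ∀ i j, w i j = true → ∃ y, p y = i ∧ q y = j) (h : hasSquare w = true) :
    Square p q := by
  simp only [hasSquare, List.any_eq_true, Bool.and_eq_true, Bool.not_eq_true',
    beq_eq_false_iff_ne] at h
  obtain ⟨a, -, a', -, b, -, b', -, ⟨ha, hb⟩, ⟨⟨h1, h2⟩, h3⟩, h4⟩ := h
  obtain ⟨y₁, p1, q1⟩ := hw _ _ h1
  obtain ⟨y₂, p2, q2⟩ := hw _ _ h2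
  obtain ⟨y₃, p3, q3⟩ := hw _ _ h3
  obtain ⟨y₄, p4, q4⟩ := hw _ _ h4
  exact ⟨y₁, y₂, y₃, y₄, p1.trans p2.symm, p3.trans p4.symm, by rwa [p1, p3], q1.trans q3.symm,
    q2.trans q4.symm, by rwa [q1, q2]⟩

theorem of_not_midSplit {p q : κ → ZMod 3} (h : ¬ MidSplit p q) :
    (∃ y₀ y₁ y₂ a b, (p y₀ = a ∧ q y₀ = b) ∧ (p y₁ = a + 1 ∧ q y₁ = b + 2) ∧
      p y₂ = a + 2 ∧ q y₂ = b + 1) ∨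
      Square p q ∨ Square p (fun y => q y - p y) ∨ Square q fun y => q y - p y := by
  let w : ZMod 3 → ZMod 3 → Bool := fun i j => decide (∃ y, p y = i ∧ q y = j)
  have hw : ∀ i j, w i j = true ↔ ∃ y, p y = i ∧ q y = j := fun i j => decide_eq_true_iff
  have htab : tableOf (w 0 0) (w 0 1) (w 0 2) (w 1 0) (w 1 1) (w 1 2) (w 2 0) (w 2 1) (w 2 2)
      = w := by
    funext i j
    fin_cases i <;> fin_cases j <;> rfl
  have hun : unsplit w = true := by
    rw [unsplit, Bool.not_eq_true', ← Bool.not_eq_true]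
    intro hs
    refine h ?_
    simp only [List.any_eq_true, List.all_eq_true, Bool.or_eq_true, Bool.not_eq_true', beq_iff_eq,
      forall_mem_zs, exists_mem_zs, ← Bool.not_eq_true, hw, not_exists, not_and] at hs
    obtain ⟨a, b, (hs | hs) | hs⟩ := hs
    · exact ⟨a, b, Or.inl fun y => (hs _ _).elim (fun h' => Or.inl (h'.resolve_left
        fun h' => h' y rfl rfl)) Or.inr⟩
    · exact ⟨a, b, Or.inr (Or.inl fun y => (hs _ _).elim (fun h' => Or.inl (h'.resolve_left
        fun h' => h' y rfl rfl)) Or.inr)⟩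
    · exact ⟨a, b, Or.inr (Or.inr fun y => (hs _ _).elim (fun h' => Or.inl (h'.resolve_left
        fun h' => h' y rfl rfl)) Or.inr)⟩
  have hd := unsplit_tableOf (w 0 0) (w 0 1) (w 0 2) (w 1 0) (w 1 1) (w 1 2) (w 2 0) (w 2 1) (w 2 2)
  simp only [htab, hun, Bool.not_true, Bool.false_or, Bool.or_eq_true] at hd
  rcases hd with ((hd | hd) | hd) | hd
  · simp only [hasLine, List.any_eq_true, Bool.and_eq_true, hw] at hd
    obtain ⟨a, -, b, -, ⟨⟨y₀, p0, q0⟩, y₁, p1, q1⟩, y₂, p2, q2⟩ := hd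
    exact Or.inl ⟨y₀, y₁, y₂, a, b, ⟨p0, q0⟩, ⟨p1, q1⟩, p2, q2⟩
  · exact Or.inr (Or.inl (square_of_hasSquare (fun i j => (hw i j).1) hd))
  · refine Or.inr (Or.inr (Or.inl (square_of_hasSquare (fun i j hij => ?_) hd)))
    obtain ⟨y, h1, h2⟩ := (hw _ _).1 hij
    exact ⟨y, h1, by rw [h1, h2]; ring⟩
  · refine Or.inr (Or.inr (Or.inr (square_of_hasSquare (fun i j hij => ?_) (of_decide_eq_true hd))))
    obtain ⟨y, h1, h2⟩ := (hw _ _).1 hij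
    exact ⟨y, h2, by rw [h1, h2]; ring⟩

end Pairs

section NFTwin

variable {ι κ F : Type*} [Field F] [CharP F 2]

theorem not_square {L : ι → κ → ZMod 3} {A : ι → κ → F}
    (hcross : ∀ i j y z, L i y - L j y = L i z - L j z ↔ A i y - A j y = A i z - A j z)
    (i j k : ι) : ¬ Square (fun y => L j y - L i y) fun y => L k y - L i y := by
  rintro ⟨y₁, y₂, y₃, y₄, h1, h2, h3, h4, h5, h6⟩
  have d : ∀ a b a' b' : ZMod 3, a ≠ a' → b ≠ b' → (b - a = b' - a' ↔ ¬ b - a' = b' - a) := by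
    decide +kernel
  have hd := d _ _ _ _ h3 h6
  have c1 := hcross k j y₁ y₄
  have c2 := hcross k j y₃ y₂
  have e1 : L k y₁ - L j y₁ = L k y₄ - L j y₄ ↔ ¬ L k y₃ - L j y₃ = L k y₂ - L j y₂ := by
    rw [show L k y₁ - L j y₁ = L k y₁ - L i y₁ - (L j y₁ - L i y₁) by ring,
      show L k y₄ - L j y₄ = L k y₂ - L i y₂ - (L j y₃ - L i y₃) by linear_combination h2 - h5,
      show L k y₃ - L j y₃ = L k y₁ - L i y₁ - (L j y₃ - L i y₃) by linear_combination -h4,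
      show L k y₂ - L j y₂ = L k y₂ - L i y₂ - (L j y₁ - L i y₁) by linear_combination h1]
    exact hd
  rw [c1, c2] at e1
  have a1 := (hcross j i y₁ y₂).1 h1
  have a2 := (hcross j i y₃ y₄).1 h2
  have a4 := (hcross k i y₁ y₃).1 h4
  have a5 := (hcross k i y₂ y₄).1 h5
  have ht : (2 : F) = 0 := CharTwo.two_eq_zero
  have e2 : A k y₁ - A j y₁ = A k y₄ - A j y₄ ↔ A k y₃ - A j y₃ = A k y₂ - A j y₂ := by
    constructor
    · intro h
      linear_combination -h - a4 - a5 + a1 + a2 +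
        (A i y₃ - A j y₃ - A i y₂ + A j y₄ - A k y₄ + A k y₁ - A j y₁ + A j y₂) * ht
    · intro h
      linear_combination -h + a4 - a5 - a1 + a2 +
        (A j y₄ - A k y₄ + A k y₃ - A j y₃) * ht
  rw [e2] at e1
  exact iff_not_self e1

end NFTwin

section Lines

variable {ι κ F : Type*} [Field F] [CharP F 2] {E : ZMod 3 → F} {L : ι → κ → ZMod 3}
  {A : ι → κ → F}

theorem Square.congr {p q p' q' : κ → ZMod 3} (h : Square p q)
    (hp : ∀ y z, p y = p z ↔ p' y = p' z) (hq : ∀ y z, q y = q z ↔ q' y = q' z) :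
    Square p' q' := by
  obtain ⟨y₁, y₂, y₃, y₄, h1, h2, h3, h4, h5, h6⟩ := h
  exact ⟨y₁, y₂, y₃, y₄, (hp _ _).1 h1, (hp _ _).1 h2, fun h => h3 ((hp _ _).2 h), (hq _ _).1 h4,
    (hq _ _).1 h5, fun h => h6 ((hq _ _).2 h)⟩

theorem exists_line
    (hcross : ∀ i j y z, L i y - L j y = L i z - L j z ↔ A i y - A j y = A i z - A j z)
    {i j k : ι} (h : ¬ MidSplit (fun y => L j y - L i y) fun y => L k y - L i y) :
    ∃ y₀ y₁ y₂ a b, (L j y₀ - L i y₀ = a ∧ L k y₀ - L i y₀ = b) ∧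
      (L j y₁ - L i y₁ = a + 1 ∧ L k y₁ - L i y₁ = b + 2) ∧
      L j y₂ - L i y₂ = a + 2 ∧ L k y₂ - L i y₂ = b + 1 := by
  rcases of_not_midSplit h with h | h | h | h
  · exact h
  · exact (not_square hcross i j k h).elim
  · refine (not_square hcross j i k (h.congr (fun y z => ?_) fun y z => ?_)).elim <;>
    constructor <;> intro h <;> first | linear_combination h | linear_combination -h
  · refine (not_square hcross k i j (h.congr (fun y z => ?_) fun y z => ?_)).elim <;>
    constructor <;> intro h <;> first | linear_combination h | linear_combination -h

theorem line_det (hE : IsExp E)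
    (hcross : ∀ i j y z, L i y - L j y = L i z - L j z ↔ A i y - A j y = A i z - A j z)
    {i j k : ι} {y₀ y₁ y₂ : κ} {a b : ZMod 3} (h0 : L j y₀ - L i y₀ = a ∧ L k y₀ - L i y₀ = b)
    (h1 : L j y₁ - L i y₁ = a + 1 ∧ L k y₁ - L i y₁ = b + 2)
    (h2 : L j y₂ - L i y₂ = a + 2 ∧ L k y₂ - L i y₂ = b + 1) :
    A j y₁ - A i y₁ ≠ A j y₀ - A i y₀ ∧ A k y₁ - A i y₁ ≠ A k y₀ - A i y₀ ∧
    (A j y₁ - A i y₁ - (A j y₀ - A i y₀)) * (A k y₂ - A i y₂ - (A k y₀ - A i y₀)) =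
      (A j y₂ - A i y₂ - (A j y₀ - A i y₀)) * (A k y₁ - A i y₁ - (A k y₀ - A i y₀)) := by
  have n1 : ∀ c : ZMod 3, c + 1 ≠ c := by decide
  have n2 : ∀ c : ZMod 3, c + 2 ≠ c := by decide
  have n3 : ∀ c : ZMod 3, c + 1 ≠ c + 2 := by decide
  have hne : ∀ {i j : ι} {y z : κ}, L i y - L j y ≠ L i z - L j z →
      A i y - A j y ≠ A i z - A j z := fun {i j y z} => (hcross i j y z).not.1
  have a1 : A j y₁ - A i y₁ ≠ A j y₀ - A i y₀ := hne (by rw [h1.1, h0.1]; exact n1 a)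
  have a2 : A j y₂ - A i y₂ ≠ A j y₀ - A i y₀ := hne (by rw [h2.1, h0.1]; exact n2 a)
  have a3 : A j y₁ - A i y₁ ≠ A j y₂ - A i y₂ := hne (by rw [h1.1, h2.1]; exact n3 a)
  have a4 : A k y₁ - A i y₁ ≠ A k y₀ - A i y₀ := hne (by rw [h1.2, h0.2]; exact n2 b)
  have a5 : A k y₂ - A i y₂ ≠ A k y₀ - A i y₀ := hne (by rw [h2.2, h0.2]; exact n1 b)
  have a6 : A k y₁ - A i y₁ ≠ A k y₂ - A i y₂ := hne (by rw [h1.2, h2.2]; exact (n3 b).symm)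
  have e0 : L k y₀ - L j y₀ = b - a := by linear_combination h0.2 - h0.1
  have e1 : L k y₁ - L j y₁ = b - a + 1 := by linear_combination h1.2 - h1.1
  have e2 : L k y₂ - L j y₂ = b - a + 2 := by
    linear_combination h2.2 - h2.1 - (by decide : (3 : ZMod 3) = 0)
  have a7 : A k y₁ - A j y₁ ≠ A k y₀ - A j y₀ := hne (by rw [e1, e0]; exact n1 _)
  have a8 : A k y₂ - A j y₂ ≠ A k y₀ - A j y₀ := hne (by rw [e2, e0]; exact n2 _)
  have a9 : A k y₁ - A j y₁ ≠ A k y₂ - A j y₂ := hne (by rw [e1, e2]; exact n3 _)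
  refine ⟨a1, a4, hE.mul_eq_mul (sub_ne_zero.2 a1) (sub_ne_zero.2 a2) (sub_left_injective.ne a3)
    (sub_ne_zero.2 a4) (sub_ne_zero.2 a5) (sub_left_injective.ne a6) ?_ ?_ ?_⟩
  · intro h
    exact a7 (by linear_combination -h)
  · intro h
    exact a8 (by linear_combination -h)
  · intro h
    exact a9 (by linear_combination -h)

theorem injective_three {γ : Type*} {x y z : γ} (h1 : x ≠ y) (h2 : x ≠ z) (h3 : y ≠ z) :
    Function.Injective ![x, y, z] := by
  intro i j h
  fin_cases i <;> fin_cases j <;> simp_all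

theorem line_injective {i j k : ι} {y₀ y₁ y₂ : κ} {a b : ZMod 3}
    (h0 : L j y₀ - L i y₀ = a ∧ L k y₀ - L i y₀ = b)
    (h1 : L j y₁ - L i y₁ = a + 1 ∧ L k y₁ - L i y₁ = b + 2)
    (h2 : L j y₂ - L i y₂ = a + 2 ∧ L k y₂ - L i y₂ = b + 1) :
    Function.Injective ![i, j, k] ∧ Function.Injective ![y₀, y₁, y₂] := by
  have n1 : ∀ c : ZMod 3, c ≠ c + 1 := by decide
  have n2 : ∀ c : ZMod 3, c ≠ c + 2 := by decide
  have n3 : ∀ c : ZMod 3, c + 1 ≠ c + 2 := by decide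
  refine ⟨injective_three ?_ ?_ ?_, injective_three ?_ ?_ ?_⟩ <;> rintro rfl
  · exact n1 a (by rw [← h1.1, ← h0.1]; ring)
  · exact n2 b (by rw [← h1.2, ← h0.2]; ring)
  · exact n1 (b - a) (by linear_combination h0.1 - h0.2 - h1.1 + h1.2)
  · exact n1 a (h0.1.symm.trans h1.1)
  · exact n2 a (h0.1.symm.trans h2.1)
  · exact n3 a (h1.1.symm.trans h2.1)

theorem Twin.row (h : Twin (fun i y => E (L i y)) A) (hE : IsExp E) (i j k : ι) :
    MidSplit (fun y => L j y - L i y) fun y => L k y - L i y := by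
  by_contra hcon
  obtain ⟨y₀, y₁, y₂, a, b, h0, h1, h2⟩ := exists_line (h.cross hE) hcon
  obtain ⟨hr, hc⟩ := line_injective h0 h1 h2
  obtain ⟨d1, d2, d3⟩ := line_det hE (h.cross hE) h0 h1 h2
  have h3 := h 3 _ _ (by norm_num) hr hc
  simp only [Fin.sum_univ_three, Fin.forall_fin_succ, Matrix.cons_val_zero, Matrix.cons_val_one,
    Fin.succ_zero_eq_one, Fin.succ_one_eq_two, IsEmpty.forall_iff, and_true, Matrix.cons_val] at h3
  obtain ⟨l, hl, g0, g1, g2⟩ := h3.2 ⟨![A j y₁ - A i y₁ - (A j y₀ - A i y₀) -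
      (A j y₂ - A i y₂ - (A j y₀ - A i y₀)), A j y₂ - A i y₂ - (A j y₀ - A i y₀),
      -(A j y₁ - A i y₁ - (A j y₀ - A i y₀))],
    fun h => sub_ne_zero.2 d1 (neg_eq_zero.1 (congrFun h 2)), by
      simp only [Matrix.cons_val]
      ring, _, rfl, by
      simp only [Matrix.cons_val]
      ring, by
      simp only [Matrix.cons_val]
      linear_combination -d3⟩
  rw [sub_eq_iff_eq_add, sub_eq_iff_eq_add] at h0 h1 h2
  simp only [h0.1, h0.2, h1.1, h1.2, h2.1, h2.2, hE.add] at g1 g2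
  obtain ⟨m0, m1, m2⟩ := hE.fourier g0
    ((mul_eq_zero.1 (by linear_combination g1 : E a * _ = 0)).resolve_left (hE.ne_zero a))
    ((mul_eq_zero.1 (by linear_combination g2 : E b * _ = 0)).resolve_left (hE.ne_zero b))
  refine hl (funext fun t => ?_)
  fin_cases t
  · exact (mul_eq_zero.1 m0).resolve_right (hE.ne_zero _)
  · exact (mul_eq_zero.1 m1).resolve_right (hE.ne_zero _)
  · exact (mul_eq_zero.1 m2).resolve_right (hE.ne_zero _)

theorem Twin.col (h : Twin (fun i y => E (L i y)) A) (hE : IsExp E) (y z w : κ) :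
    MidSplit (fun i => L i z - L i y) fun i => L i w - L i y := by
  by_contra hcon
  have hcross : ∀ y z i j, L i y - L i z = L j y - L j z ↔ A i y - A i z = A j y - A j z := by
    intro y z i j
    refine Iff.trans ⟨fun h' => ?_, fun h' => ?_⟩ ((h.cross hE i j y z).trans
      ⟨fun h' => ?_, fun h' => ?_⟩) <;> linear_combination h'
  obtain ⟨i, j, k, a, b, h0, h1, h2⟩ :=
    exists_line (L := fun y i => L i y) (A := fun y i => A i y) hcross hcon
  obtain ⟨hc, hr⟩ := line_injective (L := fun y i => L i y) h0 h1 h2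
  obtain ⟨d1, d2, d3⟩ := line_det (L := fun y i => L i y) (A := fun y i => A i y) hE hcross h0 h1 h2
  have h3 := h 3 _ _ (by norm_num) hr hc
  simp only [Fin.sum_univ_three, Fin.forall_fin_succ, Matrix.cons_val_zero, Matrix.cons_val_one,
    Fin.succ_zero_eq_one, Fin.succ_one_eq_two, IsEmpty.forall_iff, and_true, Matrix.cons_val] at h3
  obtain ⟨l, hl, g0, g1, g2⟩ := h3.2 ⟨![A j z - A j y - (A i z - A i y) -
      (A j w - A j y - (A i w - A i y)), A j w - A j y - (A i w - A i y),
      -(A j z - A j y - (A i z - A i y))],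
    fun h => sub_ne_zero.2 d1 (neg_eq_zero.1 (congrFun h 2)), by
      simp only [Matrix.cons_val]
      ring, _, rfl, by
      simp only [Matrix.cons_val]
      ring, by
      simp only [Matrix.cons_val]
      linear_combination -d3⟩
  rw [sub_eq_iff_eq_add, sub_eq_iff_eq_add] at h0 h1 h2
  simp only [h0.1, h0.2, h1.1, h1.2, h2.1, h2.2, hE.add] at g0 g1 g2
  obtain ⟨m0, m1, m2⟩ := hE.fourier (m₀ := l 0) (m₁ := l 1 * E a) (m₂ := l 2 * E b)
    ((mul_eq_zero.1 (by linear_combination g0 : E (L i y) * _ = 0)).resolve_left (hE.ne_zero _))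
    ((mul_eq_zero.1 (by linear_combination g1 : E (L j y) * _ = 0)).resolve_left (hE.ne_zero _))
    ((mul_eq_zero.1 (by linear_combination g2 : E (L k y) * _ = 0)).resolve_left (hE.ne_zero _))
  refine hl (funext fun t => ?_)
  fin_cases t
  · exact m0
  · exact (mul_eq_zero.1 m1).resolve_right (hE.ne_zero _)
  · exact (mul_eq_zero.1 m2).resolve_right (hE.ne_zero _)

theorem eq_zero_of_pattern {B C G l : Fin 4 → F} (b1 : B 1 = B 3) (b2 : C 0 = C 2)
    (b3 : B 0 - C 0 = B 3 - C 3) (b4 : B 1 - C 1 = B 2 - C 2) (b5 : G 0 = G 1) (b6 : G 2 = G 3)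
    (b7 : G 0 - B 0 = G 2 - B 2) (b8 : B 2 ≠ B 0) (h : l 0 + l 1 + l 2 + l 3 = 0)
    (hB : l 0 * B 0 + l 1 * B 1 + l 2 * B 2 + l 3 * B 3 = 0)
    (hC : l 0 * C 0 + l 1 * C 1 + l 2 * C 2 + l 3 * C 3 = 0)
    (hG : l 0 * G 0 + l 1 * G 1 + l 2 * G 2 + l 3 * G 3 = 0) : l = 0 := by
  have ht : (2 : F) = 0 := CharTwo.two_eq_zero
  have hb : B 2 - B 0 ≠ 0 := sub_ne_zero.2 b8
  have h3 : l 2 + l 3 = 0 := (mul_eq_zero.1 (by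
    linear_combination hG + l 1 * b5 + l 3 * b6 - G 0 * h + (l 2 + l 3) * b7 :
      (B 2 - B 0) * (l 2 + l 3) = 0)).resolve_left hb
  have e1 : (B 1 - B 0) * l 1 + (B 2 - B 0) * l 2 + (B 1 - B 0) * l 3 = 0 := by
    linear_combination hB - B 0 * h + l 3 * b1
  have e2 : (B 1 - B 2) * l 1 + (B 1 - B 0) * l 3 = 0 := by
    linear_combination hC - C 0 * h + l 1 * (b4 + b2) + l 2 * b2 + l 3 * (b1 - b3)
  have h1 : l 1 = 0 := (mul_eq_zero.1 (by
    linear_combination -(B 1 - B 0) * (e1 - (B 1 - B 0) * h3) -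
      (B 2 - B 1) * (e2 - (B 1 - B 0) * h3) + (B 1 - B 0) * (B 2 - B 0) * l 1 * ht :
      (B 2 - B 0) ^ 2 * l 1 = 0)).resolve_left (pow_ne_zero 2 hb)
  have h2 : l 2 = 0 := (mul_eq_zero.1 (by
    linear_combination -(B 1 - B 2) * (e1 - (B 1 - B 0) * h3) +
      (B 1 - B 0) * (e2 - (B 1 - B 0) * h3) + (B 1 - B 0) * (B 2 - B 0) * l 2 * ht :
      (B 2 - B 0) ^ 2 * l 2 = 0)).resolve_left (pow_ne_zero 2 hb)
  have h0 : l 0 = 0 := by linear_combination h - h1 - h3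
  have h4 : l 3 = 0 := by linear_combination h3 - h2
  funext t
  fin_cases t
  exacts [h0, h1, h2, h4]

theorem Twin.four (h : Twin (fun i y => E (L i y)) A) (hE : IsExp E) (r : Fin 4 → ι)
    (c : Fin 4 → κ) (u : Fin 4 → ZMod 3) :
    ¬ ∀ i j, L (r i) (c j) - L (r 0) (c j) = u i + quad i j := by
  intro hq
  have hr : Function.Injective r := by
    have d : ∀ i j : Fin 4, ∀ v : ZMod 3, (∀ t, quad i t = v + quad j t) → i = j := by
      decide +kernel
    intro i j hij
    refine d i j (u j - u i) fun t => ?_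
    have h1 := hq i t
    rw [hij] at h1
    linear_combination hq j t - h1
  have hc : Function.Injective c := by
    have d : ∀ s t : Fin 4, (∀ i, quad i s = quad i t) → s = t := by decide +kernel
    intro s t hst
    refine d s t fun i => ?_
    have h1 := hq i s
    rw [hst] at h1
    linear_combination hq i t - h1
  have he : E 2 = E 1 * E 1 := hE.add 1 1
  have h1 := hE.one_cube
  have ht : (2 : F) = 0 := CharTwo.two_eq_zero
  have hq' : ∀ i j, E (-L (r 0) (c j)) * E (L (r i) (c j)) = E (u i) * E (quad i j) := by
    intro i j
    rw [← hE.add, ← hE.add, ← hq]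
    congr 1
    ring
  have h4 := h 4 r c (by norm_num) hr hc
  obtain ⟨l, hl, g0, a, g⟩ := h4.1 ⟨fun t => ![1, 1, E 1, E 1] t * E (-L (r 0) (c t)),
    fun h => hE.ne_zero (-L (r 0) (c 0)) (by simpa using congrFun h 0), fun s => by
      simp only [mul_assoc, hq', Fin.sum_univ_four, Matrix.cons_val]
      suffices hsum : E (quad s 0) + E (quad s 1) + E 1 * E (quad s 2) + E 1 * E (quad s 3) = 0 by
        linear_combination E (u s) * hsum
      fin_cases s <;> simp only [quad, hE.zero, he, Fin.zero_eta, Fin.mk_one, Fin.reduceFinMk,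
        Matrix.cons_val]
      · linear_combination (1 + E 1) * ht
      · linear_combination h1 + (1 + E 1) * ht
      · linear_combination h1 + (1 + E 1) * ht
      · linear_combination (E 1 + E 1 ^ 3) * ht⟩
  have hB : ∀ s i t t', L (r s) (c t) - L (r i) (c t) = L (r s) (c t') - L (r i) (c t') ↔
      A (r s) (c t) - A (r i) (c t) = A (r s) (c t') - A (r i) (c t') :=
    fun s i t t' => h.cross hE _ _ _ _
  have hL : ∀ s i t, L (r s) (c t) - L (r i) (c t) = u s - u i + (quad s t - quad i t) := by
    intro s i t
    linear_combination hq s t - hq i t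
  simp only [hL, add_right_inj] at hB
  have b1 := (hB 1 0 1 3).1 (by decide)
  have b2 := (hB 2 0 0 2).1 (by decide)
  have b3 := (hB 1 2 0 3).1 (by decide)
  have b4 := (hB 1 2 1 2).1 (by decide)
  have b5 := (hB 3 0 0 1).1 (by decide)
  have b6 := (hB 3 0 2 3).1 (by decide)
  have b7 := (hB 3 1 0 2).1 (by decide)
  have b8 := (hB 1 0 2 0).not.1 (by decide)
  simp only [Fin.sum_univ_four] at g g0
  have g1 := (g 1).trans (g 0).symm
  have g2 := (g 2).trans (g 0).symm
  have g3 := (g 3).trans (g 0).symm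
  refine hl (eq_zero_of_pattern (B := fun t => A (r 1) (c t) - A (r 0) (c t))
    (C := fun t => A (r 2) (c t) - A (r 0) (c t)) (G := fun t => A (r 3) (c t) - A (r 0) (c t))
    b1 b2 ?_ ?_ b5 b6 ?_ b8 g0 ?_ ?_ ?_)
  · linear_combination b3
  · linear_combination b4
  · linear_combination b7
  · linear_combination g1
  · linear_combination g2
  · linear_combination g3

theorem Twin.nf (h : Twin (fun i y => E (L i y)) A) (hE : IsExp E) : NF L :=
  ⟨h.row hE, h.col hE, h.four hE⟩

end Lines

section LinearAlgebra

variable {α ι F V : Type*} [Field F] [AddCommGroup V] [Module F V]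

theorem mem_span_image_iff_exists [Fintype ι] {v : ι → V} {S : Set ι} {z : V} :
    z ∈ Submodule.span F (v '' S) ↔ ∃ b : ι → F, (∀ x ∉ S, b x = 0) ∧ ∑ x, b x • v x = z := by
  constructor
  · intro hz
    rw [Finsupp.mem_span_image_iff_linearCombination] at hz
    obtain ⟨b, hb, rfl⟩ := hz
    refine ⟨b, fun x hx => ?_, ?_⟩
    · by_contra hne
      exact hx ((Finsupp.mem_supported F b).1 hb (Finsupp.mem_support_iff.2 hne))
    · rw [Finsupp.linearCombination_apply, Finsupp.sum_fintype _ _ (by simp)]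
  · rintro ⟨b, hb, rfl⟩
    refine Submodule.sum_mem _ fun x _ => ?_
    by_cases hx : x ∈ S
    · exact Submodule.smul_mem _ _ (Submodule.subset_span ⟨x, hx, rfl⟩)
    · simp [hb x hx]

theorem sum_mem_span_image [Fintype ι] {v : ι → V} (hv : LinearIndependent F v) {a : ι → F}
    {S : Set ι} : ∑ x, a x • v x ∈ Submodule.span F (v '' S) ↔ ∀ x ∉ S, a x = 0 := by
  rw [mem_span_image_iff_exists]
  refine ⟨fun ⟨b, hb, h⟩ x hx => ?_, fun h => ⟨a, h, rfl⟩⟩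
  have := Fintype.linearIndependent_iff.1 hv (fun x => b x - a x)
    (by simp only [sub_smul, Finset.sum_sub_distrib, h, sub_self]) x
  rw [← hb x hx, sub_eq_zero.1 this]

theorem add_sum_mem_span_image [Fintype ι] {v : ι → V} {c : ι → F} (hc : ∀ x, c x ≠ 0)
    (hv : ∀ b : ι → F, ∑ x, b x • v x = 0 ↔ ∃ a, ∀ x, b x = a * c x) {w : V}
    (hw : w ∉ Submodule.span F (range v)) {m : F} {a : ι → F} {S : Set ι} :
    m • w + ∑ x, (a x * c x) • v x ∈ Submodule.span F (v '' S) ↔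
      m = 0 ∧ ∃ d, ∀ x ∉ S, a x = d := by
  rw [mem_span_image_iff_exists]
  constructor
  · rintro ⟨b, hb, h⟩
    have hm : m = 0 := by
      by_contra hm
      refine hw ?_
      have hsum : ∀ e : ι → F, ∑ x, e x • v x ∈ Submodule.span F (range v) := fun e =>
        Submodule.sum_mem _ fun x _ => Submodule.smul_mem _ _ (Submodule.subset_span ⟨x, rfl⟩)
      rw [← Submodule.smul_mem_iff _ hm, eq_sub_of_add_eq h.symm]
      exact Submodule.sub_mem _ (hsum _) (hsum _)
    refine ⟨hm, ?_⟩
    rw [hm, zero_smul, zero_add] at h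
    obtain ⟨d, hd⟩ := (hv fun x => a x * c x - b x).1
      (by simp only [sub_smul, Finset.sum_sub_distrib, h, sub_self])
    refine ⟨d, fun x hx => mul_right_cancel₀ (hc x) ?_⟩
    rw [← hd x, hb x hx, sub_zero]
  · rintro ⟨rfl, d, hd⟩
    refine ⟨fun x => a x * c x - d * c x, fun x hx => by simp only [hd x hx, sub_self], ?_⟩
    simp only [sub_smul, Finset.sum_sub_distrib, (hv fun x => d * c x).2 ⟨d, fun _ => rfl⟩,
      sub_zero, zero_smul, zero_add]

theorem not_linearIndepOn_union_range {φ : α → V} {S : Set α} (hS : LinearIndepOn F φ S) {k : ℕ}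
    {c : Fin k → α} (hc : Function.Injective c) (hcS : ∀ t, c t ∉ S) :
    ¬ LinearIndepOn F φ (S ∪ range c) ↔
      ∃ l : Fin k → F, l ≠ 0 ∧ ∑ t, l t • φ (c t) ∈ Submodule.span F (φ '' S) := by
  have hd : Disjoint S (range c) := Set.disjoint_right.2 (by rintro _ ⟨t, rfl⟩; exact hcS t)
  rw [linearIndepOn_union_iff_quotient hd, and_iff_right hS, linearIndepOn_range_iff hc,
    Fintype.linearIndependent_iff]
  push Not
  refine exists_congr fun l => ?_
  rw [and_comm]
  refine and_congr Function.ne_iff.symm ?_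
  rw [← Submodule.Quotient.mk_eq_zero, ← Submodule.mkQ_apply, map_sum]
  simp only [map_smul, Function.comp_apply]

/-- The linear relations of a minimally dependent family form a line. -/
theorem exists_circuit_relation [Fintype ι] {v : ι → V} (hv : ¬ LinearIndependent F v)
    (hx : ∀ x, LinearIndepOn F v {x}ᶜ) :
    ∃ c : ι → F, (∀ x, c x ≠ 0) ∧
      ∀ b : ι → F, ∑ x, b x • v x = 0 ↔ ∃ a, ∀ x, b x = a * c x := by
  have key : ∀ b : ι → F, ∑ x, b x • v x = 0 → ∀ x, b x = 0 → b = 0 := by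
    intro b hb x hbx
    have h1 : LinearIndepOn F v (Finset.univ.erase x : Finset ι) := by
      simpa [Set.compl_eq_univ_sdiff] using hx x
    funext y
    by_cases hy : y = x
    · rw [hy, hbx]
      rfl
    · refine linearIndepOn_finset_iff.1 h1 b ?_ y (Finset.mem_erase.2 ⟨hy, Finset.mem_univ y⟩)
      rw [← hb, ← Finset.add_sum_erase _ _ (Finset.mem_univ x), hbx, zero_smul, zero_add]
  rw [Fintype.not_linearIndependent_iff] at hv
  obtain ⟨c, hc, x₀, hx₀⟩ := hv
  have hc0 : ∀ x, c x ≠ 0 := fun x hx => hx₀ (congrFun (key c hc x hx) x₀)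
  refine ⟨c, hc0, fun b => ⟨fun hb => ⟨b x₀ / c x₀, fun x => ?_⟩, ?_⟩⟩
  · have := key (fun x => b x - b x₀ / c x₀ * c x)
      (by simp only [sub_smul, Finset.sum_sub_distrib, hb, mul_smul, ← Finset.smul_sum, hc,
        smul_zero, sub_self]) x₀ (by rw [div_mul_cancel₀ _ hx₀, sub_self])
    exact sub_eq_zero.1 (congrFun this x)
  · rintro ⟨a, ha⟩
    simp only [ha, mul_smul, ← Finset.smul_sum, hc, smul_zero]

end LinearAlgebra

section Coordinates

variable {α F V : Type*} [Field F] [AddCommGroup V] [Module F V] {M M' : Matroid α} {X : Set α}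
  {φ : α → V}

theorem mem_span_iff_mem_closure (hφ : ∀ I ⊆ M.E, (M.Indep I ↔ LinearIndepOn F φ I)) {I : Set α}
    (hI : M.Indep I) {y : α} (hy : y ∈ M.E) :
    φ y ∈ Submodule.span F (φ '' I) ↔ y ∈ M.closure I := by
  have hsub : insert y I ⊆ M.E := insert_subset hy hI.subset_ground
  rw [((hφ I hI.subset_ground).1 hI).mem_span_iff, hI.mem_closure_iff, ← hφ _ hsub,
    ← not_indep_iff hsub]
  tauto

/-- If `D` holds the coordinates of the elements outside the basis `X`, then exchanging elements of
`X` for others yields a dependent set exactly when the corresponding submatrix of `D` is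
singular. -/
theorem not_indep_exchange_iff (hφ : ∀ I ⊆ M.E, (M.Indep I ↔ LinearIndepOn F φ I))
    (hX : M.Indep X) {Y : Set α} (hY : Y ⊆ M.E \ X) [Fintype X] {D : X → Y → F}
    (hD : ∀ y : Y, φ y = ∑ x : X, D x y • φ x) {k : ℕ} (r : Fin k → X)
    {c : Fin k → Y} (hc : Function.Injective c) :
    ¬ M.Indep (Subtype.val '' (range r)ᶜ ∪ range fun t => (c t : α)) ↔
      ∃ l : Fin k → F, l ≠ 0 ∧ ∀ s, ∑ t, l t * D (r s) (c t) = 0 := by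
  have hXE := hX.subset_ground
  have hsub : Subtype.val '' (range r)ᶜ ⊆ X := Subtype.coe_image_subset X _
  have hXi : LinearIndependent F fun x : X => φ x := (hφ X hXE).1 hX
  rw [hφ _ (union_subset (hsub.trans hXE) (range_subset_iff.2 fun t => (hY (c t).2).1)),
    not_linearIndepOn_union_range ((hφ _ (hsub.trans hXE)).1 (hX.subset hsub))
      (c := fun t => (c t : α)) (Subtype.val_injective.comp hc) fun t ht => (hY (c t).2).2 (hsub ht), image_image]
  refine exists_congr fun l => and_congr Iff.rfl ?_
  have hsum : ∑ t, l t • φ (c t) = ∑ x : X, (∑ t, l t * D x (c t)) • φ x := by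
    simp only [hD, Finset.smul_sum, Finset.sum_smul, smul_smul]
    exact Finset.sum_comm
  rw [hsum, sum_mem_span_image hXi]
  simp

/-- The analogue of `not_indep_exchange_iff` for a circuit-hyperplane `X`. -/
theorem not_indep_exchange_iff_of_circuit (hφ : ∀ I ⊆ M.E, (M.Indep I ↔ LinearIndepOn F φ I))
    (hX : Relax.Circuit M X) {Y : Set α} (hY : Y ⊆ M.E \ X) [Fintype X] {b : X → F} (hb : ∀ x, b x ≠ 0)
    (hrel : ∀ a : X → F, ∑ x, a x • φ x = 0 ↔ ∃ d, ∀ x, a x = d * b x) {w : V}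
    (hw : w ∉ Submodule.span F (φ '' X)) {A : X → Y → F} {μ : Y → F}
    (hμ : ∀ y, μ y ≠ 0)
    (hA : ∀ y : Y, φ y = μ y • w + ∑ x : X, (μ y * A x y * b x) • φ x) {k : ℕ}
    (hk : 0 < k) (r : Fin k → X) {c : Fin k → Y} (hc : Function.Injective c) :
    ¬ M.Indep (Subtype.val '' (range r)ᶜ ∪ range fun t => (c t : α)) ↔
      ∃ l : Fin k → F, l ≠ 0 ∧ ∑ t, l t = 0 ∧ ∃ a, ∀ s, ∑ t, l t * A (r s) (c t) = a := by
  have hXE := hX.1.subset_ground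
  have hsub : Subtype.val '' (range r)ᶜ ⊂ X := by
    refine ⟨Subtype.coe_image_subset X _, fun h => ?_⟩
    obtain ⟨x, hx, hxr⟩ := h (r ⟨0, hk⟩).2
    exact hx ⟨_, (Subtype.val_injective hxr).symm⟩
  rw [image_eq_range] at hw
  rw [hφ _ (union_subset (hsub.1.trans hXE) (range_subset_iff.2 fun t => (hY (c t).2).1)),
    not_linearIndepOn_union_range ((hφ _ (hsub.1.trans hXE)).1 (hX.2 _ hsub))
      (c := fun t => (c t : α)) (Subtype.val_injective.comp hc) fun t ht => (hY (c t).2).2 (hsub.1 ht), image_image]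
  have hsum : ∀ l : Fin k → F, ∑ t, l t • φ (c t) = (∑ t, l t * μ (c t)) • w +
      ∑ x : X, ((∑ t, l t * μ (c t) * A x (c t)) * b x) • φ x := by
    intro l
    simp only [hA, smul_add, Finset.smul_sum, Finset.sum_smul, smul_smul, Finset.sum_add_distrib,
      Finset.sum_mul, mul_assoc]
    rw [Finset.sum_comm]
  simp only [hsum, add_sum_mem_span_image hb hrel hw]
  constructor
  · rintro ⟨l, hl, h0, d, hd⟩
    refine ⟨fun t => l t * μ (c t), fun h => hl (funext fun t => ?_), h0, d, fun s => hd _ ?_⟩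
    · exact (mul_eq_zero.1 (congrFun h t)).resolve_right (hμ _)
    · simp
  · rintro ⟨l, hl, h0, d, hd⟩
    refine ⟨fun t => l t / μ (c t), fun h => hl (funext fun t => ?_), ?_, d, ?_⟩
    · exact (div_eq_zero_iff.1 (congrFun h t)).resolve_right (hμ _)
    · simpa only [div_mul_cancel₀ _ (hμ _)] using h0
    · simp only [div_mul_cancel₀ _ (hμ _)]
      intro x hx
      obtain ⟨s, rfl⟩ := not_not.1 hx
      exact hd s

theorem exists_coordinates (hφ : ∀ I ⊆ M.E, (M.Indep I ↔ LinearIndepOn F φ I))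
    (hX : M.IsBase X) {Y : Set α} (hY : Y ⊆ M.E \ X) [Fintype X] :
    ∃ D : X → Y → F, ∀ y : Y, φ y = ∑ x : X, D x y • φ x := by
  have h : ∀ y : Y, ∃ a : X → F, ∑ x : X, a x • φ x = φ y := by
    intro y
    have hy : φ y ∈ Submodule.span F (φ '' X) := by
      rw [mem_span_iff_mem_closure hφ hX.indep (hY y.2).1, hX.closure_eq]
      exact (hY y.2).1
    rw [image_eq_range, ← image_univ, mem_span_image_iff_exists] at hy
    obtain ⟨a, -, ha⟩ := hy
    exact ⟨a, ha⟩
  choose a ha using h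
  exact ⟨fun x y => a y x, fun y => (ha y).symm⟩

theorem notMem_span_of_circuitHyperplane
    (hφ : ∀ I ⊆ M.E, (M.Indep I ↔ LinearIndepOn F φ I)) (hX : Relax.CircuitHyperplane M X)
    {x : α} (hx : x ∈ X) :
    M.closure (X \ {x}) = X ∧ Submodule.span F (φ '' (X \ {x})) = Submodule.span F (φ '' X) ∧
      ∀ y ∈ M.E \ X, φ y ∉ Submodule.span F (φ '' X) := by
  obtain ⟨⟨hdep, hind⟩, hflat, -, -⟩ := hX
  have hI := hind _ (sdiff_singleton_ssubset.2 hx)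
  have hins : insert x (X \ {x}) = X := insert_sdiff_self_of_mem hx
  have hcl : M.closure (X \ {x}) = X := by
    rw [← M.closure_insert_eq_of_mem_closure (hI.mem_closure_iff.2 (Or.inl (hins.symm ▸ hdep))),
      hins, hflat.closure]
  have hspan : Submodule.span F (φ '' (X \ {x})) = Submodule.span F (φ '' X) := by
    refine le_antisymm (Submodule.span_mono (image_mono sdiff_subset)) (Submodule.span_le.2 ?_)
    rintro _ ⟨y, hy, rfl⟩
    exact (mem_span_iff_mem_closure hφ hI (hflat.subset_ground hy)).2 (hcl.symm ▸ hy)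
  refine ⟨hcl, hspan, fun y hy => ?_⟩
  rw [← hspan, mem_span_iff_mem_closure hφ hI hy.1, hcl]
  exact hy.2

theorem exists_coordinates_of_circuitHyperplane
    (hφ : ∀ I ⊆ M.E, (M.Indep I ↔ LinearIndepOn F φ I)) (hX : Relax.CircuitHyperplane M X) {Y : Set α} (hY : Y ⊆ M.E \ X)
    [Fintype X] :
    ∃ (b : X → F) (w : V) (A : X → Y → F) (μ : Y → F), (∀ x, b x ≠ 0) ∧
      (∀ a : X → F, ∑ x, a x • φ x = 0 ↔ ∃ d, ∀ x, a x = d * b x) ∧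
      w ∉ Submodule.span F (φ '' X) ∧ (∀ y, μ y ≠ 0) ∧
      ∀ y : Y, φ y = μ y • w + ∑ x : X, (μ y * A x y * b x) • φ x := by
  have hXE := hX.1.1.subset_ground
  obtain ⟨x, hx⟩ : X.Nonempty := hX.1.1.nonempty
  obtain ⟨y₀, hy₀⟩ : (M.E \ X).Nonempty :=
    sdiff_nonempty.2 fun h => hX.2.2.1 (hXE.antisymm h)
  obtain ⟨hcl, hspan, hnot⟩ := notMem_span_of_circuitHyperplane hφ hX hx
  obtain ⟨b, hb, hrel⟩ := exists_circuit_relation (F := F) (v := fun x : X => φ x)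
    (fun h => hX.1.1.not_indep ((hφ X hXE).2 h)) fun z => by
      have h := (hφ _ (sdiff_subset.trans hXE)).1 (hX.1.2 _ (sdiff_singleton_ssubset.2 z.2))
      refine LinearIndepOn.comp_of_image (v := φ) ?_ Subtype.val_injective.injOn
      refine h.mono ?_
      rintro _ ⟨y, hy, rfl⟩
      exact ⟨y.2, fun hyz => hy (Subtype.val_injective hyz)⟩
  have hI := hX.1.2 _ (sdiff_singleton_ssubset.2 hx)
  have hI' : M.Indep (insert y₀ (X \ {x})) := hI.insert_indep_iff.2 (Or.inl (hcl.symm ▸ hy₀))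
  have hcl' : M.closure (insert y₀ (X \ {x})) = M.E := by
    refine hX.2.2.2 _ (M.isFlat_closure _) ⟨?_, fun h => hy₀.2 (h ?_)⟩
    · rw [← hcl]
      exact M.closure_subset_closure (by rw [hcl]; exact subset_insert _ _)
    · exact M.mem_closure_of_mem (mem_insert _ _) hI'.subset_ground
  have hrep : ∀ y : Y, ∃ (m : F) (a : X → F), φ y = m • φ y₀ + ∑ x : X, a x • φ x := by
    intro y
    have hy : φ y ∈ Submodule.span F (φ '' insert y₀ (X \ {x})) := by
      rw [mem_span_iff_mem_closure hφ hI' (hY y.2).1, hcl']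
      exact (hY y.2).1
    rw [image_insert_eq, Submodule.mem_span_insert] at hy
    obtain ⟨m, z, hz, h⟩ := hy
    rw [hspan, image_eq_range, ← image_univ, mem_span_image_iff_exists] at hz
    obtain ⟨a, -, rfl⟩ := hz
    exact ⟨m, a, h⟩
  choose m a hma using hrep
  have hm : ∀ y, m y ≠ 0 := by
    intro y h0
    refine hnot y (hY y.2) ?_
    rw [hma, h0, zero_smul, zero_add]
    exact Submodule.sum_mem _ fun x _ =>
      Submodule.smul_mem _ _ (Submodule.subset_span ⟨x, x.2, rfl⟩)
  refine ⟨b, φ y₀, fun x y => a y x / (m y * b x), m, hb, hrel, hnot y₀ hy₀, hm, fun y => ?_⟩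
  rw [hma y]
  congr 1
  refine Finset.sum_congr rfl fun x _ => ?_
  congr 1
  have := hm y
  have := hb x
  field_simp

theorem indep_iff_of_isRelaxation (hrel : Relax.IsRelaxation M M' X) (hfin : X.Finite) {Z : Set α}
    (hcard : Z.ncard = X.ncard) (hZ : Z ≠ X) : M'.Indep Z ↔ M.Indep Z := by
  obtain ⟨-, -, hbase⟩ := hrel
  have hXb : M'.IsBase X := (hbase X).2 (Or.inr rfl)
  have key : ∀ B, M'.IsBase B → Z ⊆ B → Z = B := fun B hB hZB =>
    eq_of_subset_of_ncard_le hZB (by rw [hcard, hB.ncard_eq_ncard_of_isBase hXb])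
      (hXb.finite_of_finite hfin hB)
  constructor
  · intro h
    obtain ⟨B, hB, hZB⟩ := h.exists_isBase_superset
    obtain rfl := key B hB hZB
    exact (((hbase Z).1 hB).resolve_right hZ).indep
  · intro h
    obtain ⟨B, hB, hZB⟩ := h.exists_isBase_superset
    have hB' := (hbase B).2 (Or.inl hB)
    obtain rfl := key B hB' hZB
    exact hB'.indep

theorem ncard_exchange {Y : Set α} (hfin : X.Finite) (hd : Disjoint X Y) {k : ℕ} {r : Fin k → X}
    {c : Fin k → Y} (hr : Function.Injective r) (hc : Function.Injective c) :
    (Subtype.val '' (range r)ᶜ ∪ range fun t => (c t : α)).ncard = X.ncard := by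
  have := hfin.to_subtype
  have h1 : (range r).ncard = k := by
    rw [← image_univ, ncard_image_of_injective _ hr, ncard_univ, Nat.card_fin]
  have hc' : Function.Injective fun t => (c t : α) := Subtype.val_injective.comp hc
  have h2 : (range fun t => (c t : α)).ncard = k := by
    rw [← image_univ, ncard_image_of_injective _ hc', ncard_univ, Nat.card_fin]
  rw [ncard_union_eq (hd.mono (Subtype.coe_image_subset X _) (range_subset_iff.2 fun t => (c t).2))
    ((toFinite _).image _) (finite_range _), ncard_image_of_injective _ Subtype.val_injective, h2,
    ← Nat.card_coe_set_eq X, ← ncard_add_ncard_compl (range r), h1, add_comm]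

theorem exists_twin {V' : Type*} [AddCommGroup V'] [Module F V'] {φ' : α → V'}
    (hrel : Relax.IsRelaxation M M' X) [Fintype X]
    (hφ : ∀ I ⊆ M.E, (M.Indep I ↔ LinearIndepOn F φ I))
    (hφ' : ∀ I ⊆ M'.E, (M'.Indep I ↔ LinearIndepOn F φ' I)) :
    ∃ D A : X → ↥(M'.E \ X) → F, Twin D A ∧ ∀ y : ↥(M'.E \ X), φ' y = ∑ x : X, D x y • φ' x := by
  have hXb : M'.IsBase X := (hrel.2.2 X).2 (Or.inr rfl)
  have hY : M'.E \ X ⊆ M.E \ X := by rw [hrel.2.1]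
  obtain ⟨D, hD⟩ := exists_coordinates hφ' hXb Subset.rfl
  obtain ⟨b, w, A, μ, hb, hb', hw, hμ, hA⟩ :=
    exists_coordinates_of_circuitHyperplane hφ hrel.1 hY
  refine ⟨D, A, fun k r c hk hr hc => ?_, hD⟩
  rw [← not_indep_exchange_iff hφ' hXb.indep Subset.rfl hD r hc,
    ← not_indep_exchange_iff_of_circuit hφ hrel.1.1 hY hb hb' hw hμ hA hk r hc, not_iff_not]
  refine indep_iff_of_isRelaxation hrel X.toFinite
    (ncard_exchange X.toFinite disjoint_sdiff_right hr hc) fun h => ?_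
  exact (c ⟨0, hk⟩).2.2 (h.subset (Or.inr ⟨_, rfl⟩))

end Coordinates

theorem Twin.exists_log {ι κ F : Type*} [Field F] {D A : ι → κ → F} (h : Twin D A)
    {E : ZMod 3 → F} (hE : IsExp E) : ∃ L : ι → κ → ZMod 3, D = fun x y => E (L x y) := by
  choose L hL using fun x y => hE.surj (D x y) (h.ne_zero x y)
  exact ⟨L, funext fun x => funext fun y => (hL x y).symm⟩

section Rank

variable {α F V : Type*} [Field F] [AddCommGroup V] [Module F V] {M : Matroid α} {X : Set α}
  {φ : α → V}

theorem rk_le_ncard (hfin : M.E.Finite) (hφ : ∀ I ⊆ M.E, (M.Indep I ↔ LinearIndepOn F φ I))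
    {S : Set α} {T : Set V} (hT : T.Finite) (h : ∀ x ∈ S, φ x ∈ Submodule.span F T) :
    Relax.rk M S ≤ T.ncard := by
  refine csSup_le ⟨0, ∅, M.empty_indep, empty_subset _, ncard_empty _⟩ ?_
  rintro _ ⟨I, hI, hIS, rfl⟩
  have := (hfin.subset hI.subset_ground).fintype
  have := hT.fintype
  have := FiniteDimensional.span_of_finite F hT
  have hle : Submodule.span F (range fun x : I => φ x) ≤ Submodule.span F T :=
    Submodule.span_le.2 (range_subset_iff.2 fun x => h x (hIS x.2))
  have h1 := finrank_span_eq_card ((hφ I hI.subset_ground).1 hI)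
  rw [← Nat.card_coe_set_eq, Nat.card_eq_fintype_card, ← h1, ncard_eq_toFinset_card' T]
  exact (Submodule.finrank_mono hle).trans (finrank_span_le_card T)

theorem ncard_le_rk (hfin : M.E.Finite) (hX : M.Indep X) : X.ncard ≤ Relax.rk M M.E := by
  refine le_csSup ⟨M.E.ncard, ?_⟩ ⟨X, hX, hX.subset_ground, rfl⟩
  rintro _ ⟨I, -, hI, rfl⟩
  exact ncard_le_ncard hI hfin

theorem rk_le_of_factor (hfin : M.E.Finite)
    (hφ : ∀ I ⊆ M.E, (M.Indep I ↔ LinearIndepOn F φ I)) [Fintype X]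
    {D : X → ↥(M.E \ X) → F} (hD : ∀ y : ↥(M.E \ X), φ y = ∑ x : X, D x y • φ x) {S : Set α}
    (hS : S ⊆ M.E) {p : X → F} {q : ↥(M.E \ X) → F}
    (hpq : ∀ x : X, ↑x ∉ S → ∀ y : ↥(M.E \ X), ↑y ∈ S → D x y = p x * q y) :
    Relax.rk M S ≤ (X ∩ S).ncard + 1 := by
  let w : V := ∑ x : X, (if (x : α) ∈ S then 0 else p x) • φ x
  have hXS : (X ∩ S).Finite := hfin.subset (inter_subset_right.trans hS)
  refine (rk_le_ncard hfin hφ (T := insert w (φ '' (X ∩ S))) ((hXS.image φ).insert w) ?_).trans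
    ((ncard_insert_le _ _).trans (Nat.succ_le_succ (ncard_image_le hXS)))
  intro y hy
  by_cases hyX : y ∈ X
  · exact Submodule.subset_span (Or.inr ⟨y, ⟨hyX, hy⟩, rfl⟩)
  have hsplit : φ y = ∑ x : X, (if (x : α) ∈ S then D x ⟨y, hS hy, hyX⟩ else 0) • φ x +
      q ⟨y, hS hy, hyX⟩ • w := by
    rw [hD ⟨y, hS hy, hyX⟩, Finset.smul_sum, ← Finset.sum_add_distrib]
    refine Finset.sum_congr rfl fun x _ => ?_
    by_cases hx : (x : α) ∈ S
    · simp [hx]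
    · simp [hx, hpq x hx ⟨y, hS hy, hyX⟩ hy, smul_smul, mul_comm]
  rw [hsplit]
  refine Submodule.add_mem _ (Submodule.sum_mem _ fun x _ => ?_)
    (Submodule.smul_mem _ _ (Submodule.subset_span (mem_insert _ _)))
  by_cases hx : (x : α) ∈ S
  · exact Submodule.smul_mem _ _ (Submodule.subset_span (Or.inr ⟨x, ⟨x.2, hx⟩, rfl⟩))
  · simp [hx]

theorem threeSeparating_of_eliminated (hfin : M.E.Finite)
    (hφ : ∀ I ⊆ M.E, (M.Indep I ↔ LinearIndepOn F φ I)) (hX : M.Indep X) [Fintype X]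
    {E : ZMod 3 → F} (hE : IsExp E) {L : X → ↥(M.E \ X) → ZMod 3}
    (hL : ∀ y : ↥(M.E \ X), φ y = ∑ x : X, E (L x y) • φ x) {u : X → ZMod 3}
    {v : ↥(M.E \ X) → ZMod 3} {S : Set α} (hS : S ⊆ M.E)
    (h : Eliminated (fun x y => L x y + u x + v y) {x | ↑x ∈ S} {y | ↑y ∈ S}) :
    Relax.ThreeSeparating M (M.E \ S) := by
  refine ⟨sdiff_subset, ?_⟩
  rw [sdiff_sdiff_cancel_left hS]
  obtain ⟨hrow, hcol⟩ := h
  choose c hc using hrow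
  choose d hd using hcol
  have h1 := rk_le_of_factor hfin hφ hL hS
    (p := fun x => if h : ↑x ∈ S then 0 else E (c x h - u x)) (q := fun y => E (-v y))
    fun x hx y hy => by
      rw [dif_neg hx, ← hE.add]
      congr 1
      linear_combination hc x hx y hy
  have h2 := rk_le_of_factor hfin hφ hL (sdiff_subset (s := M.E) (t := S))
    (p := fun x => E (-u x)) (q := fun y => if h : ↑y ∈ S then 0 else E (d y h - v y))
    fun x hx y hy => by
      have hx' : ↑x ∈ S := by_contra fun h => hx ⟨hX.subset_ground x.2, h⟩
      rw [dif_neg hy.2, ← hE.add]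
      congr 1
      linear_combination hd y hy.2 x hx'
  have h3 := ncard_le_rk hfin hX
  have h4 : (X ∩ S).ncard + (X ∩ (M.E \ S)).ncard = X.ncard := by
    rw [← inter_sdiff_assoc, inter_eq_left.2 hX.subset_ground,
      ncard_inter_add_ncard_sdiff_eq_ncard X S (hfin.subset hX.subset_ground)]
  omega

theorem pathWidth3_of_nf (hfin : M.E.Finite)
    (hφ : ∀ I ⊆ M.E, (M.Indep I ↔ LinearIndepOn F φ I)) (hX : M.Indep X) [Fintype X] [Nonempty X]
    [Nonempty ↥(M.E \ X)] {E : ZMod 3 → F} (hE : IsExp E) {L : X → ↥(M.E \ X) → ZMod 3}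
    (hL : ∀ y : ↥(M.E \ X), φ y = ∑ x : X, E (L x y) • φ x) (h : NF L) :
    Relax.PathWidth3 M := by
  have := (hfin.subset (sdiff_subset (s := M.E) (t := X))).to_subtype
  obtain ⟨u, v, e, f, hNF, hcore, he, hf⟩ := exists_normalised h
  let G : Set α → Prop := fun S => S ⊆ M.E ∧
    Eliminated (fun x y => L x y + u x + v y) {x : X | ↑x ∈ S} {y : ↥(M.E \ X) | ↑y ∈ S}
  have hstep : ∀ S : Set α, S.Nonempty → G S → ∃ z ∈ S, G (S \ {z}) := by
    rintro S ⟨z, hz⟩ ⟨hSE, hS⟩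
    have hne : {x : X | ↑x ∈ S}.Nonempty ∨ {y : ↥(M.E \ X) | ↑y ∈ S}.Nonempty := by
      by_cases hzX : z ∈ X
      · exact Or.inl ⟨⟨z, hzX⟩, hz⟩
      · exact Or.inr ⟨⟨z, hSE hz, hzX⟩, hz⟩
    have hmem : ∀ {T : Set α} (r : T), {x : T | ↑x ∈ S \ {↑r}} = {x : T | ↑x ∈ S} \ {r} := by
      intro T r
      ext x
      simp [Subtype.ext_iff]
    have hnot : ∀ {T : Set α} {r : α}, r ∉ T → {x : T | ↑x ∈ S \ {r}} = {x : T | ↑x ∈ S} := by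
      intro T r hr
      ext x
      simp only [mem_ofPred_eq, mem_sdiff, mem_singleton_iff, and_iff_left_iff_imp]
      rintro - rfl
      exact hr x.2
    obtain ⟨r, hr, h'⟩ | ⟨y, hy, h'⟩ := Eliminated.step hNF hcore he hf hS hne
    · refine ⟨r, hr, sdiff_subset.trans hSE, ?_⟩
      rwa [hmem r, hnot fun h => h.2 r.2]
    · refine ⟨y, hy, sdiff_subset.trans hSE, ?_⟩
      rwa [hmem y, hnot y.2.2]
  obtain ⟨n, o, ho, hrange, hG⟩ := exists_fin_ordering G hstep M.E hfin
    ⟨Subset.rfl, fun x hx => (hx (hX.subset_ground x.2)).elim, fun y hy => (hy y.2.1).elim⟩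
  refine ⟨n, o, ho, hrange, fun t => ?_⟩
  have := threeSeparating_of_eliminated hfin hφ hX hE hL (hG t).1 (hG t).2
  rwa [sdiff_sdiff_cancel_left ((image_subset_range _ _).trans hrange.subset)] at this

end Rank

end RelaxPath

/-- Let `M` and `M'` be GF(4)-representable (finite) matroids such that `M'`
is obtained from `M` by relaxing a circuit-hyperplane `X` of `M`. Then `M'` has path width 3. -/
theorem statement0 {α : Type*} (M M' : Matroid α) (X : Set α)
    (hfin : M.E.Finite)
    (hrepM : Relax.Representable M Relax.GF4)
    (hrepM' : Relax.Representable M' Relax.GF4)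
    (hrel : Relax.IsRelaxation M M' X) :
    Relax.PathWidth3 M' := by
  obtain ⟨n, φ, hφ⟩ := hrepM
  obtain ⟨n', φ', hφ'⟩ := hrepM'
  have hXE : X ⊆ M.E := hrel.1.1.1.subset_ground
  have := (hfin.subset hXE).fintype
  have : Nonempty X := hrel.1.1.1.nonempty.to_subtype
  have : Nonempty ↥(M'.E \ X) := by
    rw [hrel.2.1]
    exact (sdiff_nonempty.2 fun h => hrel.1.2.2.1 (hXE.antisymm h)).to_subtype
  obtain ⟨E, hE⟩ := RelaxPath.exists_isExp (F := Relax.GF4) (GaloisField.card 2 2 two_ne_zero)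
  obtain ⟨D, A, hDA, hD⟩ := RelaxPath.exists_twin hrel hφ hφ'
  obtain ⟨L, rfl⟩ := hDA.exists_log hE
  exact RelaxPath.pathWidth3_of_nf (hrel.2.1 ▸ hfin) hφ' ((hrel.2.2 X).2 (Or.inr rfl)).indep hE hD
    (hDA.nf hE)
end

section
/- Let X be a circuit-hyperplane of a matroid M, and let M' be the relaxation of M at X. Let N be a set of matroids such that M' has an N-minor but M has no N-minor. Then M' is N-fragile; moreover, X is a basis of M' every element of which is nondeletable in M', and every element of E(M')−X is noncontractible in M'. -/
open Matroid Set
open scoped Classical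

namespace Relax

variable {α β : Type*}

theorem IsRelaxation.delete_singleton_eq {M M' : Matroid α} {X : Set α}
    (h : IsRelaxation M M' X) {a : α} (ha : a ∈ X) : delete M' {a} = delete M {a} := by
  obtain ⟨⟨hC, -⟩, hE, hB⟩ := h
  unfold delete
  rw [hE]
  refine Matroid.ext_indep rfl fun I hI ↦ ?_
  simp only [Matroid.restrict_ground_eq] at hI
  have haI : a ∉ I := fun h ↦ (hI h).2 rfl
  simp only [Matroid.restrict_indep_iff, hI, and_true]
  constructor
  · intro h
    obtain ⟨B, hBb, hIB⟩ := h.exists_isBase_superset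
    obtain hBM | rfl := (hB B).1 hBb
    · exact hBM.indep.subset hIB
    · exact hC.2 I ⟨hIB, fun h' ↦ haI (h' ha)⟩
  · intro h
    obtain ⟨B, hBb, hIB⟩ := h.exists_isBase_superset
    exact ((hB B).2 (Or.inl hBb)).indep.subset hIB

theorem CircuitHyperplane.isBase_insert_diff_singleton {M : Matroid α} {X : Set α}
    (h : CircuitHyperplane M X) {a f : α} (ha : a ∈ X) (hf : f ∈ M.E) (hfX : f ∉ X) :
    M.IsBase (insert f (X \ {a})) := by
  obtain ⟨hC, hF, -, hmax⟩ := h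
  have hI : M.Indep (X \ {a}) := hC.2 _ (Set.sdiff_singleton_ssubset.2 ha)
  have hcl : M.closure (X \ {a}) ⊆ X :=
    (M.closure_subset_closure Set.sdiff_subset).trans hF.closure.subset
  have hind : M.Indep (insert f (X \ {a})) :=
    hI.insert_indep_iff.2 (Or.inl ⟨hf, fun h' ↦ hfX (hcl h')⟩)
  have hacl : a ∈ M.closure (X \ {a}) := by
    refine hI.mem_closure_iff.2 (Or.inl ?_)
    rw [Set.insert_sdiff_singleton, Set.insert_eq_of_mem ha]
    exact hC.1
  have hfcl : f ∈ M.closure (insert f (X \ {a})) :=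
    M.mem_closure_of_mem (Set.mem_insert _ _) hind.subset_ground
  have hXcl : X ⊆ M.closure (insert f (X \ {a})) := by
    intro x hx
    obtain rfl | hxa := eq_or_ne x a
    · exact M.closure_subset_closure (Set.subset_insert _ _) hacl
    · exact M.mem_closure_of_mem (Or.inr ⟨hx, hxa⟩) hind.subset_ground
  exact hind.isBase_of_ground_subset_closure
    (hmax _ (M.isFlat_closure _) ⟨hXcl, fun h' ↦ hfX (h' hfcl)⟩).symm.subset

theorem IsRelaxation.contract_singleton_eq {M M' : Matroid α} {X : Set α}
    (h : IsRelaxation M M' X) {f : α} (hf : f ∈ M.E) (hfX : f ∉ X) :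
    contract M' {f} = contract M {f} := by
  obtain ⟨hX, hE, hB⟩ := h
  obtain ⟨a, ha⟩ := hX.1.1.nonempty
  unfold contract delete
  congr 1
  simp only [Matroid.dual_ground]
  rw [hE]
  refine Matroid.ext_indep rfl fun I hI ↦ ?_
  simp only [Matroid.restrict_ground_eq] at hI
  have hfI : f ∉ I := fun h ↦ (hI h).2 rfl
  have hIE : I ⊆ M.E := hI.trans Set.sdiff_subset
  simp only [Matroid.restrict_indep_iff, hI, and_true]
  rw [Matroid.dual_indep_iff_exists (hE ▸ hIE), Matroid.dual_indep_iff_exists hIE]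
  constructor
  · rintro ⟨B, hBb, hIB⟩
    obtain hBM | rfl := (hB B).1 hBb
    · exact ⟨B, hBM, hIB⟩
    · refine ⟨_, hX.isBase_insert_diff_singleton ha hf hfX, ?_⟩
      rw [Set.disjoint_insert_right]
      exact ⟨hfI, hIB.mono_right Set.sdiff_subset⟩
  · rintro ⟨B, hBb, hIB⟩
    exact ⟨B, (hB B).2 (Or.inl hBb), hIB⟩

theorem minorOf_iff_isMinor {M N : Matroid α} : MinorOf N M ↔ N ≤m M := by
  constructor
  · rintro ⟨C, D, -, -, -, h⟩
    exact ⟨C, D, h⟩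
  · intro h
    obtain ⟨C, D, hC, hD, hCD, rfl⟩ := h.exists_eq_contract_delete_disjoint
    exact ⟨C, D, hC, hD, hCD, rfl⟩

theorem delete_isMinor (M : Matroid α) (D : Set α) : delete M D ≤m M :=
  ⟨∅, D, by rw [Matroid.contract_empty]; rfl⟩

theorem contract_isMinor (M : Matroid α) (C : Set α) : contract M C ≤m M :=
  ⟨C, ∅, by rw [Matroid.delete_empty]; rfl⟩

theorem HasMinorIn.of_isMinor {M M₁ : Matroid α} {𝒩 : Set (Matroid β)}
    (h : HasMinorIn M₁ 𝒩) (hM : M₁ ≤m M) : HasMinorIn M 𝒩 := by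
  obtain ⟨N, hN, M₀, hM₀, hiso⟩ := h
  exact ⟨N, hN, M₀, minorOf_iff_isMinor.2 ((minorOf_iff_isMinor.1 hM₀).trans hM), hiso⟩

end Relax

/-- Let `X` be a circuit-hyperplane of a (finite) matroid `M`, and let `M'` be
the relaxation of `M` at `X`. Let `𝒩` be a set of matroids such that `M'` has an `𝒩`-minor but
`M` has no `𝒩`-minor. Then `M'` is `𝒩`-fragile; moreover, `X` is a basis of `M'` every element
of which is nondeletable in `M'`, and every element of `E(M') − X` is noncontractible in `M'`. -/
theorem statement2 {α β : Type*} (M M' : Matroid α) (X : Set α) (𝒩 : Set (Matroid β))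
    (hfin : M.E.Finite)
    (hrel : Relax.IsRelaxation M M' X)
    (hM' : Relax.HasMinorIn M' 𝒩) (hM : ¬ Relax.HasMinorIn M 𝒩) :
    Relax.Fragile M' 𝒩 ∧ M'.IsBase X ∧
      (∀ a ∈ X, ¬ Relax.HasMinorIn (Relax.delete M' {a}) 𝒩) ∧
      (∀ a ∈ M'.E \ X, ¬ Relax.HasMinorIn (Relax.contract M' {a}) 𝒩) := by
  have hdel : ∀ a ∈ X, ¬ Relax.HasMinorIn (Relax.delete M' {a}) 𝒩 := by
    intro a ha h
    rw [hrel.delete_singleton_eq ha] at h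
    exact hM (h.of_isMinor (Relax.delete_isMinor M {a}))
  have hcon : ∀ a ∈ M'.E \ X, ¬ Relax.HasMinorIn (Relax.contract M' {a}) 𝒩 := by
    rintro a ⟨ha, haX⟩ h
    rw [hrel.contract_singleton_eq (hrel.2.1 ▸ ha) haX] at h
    exact hM (h.of_isMinor (Relax.contract_isMinor M {a}))
  refine ⟨⟨hM', ?_⟩, (hrel.2.2 X).2 (Or.inr rfl), hdel, hcon⟩
  rintro a ha ⟨h₁, h₂⟩
  by_cases haX : a ∈ X
  · exact hdel a haX h₁
  · exact hcon a ⟨ha, haX⟩ h₂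
end
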